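/- Let (W_n) be a sequence of graphons with sup_n ‖W_n‖_∞ < ∞, let W be a graphon with δ_□(W_n, W) → 0, and let c > 0 be a constant. Let G(n, cW_n) be the random graph on [n] obtained by choosing X₁,…,X_n independently and uniformly from [0,1] and then, given X₁,…,X_n, joining each pair i < j independently with probability min{cW_n(X_i,X_j)/n, 1}. Then: (a) if c‖T_W‖ ≤ 1, the largest component of G(n,cW_n) has o_p(n) vertices; (b) if c‖T_W‖ > 1, the largest component has Θ(n) vertices whp; and (c) if W is irreducible, then C₁/n → ρ(cW) in probability and C₂ = o_p(n), where C₁ and C₂ are the numbers of vertices in the largest and second largest components of G(n,cW_n). -/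

import Mathlib

open MeasureTheory Filter Topology

noncomputable section

namespace Percolation

/-- The symmetrized lift of a two-variable real function to `Sym2`. If `f` is symmetric,
`sym2Val f s(a, b) = f a b`. -/
def sym2Val {α : Type*} (f : α → α → ℝ) : Sym2 α → ℝ :=
  Sym2.lift ⟨fun a b => (f a b + f b a) / 2, fun a b => by simp [add_comm]⟩

/-- The product over the edges of `F` of a symmetric function of the endpoints. -/
def edgeProd {k : ℕ} (F : SimpleGraph (Fin k)) (f : Fin k → Fin k → ℝ) : ℝ := by
  classical exact ∏ e ∈ F.edgeFinset, sym2Val f e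

/-- The homomorphism density `t(F, G)` of a finite simple graph `F` in the weighted graph
on `[n]` with edge weights `β`. -/
def homDensityG {n k : ℕ} (β : Fin n → Fin n → ℝ) (F : SimpleGraph (Fin k)) : ℝ :=
  (∑ v : Fin k → Fin n, edgeProd F fun i j => β (v i) (v j)) / (n : ℝ) ^ k

/-- The unit interval `[0,1] ⊆ ℝ`. -/
def I01 : Set ℝ := Set.Icc 0 1

/-- The homomorphism density `t(F, W)` of a finite simple graph `F` in a graphon `W`. -/
def homDensityW {k : ℕ} (W : ℝ → ℝ → ℝ) (F : SimpleGraph (Fin k)) : ℝ :=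
  ∫ x : Fin k → ℝ in Set.univ.pi fun _ => I01, edgeProd F fun i j => W (x i) (x j)

/-- `G_n → W`: convergence of the homomorphism densities for every finite simple graph. -/
def ConvergesTo (β : ∀ n : ℕ, Fin n → Fin n → ℝ) (W : ℝ → ℝ → ℝ) : Prop :=
  ∀ (k : ℕ) (F : SimpleGraph (Fin k)),
    Tendsto (fun n => homDensityG (β n) F) atTop (nhds (homDensityW W F))

/-- `W` is a graphon: a bounded symmetric measurable function with nonnegative values. -/
def IsGraphon (W : ℝ → ℝ → ℝ) : Prop :=
  Measurable (Function.uncurry W) ∧ (∀ x y, 0 ≤ W x y) ∧ (∀ x y, W x y = W y x) ∧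
    ∃ M : ℝ, ∀ x y, W x y ≤ M

/-- The Bernoulli measure on `Bool` with success probability `p`. -/
def bern (p : ℝ) : Measure Bool :=
  ENNReal.ofReal p • Measure.dirac true + ENNReal.ofReal (1 - p) • Measure.dirac false

/-- The law of the random graph in which each pair `{v, w}` is an edge independently
with probability `min (p * β v w) 1`; a point of the sample space records for each
unordered pair whether it is an edge. -/
def percMeasure {V : Type*} [Fintype V] [DecidableEq V] (β : V → V → ℝ) (p : ℝ) :
    Measure (Sym2 V → Bool) :=
  Measure.pi fun e => bern (min (p * sym2Val β e) 1)

/-- The simple graph determined by a point of the sample space. -/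
def graphOf {V : Type*} (ω : Sym2 V → Bool) : SimpleGraph V :=
  SimpleGraph.fromRel fun i j => ω s(i, j)

/-- The number of vertices of the component of `v` in `G`. -/
def compSize {V : Type*} (G : SimpleGraph V) (v : V) : ℕ := {w | G.Reachable v w}.ncard

/-- The number of vertices of the largest component of `G`. -/
def C1 {V : Type*} [Fintype V] (G : SimpleGraph V) : ℕ :=
  Finset.univ.sup fun v => compSize G v

/-- The number of vertices of the second largest component of `G` (zero if `G` is
connected): the largest value of `min (|C_v|, |C_w|)` over vertices `v`, `w` lying in
distinct components. -/
def C2 {V : Type*} (G : SimpleGraph V) : ℕ :=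
  sSup {m | ∃ v w : V, ¬G.Reachable v w ∧ m = min (compSize G v) (compSize G w)}

/-- The operator `T_W` with kernel `W` applied to `f`. -/
def applyT (W : ℝ → ℝ → ℝ) (f : ℝ → ℝ) (x : ℝ) : ℝ := ∫ y in I01, W x y * f y

/-- The `L²[0,1]` norm of a function. -/
def l2norm (f : ℝ → ℝ) : ℝ := Real.sqrt (∫ x in I01, f x ^ 2)

/-- The `L²`-operator norm `‖T_W‖` of the integral operator with kernel `W`. -/
def opNorm (W : ℝ → ℝ → ℝ) : ℝ :=
  sSup {r | ∃ f : ℝ → ℝ, Measurable f ∧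
    MeasureTheory.IntegrableOn (fun x => f x ^ 2) I01 ∧
    l2norm f ≤ 1 ∧ r = l2norm (applyT W f)}

/-- The survival probability `ρ(W)` of the multitype Poisson branching process with
kernel `W`: the supremum of `∫ f` over measurable `f : [0,1] → [0,1]` satisfying the
functional equation `f(x) = 1 - exp(-∫ W(x,y) f(y) dy)` almost everywhere. -/
def survival (W : ℝ → ℝ → ℝ) : ℝ :=
  sSup {r | ∃ f : ℝ → ℝ, Measurable f ∧ (∀ x, f x ∈ Set.Icc (0 : ℝ) 1) ∧
    (∀ᵐ x ∂volume.restrict I01, f x = 1 - Real.exp (-∫ y in I01, W x y * f y)) ∧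
    r = ∫ x in I01, f x}

/-- A graphon `W` is irreducible if there is no measurable `A ⊆ [0,1]` with
`0 < μ(A) < 1` such that `W = 0` a.e. on `A × ([0,1] \ A)`. -/
def Irreducible (W : ℝ → ℝ → ℝ) : Prop :=
  ¬∃ A : Set ℝ, MeasurableSet A ∧ A ⊆ I01 ∧ 0 < volume A ∧ volume A < 1 ∧
    ∀ᵐ p : ℝ × ℝ, p.1 ∈ A → p.2 ∈ I01 \ A → W p.1 p.2 = 0

end Percolation
namespace Percolation

open MeasureTheory Filter Topology

/-- The cut norm `‖U‖_□` of a kernel on `[0,1]²`. -/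
def cutNorm (U : ℝ → ℝ → ℝ) : ℝ :=
  sSup {r | ∃ A B : Set ℝ, MeasurableSet A ∧ MeasurableSet B ∧ A ⊆ I01 ∧ B ⊆ I01 ∧
    r = |∫ x in A, ∫ y in B, U x y|}

/-- The cut metric `δ_□(U, V)`: the infimum over measure-preserving bijections `φ` of
`[0,1]` of the cut norm of `U - V^φ`. -/
def cutDist (U V : ℝ → ℝ → ℝ) : ℝ :=
  sInf {r | ∃ φ : ℝ → ℝ,
    MeasurePreserving φ (volume.restrict I01) (volume.restrict I01) ∧
    Set.BijOn φ I01 I01 ∧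
    r = cutNorm fun x y => U x y - V (φ x) (φ y)}

/-- The sample space for `G(n, κ)`: independent uniform types `X_i ∈ [0,1]` for each
vertex together with an independent uniform `[0,1]` label for each unordered pair of
vertices (used to decide the presence of edges). -/
def gnwMeasure (n : ℕ) : Measure ((Fin n → ℝ) × (Sym2 (Fin n) → ℝ)) :=
  (Measure.pi fun _ => volume.restrict I01).prod (Measure.pi fun _ => volume.restrict I01)

/-- The random graph `G(n, κ)`: given types `ω.1` and uniform edge labels `ω.2`, the
pair `ij` is an edge iff its label is below `min (κ (X_i) (X_j) / n) 1`, so that edges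
appear independently with probabilities `min (κ (X_i) (X_j) / n) 1` given the types. -/
def gnwGraph {n : ℕ} (κ : ℝ → ℝ → ℝ) (ω : (Fin n → ℝ) × (Sym2 (Fin n) → ℝ)) :
    SimpleGraph (Fin n) :=
  SimpleGraph.fromRel fun i j => ω.2 s(i, j) < min (κ (ω.1 i) (ω.1 j) / n) 1

end Percolation

open MeasureTheory Filter Topology
noncomputable section
namespace Percolation

def lam : Measure ℝ := volume.restrict I01

instance lam_prob : IsProbabilityMeasure lam := ⟨by simp [lam, I01]⟩

structure Ker (k : ℝ → ℝ → ℝ) (K : ℝ) : Prop where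
  meas : Measurable (Function.uncurry k)
  nn : ∀ x y, 0 ≤ k x y
  sym : ∀ x y, k x y = k y x
  le : ∀ x y, k x y ≤ K

def TT (k : ℝ → ℝ → ℝ) (f : ℝ → ℝ) (x : ℝ) : ℝ := ∫ y, k x y * f y ∂lam

def qq (k : ℝ → ℝ → ℝ) : ℕ → ℝ → ℝ
  | 0 => fun _ => 1
  | h + 1 => fun x => 1 - Real.exp (-(TT k (qq k h) x))

def rho (k : ℝ → ℝ → ℝ) (x : ℝ) : ℝ := ⨅ h, qq k h x

theorem bint {α : Type*} [MeasurableSpace α] {μ : Measure α} [IsFiniteMeasure μ] {f : α → ℝ}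
    (hf : Measurable f) (C : ℝ) (h : ∀ x, |f x| ≤ C) : Integrable f μ :=
  Integrable.of_bound hf.aestronglyMeasurable C (ae_of_all _ h)

section
variable {k : ℝ → ℝ → ℝ} {K : ℝ} (hk : Ker k K)
include hk

theorem Ker.K0 : 0 ≤ K := (hk.nn 0 0).trans (hk.le 0 0)

theorem Ker.m1 (x : ℝ) : Measurable (k x) := hk.meas.comp measurable_prodMk_left

theorem Ker.m2 (y : ℝ) : Measurable (fun x => k x y) := hk.meas.comp measurable_prodMk_right

theorem Ker.abs (x y : ℝ) : |k x y| ≤ K := by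
  rw [abs_of_nonneg (hk.nn x y)]; exact hk.le x y

theorem Ker.int {f : ℝ → ℝ} (hf : Measurable f) (C : ℝ) (h : ∀ x, |f x| ≤ C) (x : ℝ) :
    Integrable (fun y => k x y * f y) lam := by
  refine bint ((hk.m1 x).mul hf) (K * C) fun y => ?_
  rw [abs_mul]; exact mul_le_mul (hk.abs x y) (h y) (abs_nonneg _) hk.K0

theorem Ker.Tmeas {f : ℝ → ℝ} (hf : Measurable f) : Measurable (TT k f) := by
  have : StronglyMeasurable (Function.uncurry fun x y => k x y * f y) :=
    (hk.meas.mul (hf.comp measurable_snd)).stronglyMeasurable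
  exact this.integral_prod_right.measurable

theorem Ker.Tnn {f : ℝ → ℝ} (h0 : ∀ x, 0 ≤ f x) (x : ℝ) : 0 ≤ TT k f x :=
  integral_nonneg fun y => mul_nonneg (hk.nn x y) (h0 y)

theorem Ker.Tmono {f g : ℝ → ℝ} (hf : Measurable f) (hg : Measurable g) (C : ℝ)
    (hfC : ∀ x, |f x| ≤ C) (hgC : ∀ x, |g x| ≤ C) (h : ∀ᵐ x ∂lam, f x ≤ g x) (x : ℝ) :
    TT k f x ≤ TT k g x := by
  refine integral_mono_ae (hk.int hf C hfC x) (hk.int hg C hgC x) ?_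
  filter_upwards [h] with y hy using mul_le_mul_of_nonneg_left hy (hk.nn x y)

theorem Ker.Tle {f : ℝ → ℝ} (hf : Measurable f) (C : ℝ)
    (hfC : ∀ x, |f x| ≤ C) (h0 : ∀ x, 0 ≤ f x) (x : ℝ) : TT k f x ≤ K * ∫ y, f y ∂lam := by
  rw [← integral_const_mul]
  refine integral_mono (hk.int hf C hfC x) ((bint hf C hfC).const_mul _) fun y => ?_
  exact mul_le_mul_of_nonneg_right (hk.le x y) (h0 y)

theorem Ker.q01 (h : ℕ) : Measurable (qq k h) ∧ ∀ x, 0 ≤ qq k h x ∧ qq k h x ≤ 1 := by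
  induction h with
  | zero => exact ⟨measurable_const, fun x => ⟨zero_le_one, le_refl _⟩⟩
  | succ h ih =>
    refine ⟨measurable_const.sub (Real.measurable_exp.comp (hk.Tmeas ih.1).neg), fun x => ?_⟩
    have := hk.Tnn (fun x => (ih.2 x).1) x
    have h2 := Real.exp_le_one_iff.2 (neg_nonpos.2 this)
    have h3 := Real.exp_pos (-(TT k (qq k h) x))
    simp only [qq]
    constructor <;> linarith

theorem Ker.qabs (h : ℕ) (x : ℝ) : |qq k h x| ≤ 1 := by
  rw [abs_of_nonneg ((hk.q01 h).2 x).1]; exact ((hk.q01 h).2 x).2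

theorem Ker.qanti1 (h : ℕ) (x : ℝ) : qq k (h + 1) x ≤ qq k h x := by
  induction h generalizing x with
  | zero => exact ((hk.q01 1).2 x).2
  | succ h ih =>
    have := hk.Tmono (hk.q01 (h+1)).1 (hk.q01 h).1 1 (hk.qabs _) (hk.qabs _) (ae_of_all _ ih) x
    change 1 - Real.exp (-(TT k (qq k (h+1)) x)) ≤ 1 - Real.exp (-(TT k (qq k h) x))
    have := Real.exp_le_exp.2 (neg_le_neg this)
    linarith

theorem Ker.qanti (x : ℝ) : Antitone fun h => qq k h x :=
  antitone_nat_of_succ_le fun h => hk.qanti1 h x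

theorem Ker.qbdd (x : ℝ) : BddBelow (Set.range fun h => qq k h x) :=
  ⟨0, by rintro _ ⟨h, rfl⟩; exact ((hk.q01 h).2 x).1⟩

theorem Ker.qtend (x : ℝ) : Tendsto (fun h => qq k h x) atTop (𝓝 (rho k x)) :=
  tendsto_atTop_ciInf (hk.qanti x) (hk.qbdd x)

theorem Ker.rmeas : Measurable (rho k) := Measurable.iInf fun h => (hk.q01 h).1

theorem Ker.r0 (x : ℝ) : 0 ≤ rho k x := le_ciInf fun h => ((hk.q01 h).2 x).1

theorem Ker.rq (h : ℕ) (x : ℝ) : rho k x ≤ qq k h x := ciInf_le (hk.qbdd x) h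

theorem Ker.r1 (x : ℝ) : rho k x ≤ 1 := hk.rq 0 x

theorem Ker.rabs (x : ℝ) : |rho k x| ≤ 1 := by
  rw [abs_of_nonneg (hk.r0 x)]; exact hk.r1 x

theorem Ker.Ttend {f : ℕ → ℝ → ℝ} {g : ℝ → ℝ} (hf : ∀ n, Measurable (f n)) (C : ℝ)
    (hC : ∀ n x, |f n x| ≤ C) (h : ∀ᵐ x ∂lam, Tendsto (fun n => f n x) atTop (𝓝 (g x))) (x : ℝ) :
    Tendsto (fun n => TT k (f n) x) atTop (𝓝 (TT k g x)) := by
  refine tendsto_integral_of_dominated_convergence (fun _ => K * C)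
    (fun n => ((hk.m1 x).mul (hf n)).aestronglyMeasurable) (integrable_const _) (fun n => ?_) ?_
  · refine ae_of_all _ fun y => ?_
    rw [Real.norm_eq_abs, abs_mul]; exact mul_le_mul (hk.abs x y) (hC n y) (abs_nonneg _) hk.K0
  · filter_upwards [h] with y hy using hy.const_mul _

theorem Ker.req (x : ℝ) : rho k x = 1 - Real.exp (-(TT k (rho k) x)) := by
  have h1 := (hk.qtend x).comp (tendsto_add_atTop_nat 1)
  have h2 := hk.Ttend (fun h => (hk.q01 h).1) 1 hk.qabs (ae_of_all _ hk.qtend) x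
  have h3 : Tendsto (fun h => qq k (h + 1) x) atTop (𝓝 (1 - Real.exp (-(TT k (rho k) x)))) :=
    tendsto_const_nhds.sub ((Real.continuous_exp.tendsto _).comp h2.neg)
  exact tendsto_nhds_unique h1 h3

theorem Ker.rmax {f : ℝ → ℝ} (hf : Measurable f) (h01 : ∀ x, f x ∈ Set.Icc (0 : ℝ) 1)
    (he : ∀ᵐ x ∂lam, f x ≤ 1 - Real.exp (-(TT k f x))) : ∀ᵐ x ∂lam, f x ≤ rho k x := by
  have hfa : ∀ x, |f x| ≤ 1 := fun x => by rw [abs_of_nonneg (h01 x).1]; exact (h01 x).2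
  have : ∀ h, ∀ᵐ x ∂lam, f x ≤ qq k h x := by
    intro h
    induction h with
    | zero => exact ae_of_all _ fun x => (h01 x).2
    | succ h ih =>
      filter_upwards [he] with x hx
      refine hx.trans ?_
      have := hk.Tmono hf (hk.q01 h).1 1 hfa (hk.qabs _) ih x
      have := Real.exp_le_exp.2 (neg_le_neg this)
      change _ ≤ 1 - Real.exp (-(TT k (qq k h) x))
      linarith
  filter_upwards [ae_all_iff.2 this] with x hx using le_ciInf hx

theorem Ker.surv : survival k = ∫ x, rho k x ∂lam := by
  apply le_antisymm
  · refine csSup_le ⟨_, rho k, hk.rmeas, fun x => ⟨hk.r0 x, hk.r1 x⟩, ae_of_all _ hk.req, rfl⟩ ?_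
    rintro r ⟨f, hf, h01, he, rfl⟩
    have := hk.rmax hf h01 (by filter_upwards [he] with x hx using hx.le)
    change ∫ x, f x ∂lam ≤ _
    refine integral_mono_ae (bint hf 1 fun x => ?_) (bint hk.rmeas 1 hk.rabs) this
    rw [abs_of_nonneg (h01 x).1]; exact (h01 x).2
  · refine le_csSup ⟨1, ?_⟩ ⟨rho k, hk.rmeas, fun x => ⟨hk.r0 x, hk.r1 x⟩, ae_of_all _ hk.req, rfl⟩
    rintro r ⟨f, hf, h01, he, rfl⟩
    have : ∫ x, f x ∂lam ≤ ∫ x, (1:ℝ) ∂lam := by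
      refine integral_mono (bint hf 1 fun x => ?_) (integrable_const _) fun x => (h01 x).2
      rw [abs_of_nonneg (h01 x).1]; exact (h01 x).2
    change ∫ x, f x ∂lam ≤ _
    simpa using this

theorem Ker.qint : Tendsto (fun h => ∫ x, qq k h x ∂lam) atTop (𝓝 (∫ x, rho k x ∂lam)) := by
  refine tendsto_integral_of_dominated_convergence (fun _ => 1)
    (fun n => (hk.q01 n).1.aestronglyMeasurable) (integrable_const _) (fun n => ?_) ?_
  · exact ae_of_all _ fun x => hk.qabs n x
  · exact ae_of_all _ fun x => hk.qtend x

theorem Ker.symT {f g : ℝ → ℝ} (hf : Measurable f) (hg : Measurable g) (C : ℝ)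
    (hfC : ∀ x, |f x| ≤ C) (hgC : ∀ x, |g x| ≤ C) :
    ∫ x, f x * TT k g x ∂lam = ∫ x, g x * TT k f x ∂lam := by
  simp only [TT, ← integral_const_mul]
  have hC : 0 ≤ C := (abs_nonneg _).trans (hfC 0)
  rw [integral_integral_swap]
  · refine integral_congr_ae (ae_of_all _ fun x => integral_congr_ae (ae_of_all _ fun y => ?_))
    simp only [hk.sym x y]; ring
  · refine bint ((hf.comp measurable_fst).mul (hk.meas.mul (hg.comp measurable_snd))) (C * (K * C)) ?_
    rintro ⟨x, y⟩
    simp only [Function.uncurry, abs_mul]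
    gcongr
    · exact hfC x
    · exact hk.K0
    · exact hk.abs x y
    · exact hgC y

theorem Ker.rT (x : ℝ) : rho k x ≤ TT k (rho k) x := by
  have := hk.req x
  have h2 := Real.add_one_le_exp (-(TT k (rho k) x))
  linarith

end
end Percolation
end

open MeasureTheory Filter Topology
noncomputable section
namespace Percolation

theorem cs_sq {μ : Measure ℝ} {F G : ℝ → ENNReal} (hF : AEMeasurable F μ) (hG : AEMeasurable G μ) :
    (∫⁻ x, F x * G x ∂μ) ^ 2 ≤ (∫⁻ x, F x ^ 2 ∂μ) * ∫⁻ x, G x ^ 2 ∂μ := by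
  have h := ENNReal.lintegral_mul_le_Lp_mul_Lq μ (p := 2) (q := 2) (by constructor <;> norm_num) hF hG
  have h2 := pow_le_pow_left₀ (zero_le) h 2
  refine h2.trans (le_of_eq ?_)
  rw [mul_pow, ← ENNReal.rpow_natCast, ← ENNReal.rpow_natCast, ← ENNReal.rpow_mul,
    ← ENNReal.rpow_mul]
  norm_num

theorem schur {k : ℝ → ℝ → ℝ} {K : ℝ} (hk : Ker k K) {q : ℝ → ℝ} (hq : Measurable q)
    (hq0 : ∀ x, 0 < q x) (hq1 : ∀ x, q x ≤ 1) {A : ℝ} (hA : 0 ≤ A)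
    (h : ∀ᵐ x ∂lam, TT k q x ≤ A * q x) {f : ℝ → ℝ} (hf : Measurable f)
    (hfi : Integrable (fun x => f x ^ 2) lam) :
    ∫ x, (TT k f x) ^ 2 ∂lam ≤ A ^ 2 * ∫ x, f x ^ 2 ∂lam := by
  have hqa : ∀ x, |q x| ≤ 1 := fun x => by rw [abs_of_pos (hq0 x)]; exact hq1 x
  have hof : ∀ x, ∫⁻ y, ENNReal.ofReal (k x y * q y) ∂lam = ENNReal.ofReal (TT k q x) := fun x => by
    rw [TT, ofReal_integral_eq_lintegral_ofReal (hk.int hq 1 hqa x)]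
    exact ae_of_all _ fun y => mul_nonneg (hk.nn x y) (hq0 y).le
  have hpt : ∀ x, ENNReal.ofReal ((TT k f x) ^ 2) ≤
      ENNReal.ofReal (TT k q x) * ∫⁻ y, ENNReal.ofReal (k x y * (f y ^ 2 / q y)) ∂lam := by
    intro x
    have h1 : ENNReal.ofReal |TT k f x| ≤ ∫⁻ y, ENNReal.ofReal (Real.sqrt (k x y * q y)) *
        ENNReal.ofReal (Real.sqrt (k x y / q y) * |f y|) ∂lam := by
      rw [← Real.norm_eq_abs, ofReal_norm]
      refine (enorm_integral_le_lintegral_enorm _).trans (le_of_eq (lintegral_congr fun y => ?_))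
      rw [← ENNReal.ofReal_mul (Real.sqrt_nonneg _), ← mul_assoc, ← Real.sqrt_mul
        (mul_nonneg (hk.nn x y) (hq0 y).le), ← ofReal_norm, Real.norm_eq_abs, abs_mul,
        abs_of_nonneg (hk.nn x y)]
      congr 2
      rw [show k x y * q y * (k x y / q y) = k x y ^ 2 by field_simp [(hq0 y).ne'],
        Real.sqrt_sq (hk.nn x y)]
    have m1 : Measurable fun y => ENNReal.ofReal (Real.sqrt (k x y * q y)) :=
      (((hk.m1 x).mul hq).sqrt).ennreal_ofReal
    have m2 : Measurable fun y => ENNReal.ofReal (Real.sqrt (k x y / q y) * |f y|) :=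
      ((((hk.m1 x).div hq).sqrt).mul hf.abs).ennreal_ofReal
    have h2 := (pow_le_pow_left₀ zero_le h1 2).trans (cs_sq m1.aemeasurable m2.aemeasurable)
    rw [← ENNReal.ofReal_pow (abs_nonneg _), sq_abs] at h2
    refine h2.trans (le_of_eq ?_)
    rw [← hof]
    congr 1
    · refine lintegral_congr fun y => ?_
      rw [← ENNReal.ofReal_pow (Real.sqrt_nonneg _), Real.sq_sqrt (mul_nonneg (hk.nn x y) (hq0 y).le)]
    · refine lintegral_congr fun y => ?_
      rw [← ENNReal.ofReal_pow (by positivity), mul_pow,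
        Real.sq_sqrt (div_nonneg (hk.nn x y) (hq0 y).le), sq_abs]
      congr 1; ring
  have hmain : ∫⁻ x, ENNReal.ofReal ((TT k f x) ^ 2) ∂lam ≤
      ENNReal.ofReal (A ^ 2 * ∫ x, f x ^ 2 ∂lam) := by
    calc ∫⁻ x, ENNReal.ofReal ((TT k f x) ^ 2) ∂lam
        ≤ ∫⁻ x, ∫⁻ y, ENNReal.ofReal (A * q x) * ENNReal.ofReal (k x y * (f y ^ 2 / q y)) ∂lam ∂lam := by
          refine lintegral_mono_ae ?_
          filter_upwards [h] with x hx
          have m : Measurable fun y => ENNReal.ofReal (k x y * (f y ^ 2 / q y)) :=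
            ((hk.m1 x).mul ((hf.pow_const 2).div hq)).ennreal_ofReal
          rw [lintegral_const_mul _ m]
          exact (hpt x).trans (mul_le_mul' (ENNReal.ofReal_le_ofReal hx) le_rfl)
      _ = ∫⁻ y, ∫⁻ x, ENNReal.ofReal (A * q x) * ENNReal.ofReal (k x y * (f y ^ 2 / q y)) ∂lam ∂lam := by
          refine lintegral_lintegral_swap (Measurable.aemeasurable ?_)
          exact (measurable_const.mul (hq.comp measurable_fst)).ennreal_ofReal.mul
            (hk.meas.mul (((hf.pow_const 2).div hq).comp measurable_snd)).ennreal_ofReal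
      _ ≤ ∫⁻ y, ENNReal.ofReal (A ^ 2 * f y ^ 2) ∂lam := by
          refine lintegral_mono_ae ?_
          filter_upwards [h] with y hy
          have : ∀ x, ENNReal.ofReal (A * q x) * ENNReal.ofReal (k x y * (f y ^ 2 / q y)) =
              ENNReal.ofReal (A * (f y ^ 2 / q y)) * ENNReal.ofReal (k y x * q x) := by
            intro x
            have := (hq0 x).le
            have := (hq0 y).le
            rw [← ENNReal.ofReal_mul (by positivity), ← ENNReal.ofReal_mul (by positivity), hk.sym x y]
            congr 1; ring
          simp only [this]
          have m : Measurable fun x => ENNReal.ofReal (k y x * q x) :=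
            ((hk.m1 y).mul hq).ennreal_ofReal
          rw [lintegral_const_mul _ m, hof,
            ← ENNReal.ofReal_mul (mul_nonneg hA (div_nonneg (sq_nonneg _) (hq0 y).le))]
          apply ENNReal.ofReal_le_ofReal
          have := (hq0 y)
          calc A * (f y ^ 2 / q y) * TT k q y ≤ A * (f y ^ 2 / q y) * (A * q y) := by gcongr
            _ = _ := by field_simp
      _ = _ := by
          rw [← integral_const_mul, ofReal_integral_eq_lintegral_ofReal (hfi.const_mul _)]
          exact ae_of_all _ fun y => by positivity
  rw [integral_eq_lintegral_of_nonneg_ae (ae_of_all _ fun x => sq_nonneg _)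
    ((hk.Tmeas hf).pow_const 2).aestronglyMeasurable]
  refine ENNReal.toReal_le_of_le_ofReal ?_ hmain
  exact mul_nonneg (sq_nonneg _) (integral_nonneg fun x => sq_nonneg _)

theorem Ker.smul {W : ℝ → ℝ → ℝ} {K : ℝ} (hW : Ker W K) {c : ℝ} (hc : 0 ≤ c) :
    Ker (fun x y => c * W x y) (c * K) :=
  ⟨hW.meas.const_mul c, fun x y => mul_nonneg hc (hW.nn x y), fun x y => by rw [hW.sym],
    fun x y => mul_le_mul_of_nonneg_left (hW.le x y) hc⟩

theorem TT_smul (W : ℝ → ℝ → ℝ) (c : ℝ) (f : ℝ → ℝ) (x : ℝ) :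
    TT (fun x y => c * W x y) f x = c * TT W f x := by
  simp only [TT, mul_assoc, integral_const_mul]

theorem opNorm_bdd {W : ℝ → ℝ → ℝ} {K : ℝ} (hW : Ker W K) : BddAbove {r | ∃ f : ℝ → ℝ, Measurable f ∧
    MeasureTheory.IntegrableOn (fun x => f x ^ 2) I01 ∧
    l2norm f ≤ 1 ∧ r = l2norm (applyT W f)} := by
  refine ⟨K, ?_⟩
  rintro r ⟨f, hf, hfi, h1, rfl⟩
  have h2 := schur hW (q := fun _ => 1) measurable_const (fun _ => one_pos) (fun _ => le_rfl) hW.K0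
    (ae_of_all _ fun x => by
      have := hW.Tle (f := fun _ => 1) measurable_const 1 (by simp) (by simp) x
      simpa using this) hf hfi
  have h3 : ∫ x, f x ^ 2 ∂lam ≤ 1 := by
    rw [l2norm, Real.sqrt_le_one] at h1; exact h1
  refine Real.sqrt_le_iff.2 ⟨hW.K0, h2.trans ?_⟩
  nlinarith [sq_nonneg K]

theorem opNorm_le {W : ℝ → ℝ → ℝ} {K : ℝ} (hW : Ker W K) {f : ℝ → ℝ} (hf : Measurable f)
    (hfi : Integrable (fun x => f x ^ 2) lam) :
    ∫ x, (TT W f x) ^ 2 ∂lam ≤ opNorm W ^ 2 * ∫ x, f x ^ 2 ∂lam := by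
  set s := ∫ x, f x ^ 2 ∂lam with hs
  have hs0 : 0 ≤ s := integral_nonneg fun x => sq_nonneg _
  rcases hs0.eq_or_lt with h0 | h0
  · have := schur hW (q := fun _ => 1) measurable_const (fun _ => one_pos) (fun _ => le_rfl) hW.K0
      (ae_of_all _ fun x => by
        have := hW.Tle (f := fun _ => 1) measurable_const 1 (by simp) (by simp) x
        simpa using this) hf hfi
    rw [← hs, ← h0] at this
    rw [← h0]; simpa using this
  · have hsq := Real.sqrt_pos.2 h0
    have e1 : ∀ x, TT W (fun y => (Real.sqrt s)⁻¹ * f y) x = (Real.sqrt s)⁻¹ * TT W f x := by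
      intro x; simp only [TT, ← integral_const_mul]; congr 1; ext y; ring
    have hmem : l2norm (applyT W (fun y => (Real.sqrt s)⁻¹ * f y)) ≤ opNorm W := by
      refine le_csSup (opNorm_bdd hW) ⟨_, hf.const_mul _, ?_, ?_, rfl⟩
      · simp only [mul_pow]; exact hfi.const_mul _
      · rw [l2norm, Real.sqrt_le_one]
        change ∫ x, ((Real.sqrt s)⁻¹ * f x) ^ 2 ∂lam ≤ 1
        simp only [mul_pow, integral_const_mul]
        rw [← hs, inv_pow, Real.sq_sqrt hs0, inv_mul_cancel₀ h0.ne']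
    have h2 : ∫ x, (TT W (fun y => (Real.sqrt s)⁻¹ * f y) x) ^ 2 ∂lam ≤ opNorm W ^ 2 := by
      rw [l2norm] at hmem
      exact (Real.sqrt_le_left ((Real.sqrt_nonneg _).trans hmem)).1 hmem
    simp only [e1, mul_pow, integral_const_mul, inv_pow, Real.sq_sqrt hs0] at h2
    rwa [inv_mul_le_iff₀ h0, mul_comm] at h2

theorem rho_zero {W : ℝ → ℝ → ℝ} {K : ℝ} (hW : Ker W K) {c : ℝ} (hc : 0 < c)
    (h : c * opNorm W ≤ 1) : ∫ x, rho (fun x y => c * W x y) x ∂lam = 0 := by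
  have hk := hW.smul hc.le
  set k := fun x y => c * W x y
  have hm := hk.Tmeas hk.rmeas
  have hTb : ∀ x, |TT k (rho k) x| ≤ c * K := fun x => by
    rw [abs_of_nonneg (hk.Tnn hk.r0 x)]
    refine (hk.Tle hk.rmeas 1 hk.rabs hk.r0 x).trans ?_
    have : ∫ y, rho k y ∂lam ≤ ∫ y, (1:ℝ) ∂lam :=
      integral_mono (bint hk.rmeas 1 hk.rabs) (integrable_const _) hk.r1
    simp at this
    nlinarith [hk.K0]
  have hi1 : Integrable (fun x => rho k x ^ 2) lam := bint (hk.rmeas.pow_const 2) 1 fun x => by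
    rw [abs_pow]; exact pow_le_one₀ (abs_nonneg _) (hk.rabs x)
  have hi2 : Integrable (fun x => TT k (rho k) x ^ 2) lam := bint (hm.pow_const 2) ((c*K)^2) fun x => by
    rw [abs_pow]; exact pow_le_pow_left₀ (abs_nonneg _) (hTb x) 2
  have h1 : ∫ x, TT k (rho k) x ^ 2 ∂lam ≤ ∫ x, rho k x ^ 2 ∂lam := by
    have := opNorm_le hW hk.rmeas hi1
    simp only [k, TT_smul, mul_pow, integral_const_mul]
    have hN : 0 ≤ opNorm W := Real.sSup_nonneg (by rintro r ⟨f, -, -, -, rfl⟩; exact Real.sqrt_nonneg _)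
    have h3 : (c * opNorm W) ^ 2 ≤ 1 := pow_le_one₀ (by positivity) h
    have h4 : 0 ≤ ∫ x, rho k x ^ 2 ∂lam := integral_nonneg fun x => sq_nonneg _
    nlinarith [sq_nonneg c]
  have h2 : ∫ x, (TT k (rho k) x ^ 2 - rho k x ^ 2) ∂lam = 0 := by
    apply le_antisymm
    · rw [integral_sub hi2 hi1]; linarith
    · refine integral_nonneg fun x => sub_nonneg.2 (pow_le_pow_left₀ (hk.r0 x) (hk.rT x) 2)
  rw [integral_eq_zero_iff_of_nonneg (fun x => sub_nonneg.2 (pow_le_pow_left₀ (hk.r0 x) (hk.rT x) 2))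
    (hi2.sub hi1)] at h2
  refine integral_eq_zero_of_ae ?_
  filter_upwards [h2] with x hx
  simp only [Pi.zero_apply] at hx ⊢
  have e : TT k (rho k) x = rho k x := by
    have := hk.r0 x; have := hk.rT x
    nlinarith
  by_contra hne
  have := hk.req x
  rw [e] at this
  have := Real.add_one_lt_exp (x := -(rho k x)) (by simpa using hne)
  linarith

theorem Ker.qsupp {k : ℝ → ℝ → ℝ} {K : ℝ} (hk : Ker k K) (h : ℕ) :
    ∀ᵐ y ∂lam, ∀ᵐ x ∂lam, qq k h y = 0 → k y x = 0 := by
  induction h with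
  | zero => simp [qq]
  | succ h ih =>
    have ih2 : ∀ᵐ y ∂lam, ∀ᵐ x ∂lam, qq k h x = 0 → k x y = 0 := by
      rw [Measure.ae_ae_comm]
      · exact ih
      · have : {p : ℝ × ℝ | qq k h p.2 = 0 → k p.2 p.1 = 0} =
            {p : ℝ × ℝ | qq k h p.2 = 0}ᶜ ∪ {p : ℝ × ℝ | k p.2 p.1 = 0} := by
          ext p; simp [imp_iff_not_or]
        rw [this]
        refine MeasurableSet.union (MeasurableSet.compl ?_) ?_
        · exact measurableSet_eq_fun ((hk.q01 h).1.comp measurable_snd) measurable_const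
        · exact measurableSet_eq_fun (hk.meas.comp measurable_swap) measurable_const
    filter_upwards [ih2] with y hy
    by_cases h0 : qq k (h+1) y = 0
    · have hT : TT k (qq k h) y = 0 := by
        change 1 - Real.exp (-(TT k (qq k h) y)) = 0 at h0
        have : Real.exp (-(TT k (qq k h) y)) = 1 := by linarith
        simpa using this
      rw [TT, integral_eq_zero_iff_of_nonneg (fun x => mul_nonneg (hk.nn y x) ((hk.q01 h).2 x).1)
        (hk.int (hk.q01 h).1 1 (hk.qabs h) y)] at hT
      filter_upwards [hT, hy] with x hx hx2 _
      rcases mul_eq_zero.1 hx with h | h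
      · exact h
      · rw [hk.sym]; exact hx2 h
    · exact ae_of_all _ fun x hx => absurd hx h0

theorem rho_pos {W : ℝ → ℝ → ℝ} {K : ℝ} (hW : Ker W K) {c : ℝ} (hc : 0 < c)
    (h : 1 < c * opNorm W) : 0 < ∫ x, rho (fun x y => c * W x y) x ∂lam := by
  have hk := hW.smul hc.le
  set k := fun x y => c * W x y
  refine lt_of_le_of_ne (integral_nonneg hk.r0) fun h0 => ?_
  obtain ⟨A, hA1, hA2⟩ := exists_between h
  have hA0 : 0 < A := by linarith
  have ht := hk.qint
  rw [← h0] at ht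
  have ht2 := ht.const_mul (c * K)
  rw [mul_zero] at ht2
  have hη : 0 < 1 - A⁻¹ := by have := inv_lt_one_of_one_lt₀ hA1; linarith
  obtain ⟨n, hn⟩ := ((tendsto_order.1 ht2).2 _ hη).exists
  set q := qq k n
  have hq := hk.q01 n
  have hT : ∀ x, TT k q x ≤ A * q x := by
    intro x
    have a1 := hk.qanti1 n x
    change 1 - Real.exp (-(TT k q x)) ≤ q x at a1
    set s := TT k q x
    have s0 : 0 ≤ s := hk.Tnn (fun x => (hq.2 x).1) x
    have s1 : s ≤ 1 - A⁻¹ := (hk.Tle hq.1 1 (hk.qabs n) (fun x => (hq.2 x).1) x).trans hn.le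
    have e1 : Real.exp (-s) * (1 + s) ≤ 1 := by
      have := Real.add_one_le_exp s
      calc Real.exp (-s) * (1 + s) ≤ Real.exp (-s) * Real.exp s := by gcongr; linarith
        _ = 1 := by rw [← Real.exp_add]; simp
    have e2 : s * A⁻¹ ≤ 1 - Real.exp (-s) := by
      nlinarith [Real.exp_pos (-s), mul_nonneg s0 s0]
    have : s = A * (s * A⁻¹) := by field_simp
    rw [this]; gcongr; linarith
  let q' : ℝ → ℝ := fun x => if q x = 0 then 1 else q x
  have hq'm : Measurable q' := Measurable.ite (measurableSet_eq_fun hq.1 measurable_const)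
    measurable_const hq.1
  have hTq : ∀ᵐ x ∂lam, TT k q' x ≤ A * q' x := by
    have hs : ∀ᵐ x ∂lam, ∀ᵐ y ∂lam, q y = 0 → k y x = 0 := by
      rw [Measure.ae_ae_comm]
      · exact hk.qsupp n
      · have : {p : ℝ × ℝ | q p.2 = 0 → k p.2 p.1 = 0} =
            {p : ℝ × ℝ | q p.2 = 0}ᶜ ∪ {p : ℝ × ℝ | k p.2 p.1 = 0} := by
          ext p; simp [imp_iff_not_or]
        rw [this]
        refine MeasurableSet.union (MeasurableSet.compl ?_) ?_
        · exact measurableSet_eq_fun (hq.1.comp measurable_snd) measurable_const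
        · exact measurableSet_eq_fun (hk.meas.comp measurable_swap) measurable_const
    filter_upwards [hs] with x hx
    have : TT k q' x = TT k q x := by
      refine integral_congr_ae ?_
      filter_upwards [hx] with y hy
      by_cases hy0 : q y = 0
      · simp [hk.sym x y, hy hy0]
      · simp [q', hy0]
    rw [this]
    refine (hT x).trans ?_
    gcongr
    simp only [q']; split_ifs with hh
    · rw [hh]; exact zero_le_one
    · exact le_rfl
  have hsch : ∀ f : ℝ → ℝ, Measurable f → Integrable (fun x => f x ^ 2) lam →
      ∫ x, (TT k f x) ^ 2 ∂lam ≤ A ^ 2 * ∫ x, f x ^ 2 ∂lam := fun f hf hfi => by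
    refine schur hk hq'm (fun x => ?_) (fun x => ?_) hA0.le hTq hf hfi
    · simp only [q']; split_ifs with hh
      · exact one_pos
      · exact lt_of_le_of_ne (hq.2 x).1 (Ne.symm hh)
    · simp only [q']; split_ifs with hh
      · exact le_rfl
      · exact (hq.2 x).2
  have : opNorm W ≤ A / c := by
    refine Real.sSup_le ?_ (by positivity)
    rintro r ⟨f, hf, hfi, h1, rfl⟩
    have h2 := hsch f hf hfi
    have h3 : ∫ x, f x ^ 2 ∂lam ≤ 1 := by
      rw [l2norm, Real.sqrt_le_one] at h1; exact h1
    refine Real.sqrt_le_iff.2 ⟨by positivity, ?_⟩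
    change ∫ x, (TT W f x) ^ 2 ∂lam ≤ _
    simp only [k, TT_smul, mul_pow, integral_const_mul] at h2
    rw [div_pow, le_div_iff₀ (by positivity)]
    nlinarith [sq_nonneg A]
  rw [le_div_iff₀ hc] at this
  linarith

end Percolation
end

open MeasureTheory Filter Topology
noncomputable section
namespace Percolation

theorem lam_prod : lam.prod lam = (volume : Measure (ℝ × ℝ)).restrict (I01 ×ˢ I01) := by
  rw [lam, Measure.prod_restrict]; rfl

theorem lam_vol {A : Set ℝ} (hA : MeasurableSet A) : lam A = volume (A ∩ I01) := by
  rw [lam, Measure.restrict_apply hA]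

theorem mI : MeasurableSet I01 := measurableSet_Icc

theorem irr0 {W : ℝ → ℝ → ℝ} (hi : Irreducible W) {A : Set ℝ} (hA : MeasurableSet A)
    (h : ∀ᵐ p ∂(lam.prod lam), p.1 ∈ A → p.2 ∉ A → W p.1 p.2 = 0) : lam A = 0 ∨ lam Aᶜ = 0 := by
  by_contra hc
  push Not at hc
  have hcomp : lam Aᶜ = 1 - lam A := by rw [prob_compl_eq_one_sub hA]
  refine hi ⟨A ∩ I01, hA.inter mI, Set.inter_subset_right, ?_, ?_, ?_⟩
  · rw [← lam_vol hA]; exact pos_iff_ne_zero.2 hc.1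
  · rw [← lam_vol hA]
    by_contra h1
    exact hc.2 (by rw [hcomp]; exact tsub_eq_zero_of_le (not_lt.1 h1))
  · rw [lam_prod, ae_restrict_iff' (mI.prod mI)] at h
    filter_upwards [h] with p hp h1 h2
    exact hp ⟨h1.2, h2.1⟩ h1.1 fun h3 => h2.2 ⟨h3, h2.1⟩

theorem lam_half : lam (Set.Icc 0 (1/2)) ≠ 0 ∧ lam (Set.Icc 0 (1/2 : ℝ))ᶜ ≠ 0 := by
  have h1 : lam (Set.Icc 0 (1/2 : ℝ)) = ENNReal.ofReal (1/2) := by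
    rw [lam_vol measurableSet_Icc, I01, Set.Icc_inter_Icc]; norm_num
  constructor
  · rw [h1]; simp
  · rw [prob_compl_eq_one_sub measurableSet_Icc, h1]
    have : ENNReal.ofReal (1/2) < 1 := by rw [ENNReal.ofReal_lt_one]; norm_num
    exact (tsub_pos_of_lt this).ne'

theorem ae_zero_of {W : ℝ → ℝ → ℝ} {K : ℝ} (hW : Ker W K) {f g : ℝ → ℝ}
    (hf : Measurable f) (hg : Measurable g) {R : ℝ} (f0 : ∀ x, 0 ≤ f x) (g0 : ∀ x, 0 ≤ g x)
    (fR : ∀ x, |f x| ≤ R) (gR : ∀ x, |g x| ≤ R)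
    (h : ∫ x, f x * TT W g x ∂lam = 0) :
    ∀ᵐ p ∂(lam.prod lam), f p.1 * (W p.1 p.2 * g p.2) = 0 := by
  have hR : 0 ≤ R := (abs_nonneg _).trans (fR 0)
  have hm : Measurable fun p : ℝ × ℝ => f p.1 * (W p.1 p.2 * g p.2) :=
    (hf.comp measurable_fst).mul (hW.meas.mul (hg.comp measurable_snd))
  have hint : Integrable (fun p : ℝ × ℝ => f p.1 * (W p.1 p.2 * g p.2)) (lam.prod lam) := by
    refine bint hm (R * (K * R)) fun p => ?_
    simp only [abs_mul]
    gcongr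
    · exact fR _
    · exact hW.K0
    · exact hW.abs _ _
    · exact gR _
  have h2 : ∫ p, f p.1 * (W p.1 p.2 * g p.2) ∂(lam.prod lam) = 0 := by
    rw [integral_prod _ hint]
    simp only [integral_const_mul]; exact h
  rw [integral_eq_zero_iff_of_nonneg (fun p => mul_nonneg (f0 _) (mul_nonneg (hW.nn _ _) (g0 _))) hint]
    at h2
  exact h2

theorem irr1 {W : ℝ → ℝ → ℝ} {K : ℝ} (hW : Ker W K) (hi : Irreducible W) {f g : ℝ → ℝ}
    (hf : Measurable f) (hg : Measurable g) {R : ℝ} (f0 : ∀ x, 0 ≤ f x) (g0 : ∀ x, 0 ≤ g x)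
    (fR : ∀ x, |f x| ≤ R) (gR : ∀ x, |g x| ≤ R) (hp : ∀ᵐ x ∂lam, 0 < f x + g x)
    (h : ∫ x, f x * TT W g x ∂lam = 0) :
    ∫ x, f x ∂lam = 0 ∨ ∫ x, g x ∂lam = 0 := by
  have key := ae_zero_of hW hf hg f0 g0 fR gR h
  have h' : ∫ x, g x * TT W f x ∂lam = 0 := by rw [← h]; exact hW.symT hg hf R gR fR
  have key' := ae_zero_of hW hg hf g0 f0 gR fR h'
  have hp2 : ∀ᵐ p ∂(lam.prod lam), 0 < f p.2 + g p.2 :=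
    Measure.quasiMeasurePreserving_snd.ae hp
  have hp1 : ∀ᵐ p ∂(lam.prod lam), 0 < f p.1 + g p.1 :=
    Measure.quasiMeasurePreserving_fst.ae hp
  have mA : MeasurableSet {x | 0 < f x} := measurableSet_lt measurable_const hf
  have mB : MeasurableSet {x | 0 < g x} := measurableSet_lt measurable_const hg
  have tr : ∀ {f : ℝ → ℝ}, (∀ x, 0 ≤ f x) → lam {x | 0 < f x} = 0 → ∫ x, f x ∂lam = 0 := by
    intro f f0 hh
    refine integral_eq_zero_of_ae ?_
    have : ∀ᵐ x ∂lam, ¬ 0 < f x := by rw [ae_iff]; simpa using hh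
    filter_upwards [this] with x hx using le_antisymm (not_lt.1 hx) (f0 x)
  rcases irr0 hi mA (by
    filter_upwards [key, hp2] with p h1 h2 h3 h4
    change 0 < f p.1 at h3
    have h4 : ¬ 0 < f p.2 := h4
    have : 0 < g p.2 := by linarith
    rcases mul_eq_zero.1 h1 with h | h
    · linarith
    · rcases mul_eq_zero.1 h with h | h
      · exact h
      · linarith) with h1 | h1
  · exact Or.inl (tr f0 h1)
  rcases irr0 hi mB (by
    filter_upwards [key', hp2] with p h1 h2 h3 h4
    change 0 < g p.1 at h3
    have h4 : ¬ 0 < g p.2 := h4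
    have : 0 < f p.2 := by linarith
    rcases mul_eq_zero.1 h1 with h | h
    · linarith
    · rcases mul_eq_zero.1 h with h | h
      · exact h
      · linarith) with h2 | h2
  · exact Or.inr (tr g0 h2)
  exfalso
  have a1 : ∀ᵐ p ∂(lam.prod lam), 0 < f p.1 := Measure.quasiMeasurePreserving_fst.ae (by
    rw [ae_iff]; exact h1)
  have a2 : ∀ᵐ p ∂(lam.prod lam), 0 < g p.2 := Measure.quasiMeasurePreserving_snd.ae (by
    rw [ae_iff]; exact h2)
  rcases irr0 hi (A := Set.Icc 0 (1/2)) measurableSet_Icc (by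
    filter_upwards [key, a1, a2] with p h1 h2 h3 _ _
    rcases mul_eq_zero.1 h1 with h | h
    · linarith
    · rcases mul_eq_zero.1 h with h | h
      · exact h
      · linarith) with h | h
  · exact lam_half.1 h
  · exact lam_half.2 h

theorem pos_ae {W : ℝ → ℝ → ℝ} {K : ℝ} (hW : Ker W K) (hi : Irreducible W) {c : ℝ} (hc : 0 < c)
    {σ : ℝ → ℝ} (hs : Measurable σ) (s0 : ∀ x, 0 ≤ σ x) (s1 : ∀ x, σ x ≤ 1)
    (he : ∀ x, σ x = 1 - Real.exp (-(c * TT W σ x))) (hp : 0 < ∫ x, σ x ∂lam) :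
    ∀ᵐ x ∂lam, 0 < σ x := by
  have mA : MeasurableSet {x | σ x = 0} := measurableSet_eq_fun hs measurable_const
  let f : ℝ → ℝ := Set.indicator {x | σ x = 0} 1
  have f0 : ∀ x, 0 ≤ f x := fun x => Set.indicator_nonneg (fun _ _ => zero_le_one) x
  have f1 : ∀ x, f x ≤ 1 := fun x => Set.indicator_le_self' (fun _ _ => zero_le_one) x
  rcases irr1 hW hi (f := f) (g := σ) (measurable_one.indicator mA) hs (R := 1) f0 s0
    (fun x => by rw [abs_of_nonneg (f0 x)]; exact f1 x)
    (fun x => by rw [abs_of_nonneg (s0 x)]; exact s1 x) (ae_of_all _ fun x => by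
      by_cases h : σ x = 0
      · have : f x = 1 := Set.indicator_of_mem (s := {x | σ x = 0}) h 1
        have := s0 x
        linarith
      · have := lt_of_le_of_ne (s0 x) (Ne.symm h)
        have := f0 x
        linarith) (integral_eq_zero_of_ae (ae_of_all _ fun x => by
      by_cases h : σ x = 0
      · have := he x
        have h2 : Real.exp (-(c * TT W σ x)) = 1 := by linarith
        simp [hc.ne'] at h2
        simp [h2]
      · have : f x = 0 := Set.indicator_of_notMem (s := {x | σ x = 0}) h 1
        simp [this])) with h | h
  · have : lam.real {x | σ x = 0} = 0 := by
      rw [← integral_indicator_one mA]; exact h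
    rw [measureReal_eq_zero_iff] at this
    have h3 : ∀ᵐ x ∂lam, ¬ σ x = 0 := by rw [ae_iff]; simpa using this
    filter_upwards [h3] with x hx using lt_of_le_of_ne (s0 x) (Ne.symm hx)
  · linarith

theorem qq_mono {k k' : ℝ → ℝ → ℝ} {K K' : ℝ} (hk : Ker k K) (hk' : Ker k' K')
    (h : ∀ x y, k x y ≤ k' x y) (n : ℕ) : ∀ x, qq k n x ≤ qq k' n x := by
  induction n with
  | zero => exact fun x => le_rfl
  | succ n ih =>
    intro x
    have h1 : TT k (qq k n) x ≤ TT k' (qq k' n) x := by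
      refine integral_mono (hk.int (hk.q01 n).1 1 (hk.qabs n) x)
        (hk'.int (hk'.q01 n).1 1 (hk'.qabs n) x) fun y => ?_
      exact mul_le_mul (h x y) (ih y) ((hk.q01 n).2 y).1 (hk'.nn _ _)
    have := Real.exp_le_exp.2 (neg_le_neg h1)
    simp only [qq]; linarith

theorem rho_mono {k k' : ℝ → ℝ → ℝ} {K K' : ℝ} (hk : Ker k K) (hk' : Ker k' K')
    (h : ∀ x y, k x y ≤ k' x y) (x : ℝ) : rho k x ≤ rho k' x :=
  ciInf_mono (hk.qbdd x) fun n => qq_mono hk hk' h n x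

theorem exp_ineq {s t : ℝ} (hs : 0 < s) (h : s < t) :
    s * (1 - Real.exp (-t)) < t * (1 - Real.exp (-s)) := by
  have ht : 0 < t := hs.trans h
  have hd : 0 < s / t := by positivity
  have hd1 : 0 < 1 - s / t := by rw [sub_pos, div_lt_one ht]; exact h
  have := strictConvexOn_exp.2 (Set.mem_univ (-t)) (Set.mem_univ 0) (by linarith) hd hd1 (by ring)
  simp only [smul_eq_mul, mul_zero, add_zero, Real.exp_zero, mul_one] at this
  rw [show s / t * -t = -s by field_simp] at this
  have h2 := mul_lt_mul_of_pos_left this ht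
  rw [show t * (s / t * Real.exp (-t) + (1 - s / t)) = s * Real.exp (-t) + (t - s) by field_simp] at h2
  linarith

theorem rho_cont {W : ℝ → ℝ → ℝ} {K : ℝ} (hW : Ker W K) (hi : Irreducible W) {c : ℝ} (hc : 0 < c)
    (h : 1 < c * opNorm W) {η : ℝ} (hη : 0 < η) : ∃ t, 0 < t ∧ t < 1 ∧ 1 < (t * c) * opNorm W ∧
      ∫ x, rho (fun x y => c * W x y) x ∂lam - η ≤ ∫ x, rho (fun x y => (t * c) * W x y) x ∂lam := by
  let t : ℕ → ℝ := fun j => 1 - 1 / ((j : ℝ) + 2)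
  have t1 : ∀ j, t j < 1 := fun j => by
    have : (0:ℝ) < 1 / ((j:ℝ)+2) := by positivity
    simp only [t]; linarith
  have t0 : ∀ j, 0 < t j := fun j => by
    have : 1 / ((j:ℝ)+2) < 1 := by
      rw [div_lt_one (by positivity)]; linarith [(Nat.cast_nonneg j : (0:ℝ) ≤ j)]
    simp only [t]; linarith
  have tmono : Monotone t := fun i j hij => by
    simp only [t]
    have : (i:ℝ) ≤ j := by exact_mod_cast hij
    gcongr
  have tlim : Tendsto t atTop (𝓝 1) := by
    have : Tendsto (fun j : ℕ => 1 / ((j:ℝ) + 2)) atTop (𝓝 0) :=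
      tendsto_const_nhds.div_atTop (tendsto_atTop_add_const_right _ _ tendsto_natCast_atTop_atTop)
    have h2 := (tendsto_const_nhds (x := (1:ℝ))).sub this
    rw [sub_zero] at h2
    exact h2
  have hkj : ∀ j, Ker (fun x y => t j * c * W x y) (t j * c * K) := fun j =>
    hW.smul (mul_pos (t0 j) hc).le
  have hk := hW.smul hc.le
  set k := fun x y => c * W x y with hkd
  let r : ℕ → ℝ → ℝ := fun j => rho (fun x y => t j * c * W x y)
  have rmono : ∀ x, Monotone fun j => r j x := fun x i j hij =>
    rho_mono (hkj i) (hkj j) (fun x y => by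
      have := tmono hij
      have := hW.nn x y
      gcongr) x
  have rle : ∀ j x, r j x ≤ rho k x := fun j x => rho_mono (hkj j) hk (fun x y => by
    have := hW.nn x y
    have := (t1 j).le
    have : t j * c ≤ c := by nlinarith
    exact mul_le_mul_of_nonneg_right this (hW.nn x y)) x
  have rbdd : ∀ x, BddAbove (Set.range fun j => r j x) := fun x => ⟨rho k x, by
    rintro _ ⟨j, rfl⟩; exact rle j x⟩
  let σ : ℝ → ℝ := fun x => ⨆ j, r j x
  have rlim : ∀ x, Tendsto (fun j => r j x) atTop (𝓝 (σ x)) := fun x =>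
    tendsto_atTop_ciSup (rmono x) (rbdd x)
  have hσ : Measurable σ := Measurable.iSup fun j => (hkj j).rmeas
  have s0 : ∀ x, 0 ≤ σ x := fun x => ((hkj 0).r0 x).trans (le_ciSup (rbdd x) 0)
  have sr : ∀ x, σ x ≤ rho k x := fun x => ciSup_le fun j => rle j x
  have s1 : ∀ x, σ x ≤ 1 := fun x => (sr x).trans (hk.r1 x)
  have sabs : ∀ x, |σ x| ≤ 1 := fun x => by rw [abs_of_nonneg (s0 x)]; exact s1 x
  have he : ∀ x, σ x = 1 - Real.exp (-(c * TT W σ x)) := by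
    intro x
    have h2 := hW.Ttend (fun j => (hkj j).rmeas) 1 (fun j => (hkj j).rabs) (ae_of_all _ rlim) x
    have h3 : Tendsto (fun j => r j x) atTop (𝓝 (1 - Real.exp (-(1 * c * TT W σ x)))) := by
      have : ∀ j, r j x = 1 - Real.exp (-(t j * c * TT W (r j) x)) := fun j => by
        have := (hkj j).req x
        rw [TT_smul] at this
        exact this
      simp only [this]
      exact tendsto_const_nhds.sub ((Real.continuous_exp.tendsto _).comp
        ((tlim.mul_const c).mul h2).neg)
    rw [one_mul] at h3
    exact tendsto_nhds_unique (rlim x) h3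
  have ilim : Tendsto (fun j => ∫ x, r j x ∂lam) atTop (𝓝 (∫ x, σ x ∂lam)) := by
    refine tendsto_integral_of_dominated_convergence (fun _ => 1)
      (fun n => (hkj n).rmeas.aestronglyMeasurable) (integrable_const _) (fun n => ?_) ?_
    · exact ae_of_all _ fun x => (hkj n).rabs x
    · exact ae_of_all _ fun x => rlim x
  have olim : Tendsto (fun j => t j * c * opNorm W) atTop (𝓝 (1 * c * opNorm W)) :=
    (tlim.mul_const c).mul_const _
  rw [one_mul] at olim
  have oev := (tendsto_order.1 olim).1 _ h
  obtain ⟨j0, hj0⟩ := oev.exists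
  have ipos : 0 < ∫ x, σ x ∂lam := by
    refine (rho_pos hW (mul_pos (t0 j0) hc) hj0).trans_le ?_
    exact integral_mono (bint (hkj j0).rmeas 1 (hkj j0).rabs) (bint hσ 1 sabs)
      fun x => le_ciSup (rbdd x) j0
  have spos := pos_ae hW hi hc hσ s0 s1 he ipos
  have hst : ∀ x, TT k σ x ≤ TT k (rho k) x := fun x =>
    hk.Tmono hσ hk.rmeas 1 sabs hk.rabs (ae_of_all _ sr) x
  have he' : ∀ x, σ x = 1 - Real.exp (-(TT k σ x)) := fun x => by
    rw [hkd, TT_smul]; exact he x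
  have Tb : ∀ {f : ℝ → ℝ}, Measurable f → (∀ x, 0 ≤ f x) → (∀ x, |f x| ≤ 1) → ∀ x,
      |TT k f x| ≤ c * K * 1 := by
    intro f hf f0 f1 x
    rw [abs_of_nonneg (hk.Tnn f0 x)]
    refine (hk.Tle hf 1 f1 f0 x).trans ?_
    refine mul_le_mul_of_nonneg_left ?_ hk.K0
    have : ∫ y, f y ∂lam ≤ ∫ y, (1:ℝ) ∂lam :=
      integral_mono (bint hf 1 f1) (integrable_const _) fun x => (abs_le.1 (f1 x)).2
    simpa using this
  have int1 : Integrable (fun x => σ x * TT k (rho k) x) lam :=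
    bint (hσ.mul (hk.Tmeas hk.rmeas)) (1 * (c * K * 1)) fun x => by
      rw [abs_mul]; exact mul_le_mul (sabs x) (Tb hk.rmeas hk.r0 hk.rabs x) (abs_nonneg _) zero_le_one
  have int2 : Integrable (fun x => rho k x * TT k σ x) lam :=
    bint (hk.rmeas.mul (hk.Tmeas hσ)) (1 * (c * K * 1)) fun x => by
      rw [abs_mul]; exact mul_le_mul (hk.rabs x) (Tb hσ s0 sabs x) (abs_nonneg _) zero_le_one
  have hz : ∫ x, (σ x * TT k (rho k) x - rho k x * TT k σ x) ∂lam = 0 := by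
    rw [integral_sub int1 int2, hk.symT hσ hk.rmeas 1 sabs hk.rabs, sub_self]
  have hnn : ∀ x, 0 ≤ σ x * TT k (rho k) x - rho k x * TT k σ x := by
    intro x
    have e1 := he' x
    have e2 := hk.req x
    have a0 := hk.Tnn s0 x
    rcases a0.eq_or_lt with h | h
    · rw [← h, mul_zero, sub_zero]; exact mul_nonneg (s0 x) (hk.Tnn hk.r0 x)
    rcases (hst x).eq_or_lt with h2 | h2
    · rw [← h2] at e2 ⊢; rw [← e1] at e2; rw [e2, sub_self]
    · have := exp_ineq h h2
      rw [← e1, ← e2] at this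
      linarith
  rw [integral_eq_zero_iff_of_nonneg hnn (int1.sub int2)] at hz
  have hfin : ∫ x, σ x ∂lam = ∫ x, rho k x ∂lam := by
    refine integral_congr_ae ?_
    filter_upwards [hz, spos] with x hx hp
    simp only [Pi.zero_apply] at hx
    have e1 := he' x
    have e2 := hk.req x
    have a0 : 0 < TT k σ x := by
      rcases (hk.Tnn s0 x).eq_or_lt with h | h
      · rw [← h] at e1; simp at e1; linarith
      · exact h
    rcases (hst x).eq_or_lt with h2 | h2
    · rw [e1, e2, h2]
    · have := exp_ineq a0 h2
      rw [← e1, ← e2] at this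
      linarith
  have lev := (tendsto_order.1 ilim).1 (∫ x, rho k x ∂lam - η) (by rw [hfin]; linarith)
  obtain ⟨j, hj1, hj2⟩ := (oev.and lev).exists
  exact ⟨t j, t0 j, t1 j, hj1, hj2.le⟩

end Percolation
end

open MeasureTheory Filter Topology
noncomputable section
namespace Percolation

theorem wk (F : ℕ → ℝ → ℝ) (hF : ∀ n, Measurable (F n)) (R : ℝ) (h0 : ∀ n x, 0 ≤ F n x)
    (hR : ∀ n x, F n x ≤ R) : ∃ f : ℝ → ℝ, Measurable f ∧ (∀ x, 0 ≤ f x) ∧ (∀ x, f x ≤ R) ∧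
      ∃ ψ : ℕ → ℕ, StrictMono ψ ∧ ∀ (φ : ℝ → ℝ) (C : ℝ), Measurable φ → (∀ x, |φ x| ≤ C) →
        Tendsto (fun n => ∫ x, F (ψ n) x * φ x ∂lam) atTop (𝓝 (∫ x, f x * φ x ∂lam)) := by
  have R0 : 0 ≤ R := (h0 0 0).trans (hR 0 0)
  have hL : ∀ {φ : ℝ → ℝ} {C : ℝ}, Measurable φ → (∀ x, |φ x| ≤ C) → MemLp φ 2 lam :=
    fun {φ C} hm hb => MemLp.of_bound hm.aestronglyMeasurable C (ae_of_all _ hb)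
  have Fb : ∀ n x, |F n x| ≤ R := fun n x => by rw [abs_of_nonneg (h0 n x)]; exact hR n x
  have : Fact ((1:ENNReal) ≤ 2) := ⟨by norm_num⟩
  have : SecondCountableTopology (Lp ℝ 2 lam) := Lp.SecondCountableTopology (one_le_p := ⟨by norm_num⟩) (p_ne_top := ⟨by norm_num⟩)
  let FL : ℕ → Lp ℝ 2 lam := fun n => (hL (hF n) (Fb n)).toLp (F n)
  have nb : ∀ n, ‖FL n‖ ≤ R := fun n => by
    have := Lp.norm_le_of_ae_bound (p := 2) (f := FL n) (C := R) R0 (by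
      filter_upwards [(hL (hF n) (Fb n)).coeFn_toLp] with x hx
      rw [hx]; exact Fb n x)
    simpa [measureUnivNNReal] using this
  obtain ⟨a, ha, ψ, hψ, hlim⟩ := WeakDual.isSeqCompact_closedBall (𝕜 := ℝ) (E := Lp ℝ 2 lam) 0 R
    (x := fun n => StrongDual.toWeakDual (InnerProductSpace.toDual ℝ (Lp ℝ 2 lam) (FL n)))
    (fun n => by
      simp only [Set.mem_preimage, Metric.mem_closedBall, dist_zero_right]
      exact ((InnerProductSpace.toDual ℝ (Lp ℝ 2 lam)).norm_map _).trans_le (nb n))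
  let aL : Lp ℝ 2 lam := (InnerProductSpace.toDual ℝ (Lp ℝ 2 lam)).symm (WeakDual.toStrongDual a)
  let f0 : ℝ → ℝ := (Lp.aestronglyMeasurable aL).mk aL
  have f0m : Measurable f0 := (Lp.aestronglyMeasurable aL).stronglyMeasurable_mk.measurable
  have f0e : aL =ᵐ[lam] f0 := (Lp.aestronglyMeasurable aL).ae_eq_mk
  have lim0 : ∀ (φ : ℝ → ℝ) (C : ℝ), Measurable φ → (∀ x, |φ x| ≤ C) →
        Tendsto (fun n => ∫ x, F (ψ n) x * φ x ∂lam) atTop (𝓝 (∫ x, f0 x * φ x ∂lam)) := by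
    intro φ C hm hb
    have hl := ((WeakDual.eval_continuous ((hL hm hb).toLp φ)).tendsto a).comp hlim
    have e2 : a ((hL hm hb).toLp φ) = ∫ x, f0 x * φ x ∂lam := by
      have : WeakDual.toStrongDual a = InnerProductSpace.toDual ℝ (Lp ℝ 2 lam) aL := by simp [aL]
      change WeakDual.toStrongDual a _ = _
      rw [this, InnerProductSpace.toDual_apply_apply, L2.inner_def]
      refine integral_congr_ae ?_
      filter_upwards [f0e, (hL hm hb).coeFn_toLp] with x h1 h2
      rw [h1, h2]; simp [mul_comm]
    rw [e2] at hl
    refine hl.congr fun n => ?_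
    change InnerProductSpace.toDual ℝ (Lp ℝ 2 lam) (FL (ψ n)) _ = _
    rw [InnerProductSpace.toDual_apply_apply, L2.inner_def]
    refine integral_congr_ae ?_
    filter_upwards [(hL (hF (ψ n)) (Fb (ψ n))).coeFn_toLp, (hL hm hb).coeFn_toLp] with x h1 h2
    simp only [FL]
    rw [h1, h2]; simp [mul_comm]
  have f0i : Integrable f0 lam := ((Lp.memLp aL).ae_eq f0e).integrable (by norm_num)
  have ei : ∀ (g : ℝ → ℝ) (s : Set ℝ), MeasurableSet s →
      ∫ x, g x * s.indicator (fun _ => (1:ℝ)) x ∂lam = ∫ x in s, g x ∂lam := by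
    intro g s hs
    rw [← integral_indicator hs]; congr 1; ext x
    by_cases hx : x ∈ s <;> simp [hx]
  have lims : ∀ s, MeasurableSet s → Tendsto (fun n => ∫ x in s, F (ψ n) x ∂lam) atTop
      (𝓝 (∫ x in s, f0 x ∂lam)) := by
    intro s hs
    have := lim0 (s.indicator fun _ => 1) 1 (measurable_const.indicator hs) (fun x => by
      by_cases hx : x ∈ s <;> simp [hx])
    simpa only [ei _ s hs] using this
  have p1 : ∀ᵐ x ∂lam, 0 ≤ f0 x := by
    refine ae_nonneg_of_forall_setIntegral_nonneg f0i fun s hs _ => ?_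
    exact ge_of_tendsto' (lims s hs) fun n => integral_nonneg fun x => h0 _ x
  have p2 : ∀ᵐ x ∂lam, f0 x ≤ R := by
    refine ae_le_of_forall_setIntegral_le f0i (integrable_const R) fun s hs _ => ?_
    exact le_of_tendsto' (lims s hs) fun n => integral_mono (bint (hF _) R (Fb _)) (integrable_const R)
      fun x => hR _ x
  refine ⟨fun x => max 0 (min (f0 x) R), measurable_const.max (f0m.min measurable_const),
    fun x => le_max_left _ _, fun x => max_le R0 (min_le_right _ _), ψ, hψ, fun φ C hm hb => ?_⟩
  refine (lim0 φ C hm hb).congr_dist ?_ |>.trans (le_of_eq ?_)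
  · simp
  · congr 1
    refine integral_congr_ae ?_
    filter_upwards [p1, p2] with x h1 h2
    rw [min_eq_left h2, max_eq_right h1]

theorem cut_lemma {W : ℝ → ℝ → ℝ} {K : ℝ} (hW : Ker W K) (hi : Irreducible W)
    {r : ℝ → ℝ} (hr : Measurable r) (r1 : ∀ x, |r x| ≤ 1) (hp : ∀ᵐ x ∂lam, 0 < r x)
    {δ : ℝ} (hδ : 0 < δ) (R : ℝ) : ∃ b > 0, ∀ F G : ℝ → ℝ, Measurable F → Measurable G →
      (∀ x, 0 ≤ F x) → (∀ x, 0 ≤ G x) → (∀ x, F x ≤ R) → (∀ x, G x ≤ R) →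
      δ ≤ ∫ x, F x ∂lam → δ ≤ ∫ x, G x ∂lam → (∀ᵐ x ∂lam, r x ≤ F x + G x) →
      b ≤ ∫ x, F x * TT W G x ∂lam := by
  by_contra hcon
  push Not at hcon
  have hc : ∀ n : ℕ, (0:ℝ) < 1 / ((n:ℝ) + 1) := fun n => by positivity
  choose F G hF hG F0 G0 FR GR Fd Gd hs hb using fun n : ℕ => hcon _ (hc n)
  have Fa : ∀ n x, |F n x| ≤ R := fun n x => by rw [abs_of_nonneg (F0 n x)]; exact FR n x
  have Ga : ∀ n x, |G n x| ≤ R := fun n x => by rw [abs_of_nonneg (G0 n x)]; exact GR n x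
  obtain ⟨f, hf, f0, fR, ψ, hψ, fl⟩ := wk F hF R F0 FR
  obtain ⟨g, hg, g0, gR, χ, hχ, gl⟩ := wk (fun n => G (ψ n)) (fun n => hG _) R (fun n => G0 _) (fun n => GR _)
  have fa : ∀ x, |f x| ≤ R := fun x => by rw [abs_of_nonneg (f0 x)]; exact fR x
  have ga : ∀ x, |g x| ≤ R := fun x => by rw [abs_of_nonneg (g0 x)]; exact gR x
  have R0 : 0 ≤ R := (abs_nonneg _).trans (fa 0)
  have fl' : ∀ (φ : ℝ → ℝ) (C : ℝ), Measurable φ → (∀ x, |φ x| ≤ C) →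
      Tendsto (fun n => ∫ x, F (ψ (χ n)) x * φ x ∂lam) atTop (𝓝 (∫ x, f x * φ x ∂lam)) :=
    fun φ C h1 h2 => (fl φ C h1 h2).comp hχ.tendsto_atTop
  have If : δ ≤ ∫ x, f x ∂lam := by
    have := fl' (fun _ => 1) 1 measurable_const (by simp)
    simp only [mul_one] at this
    exact ge_of_tendsto' this fun n => Fd _
  have Ig : δ ≤ ∫ x, g x ∂lam := by
    have := gl (fun _ => 1) 1 measurable_const (by simp)
    simp only [mul_one] at this
    exact ge_of_tendsto' this fun n => Gd _
  have Tb : ∀ {f : ℝ → ℝ}, Measurable f → (∀ x, 0 ≤ f x) → (∀ x, |f x| ≤ R) → ∀ x,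
      |TT W f x| ≤ K * R := by
    intro f hf f0 f1 x
    rw [abs_of_nonneg (hW.Tnn f0 x)]
    refine (hW.Tle hf R f1 f0 x).trans ?_
    refine mul_le_mul_of_nonneg_left ?_ hW.K0
    have : ∫ y, f y ∂lam ≤ ∫ y, R ∂lam :=
      integral_mono (bint hf R f1) (integrable_const _) fun x => (abs_le.1 (f1 x)).2
    simpa using this
  have KR : 0 ≤ K * R := mul_nonneg hW.K0 R0
  have sum : ∀ᵐ x ∂lam, r x ≤ f x + g x := by
    have i1 : Integrable r lam := bint hr 1 r1
    have i2 : Integrable f lam := bint hf R fa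
    have i3 : Integrable g lam := bint hg R ga
    refine ae_le_of_forall_setIntegral_le i1 (i2.add i3) fun s hs' _ => ?_
    have l := (fl' (s.indicator fun _ => 1) 1 (measurable_const.indicator hs') (fun x => by
      by_cases hx : x ∈ s <;> simp [hx])).add (gl (s.indicator fun _ => 1) 1
        (measurable_const.indicator hs') (fun x => by by_cases hx : x ∈ s <;> simp [hx]))
    have ei : ∀ (g : ℝ → ℝ), 
      ∫ x, g x * s.indicator (fun _ => (1:ℝ)) x ∂lam = ∫ x in s, g x ∂lam := by
      intro g
      rw [← integral_indicator hs']; congr 1; ext x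
      by_cases hx : x ∈ s <;> simp [hx]
    simp only [ei] at l
    change _ ≤ ∫ x in s, (f x + g x) ∂lam
    rw [integral_add i2.integrableOn i3.integrableOn]
    refine ge_of_tendsto' l fun n => ?_
    rw [← integral_add (bint (hF _) R (Fa _)) (bint (hG _) R (Ga _))]
    exact integral_mono_ae i1.integrableOn ((bint (hF _) R (Fa _)).add (bint (hG _) R (Ga _)))
      (ae_restrict_of_ae (hs _))
  have hT : ∀ x, Tendsto (fun n => TT W (G (ψ (χ n))) x) atTop (𝓝 (TT W g x)) := by
    intro x
    have := gl (W x) K (hW.m1 x) (hW.abs x)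
    simp only [TT]
    simpa only [mul_comm] using this
  have lim1 : Tendsto (fun n => ∫ x, F (ψ (χ n)) x * (TT W (G (ψ (χ n))) x - TT W g x) ∂lam) atTop
      (𝓝 (∫ x, (0:ℝ) ∂lam)) := by
    refine tendsto_integral_of_dominated_convergence (fun _ => R * (K * R + K * R))
      (fun n => ((hF _).mul ((hW.Tmeas (hG _)).sub (hW.Tmeas hg))).aestronglyMeasurable)
      (integrable_const _) (fun n => ae_of_all _ fun x => ?_) (ae_of_all _ fun x => ?_)
    · rw [Real.norm_eq_abs, abs_mul]
      refine mul_le_mul (Fa _ x) ((abs_sub _ _).trans ?_) (abs_nonneg _) R0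
      exact add_le_add (Tb (hG _) (G0 _) (Ga _) x) (Tb hg g0 ga x)
    · have h1 : Tendsto (fun n => R * |TT W (G (ψ (χ n))) x - TT W g x|) atTop (𝓝 0) := by
        have := (((hT x).sub_const (TT W g x)).abs).const_mul R
        simpa using this
      refine squeeze_zero_norm (fun n => ?_) h1
      rw [Real.norm_eq_abs, abs_mul]
      exact mul_le_mul_of_nonneg_right (Fa _ x) (abs_nonneg _)
  have lim2 := fl' (TT W g) (K * R) (hW.Tmeas hg) (Tb hg g0 ga)
  have lim3 := lim1.add lim2
  have lim4 : Tendsto (fun n => ∫ x, F (ψ (χ n)) x * TT W (G (ψ (χ n))) x ∂lam) atTop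
      (𝓝 (∫ x, f x * TT W g x ∂lam)) := by
    rw [integral_zero, zero_add] at lim3
    refine lim3.congr fun n => ?_
    rw [← integral_add]
    · congr 1; ext x; ring
    · refine bint ((hF _).mul ((hW.Tmeas (hG _)).sub (hW.Tmeas hg))) (R * (K * R + K * R)) fun x => ?_
      rw [abs_mul]
      refine mul_le_mul (Fa _ x) ((abs_sub _ _).trans ?_) (abs_nonneg _) R0
      exact add_le_add (Tb (hG _) (G0 _) (Ga _) x) (Tb hg g0 ga x)
    · refine bint ((hF _).mul (hW.Tmeas hg)) (R * (K * R)) fun x => ?_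
      rw [abs_mul]
      exact mul_le_mul (Fa _ x) (Tb hg g0 ga x) (abs_nonneg _) R0
  have lim5 : Tendsto (fun n : ℕ => 1 / (((ψ (χ n) : ℕ):ℝ) + 1)) atTop (𝓝 0) :=
    tendsto_one_div_add_atTop_nhds_zero_nat.comp (hψ.comp hχ).tendsto_atTop
  have hz : ∫ x, f x * TT W g x ∂lam = 0 := by
    apply le_antisymm
    · exact le_of_tendsto_of_tendsto' lim4 lim5 fun n => (hb _).le
    · exact integral_nonneg fun x => mul_nonneg (f0 x) (hW.Tnn g0 x)
  rcases irr1 hW hi hf hg f0 g0 fa ga (by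
    filter_upwards [sum, hp] with x h1 h2; linarith) hz with h | h <;> linarith

end Percolation
end

open MeasureTheory Filter Topology
noncomputable section
namespace Percolation

def blk (m : ℕ) (x : ℝ) : Fin (m + 1) := ⟨min ⌊((m : ℝ) + 1) * x⌋₊ m, by omega⟩

theorem blk_meas (m : ℕ) : Measurable (blk m) := by
  have h1 : Measurable fun x : ℝ => ⌊((m : ℝ) + 1) * x⌋₊ :=
    Nat.measurable_floor.comp (measurable_const.mul measurable_id)
  have h2 : Measurable fun k : ℕ => (⟨min k m, by omega⟩ : Fin (m + 1)) := measurable_from_nat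
  exact h2.comp h1

theorem blk_close (m : ℕ) {x : ℝ} (hx : x ∈ I01) :
    |x - ((blk m x : ℕ) : ℝ) / ((m : ℝ) + 1)| ≤ 1 / ((m : ℝ) + 1) := by
  have hM : (0:ℝ) < (m:ℝ) + 1 := by positivity
  have hy : 0 ≤ ((m : ℝ) + 1) * x := mul_nonneg hM.le hx.1
  have f1 := Nat.floor_le hy
  have f2 := Nat.lt_floor_add_one (((m : ℝ) + 1) * x)
  have key : |((m : ℝ) + 1) * x - ((blk m x : ℕ) : ℝ)| ≤ 1 := by
    simp only [blk]
    rcases le_total ⌊((m : ℝ) + 1) * x⌋₊ m with h | h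
    · rw [min_eq_left h, abs_le]; constructor <;> linarith
    · rw [min_eq_right h, abs_le]
      have h' : (m:ℝ) ≤ ⌊((m : ℝ) + 1) * x⌋₊ := by exact_mod_cast h
      have : ((m : ℝ) + 1) * x ≤ m + 1 := by nlinarith [hx.2]
      constructor <;> linarith
  have : x - ((blk m x : ℕ) : ℝ) / ((m : ℝ) + 1) =
      (((m : ℝ) + 1) * x - ((blk m x : ℕ) : ℝ)) / ((m : ℝ) + 1) := by field_simp
  rw [this, abs_div, abs_of_pos hM]
  gcongr

theorem blk_pos (m : ℕ) (a : Fin (m + 1)) : 0 < lam.real (blk m ⁻¹' {a}) := by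
  have hM : (0:ℝ) < (m:ℝ) + 1 := by positivity
  have hsub : Set.Ioo ((a:ℝ) / ((m:ℝ)+1)) (((a:ℝ) + 1) / ((m:ℝ)+1)) ⊆ blk m ⁻¹' {a} ∩ I01 := by
    rintro x ⟨h1, h2⟩
    rw [div_lt_iff₀ hM] at h1
    rw [lt_div_iff₀ hM] at h2
    have ha : (a:ℝ) ≤ m := by exact_mod_cast Nat.lt_succ_iff.1 a.2
    refine ⟨?_, ?_, ?_⟩
    · simp only [Set.mem_preimage, Set.mem_singleton_iff, blk]
      ext
      have : ⌊((m : ℝ) + 1) * x⌋₊ = a := by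
        rw [Nat.floor_eq_iff (by nlinarith [(Nat.cast_nonneg a : (0:ℝ) ≤ ((a:ℕ):ℝ))])]
        constructor <;> nlinarith
      simp [this]; omega
    · by_contra h; push Not at h
      have := (Nat.cast_nonneg a : (0:ℝ) ≤ ((a:ℕ):ℝ)); nlinarith
    · by_contra h; push Not at h
      nlinarith
  rw [Measure.real, ENNReal.toReal_pos_iff]
  refine ⟨?_, measure_lt_top _ _⟩
  rw [lam_vol (blk_meas m (measurableSet_singleton a))]
  refine lt_of_lt_of_le ?_ (measure_mono hsub)
  rw [Real.volume_Ioo, ENNReal.ofReal_pos, sub_pos]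
  gcongr; linarith

theorem lam_mem : ∀ᵐ x ∂lam, x ∈ I01 := ae_restrict_mem mI

theorem step2 {f : ℝ × ℝ → ℝ} (hf : Measurable f) {K : ℝ} (f0 : ∀ p, 0 ≤ f p) (fK : ∀ p, f p ≤ K)
    {η : ℝ} (hη : 0 < η) : ∀ᶠ m : ℕ in atTop, ∃ U : Fin (m+1) → Fin (m+1) → ℝ,
      (∀ a b, 0 ≤ U a b ∧ U a b ≤ K) ∧
      ∫ p, |f p - U (blk m p.1) (blk m p.2)| ∂(lam.prod lam) ≤ η := by
  have K0 : 0 ≤ K := (f0 0).trans (fK 0)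
  have fi : Integrable f (lam.prod lam) := bint hf K fun p => by rw [abs_of_nonneg (f0 p)]; exact fK p
  obtain ⟨g, gs, ga, gc, gi⟩ := fi.exists_hasCompactSupport_integral_sub_le (half_pos hη)
  have gu := gs.uniformContinuous_of_continuous gc
  obtain ⟨d, d0, hd⟩ := Metric.uniformContinuous_iff.1 gu (η/2) (half_pos hη)
  have hl := (tendsto_order.1 (tendsto_one_div_add_atTop_nhds_zero_nat (𝕜 := ℝ))).2 d d0
  filter_upwards [hl] with m hm
  let g' : Fin (m+1) → Fin (m+1) → ℝ := fun a b => g (((a:ℕ):ℝ) / ((m:ℝ)+1), ((b:ℕ):ℝ) / ((m:ℝ)+1))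
  have mU : ∀ U : Fin (m+1) → Fin (m+1) → ℝ, Measurable fun p : ℝ × ℝ => U (blk m p.1) (blk m p.2) := by
    intro U
    have : Measurable (Function.uncurry U) := measurable_of_countable _
    exact this.comp (((blk_meas m).comp measurable_fst).prodMk ((blk_meas m).comp measurable_snd))
  refine ⟨fun a b => max 0 (min (g' a b) K), fun a b => ⟨le_max_left _ _, max_le K0 (min_le_right _ _)⟩, ?_⟩
  have i1 : Integrable (fun p => |f p - g p|) (lam.prod lam) := (fi.sub gi).abs
  have hmem : ∀ᵐ p ∂(lam.prod lam), p.1 ∈ I01 ∧ p.2 ∈ I01 := by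
    filter_upwards [Measure.quasiMeasurePreserving_fst.ae lam_mem,
      Measure.quasiMeasurePreserving_snd.ae lam_mem] with p h1 h2 using ⟨h1, h2⟩
  calc _ ≤ ∫ p, (|f p - g p| + η / 2) ∂(lam.prod lam) := by
        refine integral_mono_ae ?_ (i1.add (integrable_const _)) ?_
        · refine bint ((hf.sub (mU fun a b => max 0 (min (g' a b) K))).abs) K fun p => ?_
          rw [abs_abs, abs_le]
          have h1 := f0 p; have h2 := fK p
          have h3 : 0 ≤ max 0 (min (g' (blk m p.1) (blk m p.2)) K) := le_max_left _ _
          have h4 : max 0 (min (g' (blk m p.1) (blk m p.2)) K) ≤ K := max_le K0 (min_le_right _ _)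
          constructor <;> linarith
        · filter_upwards [hmem] with p hp
          have h1 : |g p - g' (blk m p.1) (blk m p.2)| < η / 2 := by
            have := @hd p (((blk m p.1 : ℕ):ℝ) / ((m:ℝ)+1), ((blk m p.2 : ℕ):ℝ) / ((m:ℝ)+1)) (by
              rw [Prod.dist_eq, Real.dist_eq, Real.dist_eq]
              exact max_lt ((blk_close m hp.1).trans_lt hm) ((blk_close m hp.2).trans_lt hm))
            rwa [Real.dist_eq] at this
          have h2 : |f p - max 0 (min (g' (blk m p.1) (blk m p.2)) K)| ≤
              |f p - g' (blk m p.1) (blk m p.2)| := by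
            have a := f0 p; have b := fK p
            rcases le_total (g' (blk m p.1) (blk m p.2)) 0 with h | h
            · rw [min_eq_left (h.trans K0), max_eq_left h, abs_of_nonneg (by linarith), abs_of_nonneg (by linarith)]
              linarith
            · rcases le_total (g' (blk m p.1) (blk m p.2)) K with h' | h'
              · rw [min_eq_left h', max_eq_right h]
              · rw [min_eq_right h', max_eq_right K0, abs_of_nonpos (by linarith), abs_of_nonpos (by linarith)]
                linarith
          have := abs_sub_le (f p) (g p) (g' (blk m p.1) (blk m p.2))
          linarith
    _ = ∫ p, |f p - g p| ∂(lam.prod lam) + η / 2 := by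
        rw [integral_add i1 (integrable_const _)]; simp
    _ ≤ η := by
        have : ∫ p, |f p - g p| ∂(lam.prod lam) ≤ η / 2 := ga
        linarith

theorem step1 {r : ℝ → ℝ} (hr : Measurable r) {K : ℝ} (r0 : ∀ p, 0 ≤ r p) (rK : ∀ p, r p ≤ K)
    {η : ℝ} (hη : 0 < η) : ∀ᶠ m : ℕ in atTop, ∃ V : Fin (m+1) → ℝ,
      (∀ a, 0 ≤ V a ∧ V a ≤ K) ∧ ∫ x, |r x - V (blk m x)| ∂lam ≤ η := by
  filter_upwards [step2 (f := fun p => r p.1) (hr.comp measurable_fst) (fun p => r0 _) (fun p => rK _) hη]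
    with m hm
  obtain ⟨U, hU, h⟩ := hm
  have K0 : 0 ≤ K := (r0 0).trans (rK 0)
  have Um : ∀ a, Measurable fun y => U a (blk m y) := fun a =>
    (measurable_of_countable (U a)).comp (blk_meas m)
  have Ui : ∀ a, Integrable (fun y => U a (blk m y)) lam := fun a => bint (Um a) K fun y => by
    rw [abs_of_nonneg (hU _ _).1]; exact (hU _ _).2
  have V1 : ∀ a, ∫ y, U a (blk m y) ∂lam ≤ K := fun a => by
    have := integral_mono (Ui a) (integrable_const K) fun y => (hU _ _).2
    simpa using this
  refine ⟨fun a => ∫ y, U a (blk m y) ∂lam, fun a => ⟨integral_nonneg fun y => (hU _ _).1, V1 a⟩, ?_⟩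
  have mU : Measurable fun p : ℝ × ℝ => U (blk m p.1) (blk m p.2) := by
    have : Measurable (Function.uncurry U) := measurable_of_countable _
    exact this.comp (((blk_meas m).comp measurable_fst).prodMk ((blk_meas m).comp measurable_snd))
  have ii : Integrable (fun p : ℝ × ℝ => |r p.1 - U (blk m p.1) (blk m p.2)|) (lam.prod lam) := by
    refine bint (((hr.comp measurable_fst).sub mU).abs) K fun p => ?_
    rw [abs_abs, abs_le]
    have h1 := r0 p.1; have h2 := rK p.1
    have h3 := hU (blk m p.1) (blk m p.2)
    constructor <;> linarith
  rw [integral_prod _ ii] at h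
  refine le_trans ?_ h
  refine integral_mono ?_ ii.integral_prod_left fun x => ?_
  · have : Measurable fun x => ∫ y, U (blk m x) (blk m y) ∂lam :=
      (measurable_of_countable fun a => ∫ y, U a (blk m y) ∂lam).comp (blk_meas m)
    refine bint ((hr.sub this).abs) K fun x => ?_
    rw [abs_abs, abs_le]
    have h1 := r0 x; have h2 := rK x
    have h3 : 0 ≤ ∫ y, U (blk m x) (blk m y) ∂lam := integral_nonneg fun y => (hU _ _).1
    have h4 := V1 (blk m x)
    constructor <;> linarith
  · simp only
    have : r x - ∫ y, U (blk m x) (blk m y) ∂lam = ∫ y, (r x - U (blk m x) (blk m y)) ∂lam := by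
      rw [integral_sub (integrable_const _) (Ui _)]; simp
    rw [this]
    exact abs_integral_le_integral_abs

end Percolation
end

open MeasureTheory Filter Topology ProbabilityTheory
noncomputable section
namespace Percolation

def PX (n : ℕ) : Measure (Fin n → ℝ) := Measure.pi fun _ => lam

instance PX_prob (n : ℕ) : IsProbabilityMeasure (PX n) := by unfold PX; infer_instance

theorem PX_eval {n : ℕ} (i : Fin n) : (PX n).map (fun X => X i) = lam :=
  (measurePreserving_eval (fun _ : Fin n => lam) i).map_eq

theorem PX_indep (n : ℕ) : iIndepFun (fun (i : Fin n) (X : Fin n → ℝ) => X i) (PX n) :=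
  iIndepFun_pi (X := fun _ x => x) fun _ => aemeasurable_id

theorem PX_pair {n : ℕ} {i j : Fin n} (h : i ≠ j) :
    (PX n).map (fun X => (X i, X j)) = lam.prod lam := by
  rw [(indepFun_iff_map_prod_eq_prod_map_map (measurable_pi_apply i).aemeasurable
    (measurable_pi_apply j).aemeasurable).1 ((PX_indep n).indepFun h), PX_eval, PX_eval]

theorem PX_quad {n : ℕ} {i j k l : Fin n} (h : i ≠ j) (h1 : k ≠ i) (h2 : k ≠ j) (h3 : l ≠ i)
    (h4 : l ≠ j) : (PX n).map (fun X => ((X k, X l), (X i, X j))) =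
      ((PX n).map fun X => (X k, X l)).prod (lam.prod lam) := by
  have m : ∀ a b : Fin n, Measurable fun X : Fin n → ℝ => (X a, X b) := fun a b =>
    (measurable_pi_apply a).prodMk (measurable_pi_apply b)
  rw [(indepFun_iff_map_prod_eq_prod_map_map (m k l).aemeasurable
    (m i j).aemeasurable).1 ((PX_indep n).indepFun_prodMk_prodMk (fun i => measurable_pi_apply i)
      k l i j h1 h2 h3 h4), PX_pair h]

theorem c4_det {n : ℕ} (A : Fin n → Fin n → ℝ) (f g : Fin n → ℝ) (hf : ∀ i, |f i| ≤ 1)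
    (hg : ∀ i, |g i| ≤ 1) : (∑ i, ∑ j, A i j * (f i * g j)) ^ 4 ≤
      (n:ℝ) ^ 4 * ∑ j, ∑ j', ∑ i, ∑ i', (A i j * A i j') * (A i' j * A i' j') := by
  have sq1 : ∀ {x : ℝ}, |x| ≤ 1 → x ^ 2 ≤ 1 := fun h => by rw [← sq_abs]; exact pow_le_one₀ (abs_nonneg _) h
  have n0 : (0:ℝ) ≤ n := Nat.cast_nonneg n
  have e1 : (∑ i, ∑ j, A i j * (f i * g j)) ^ 2 ≤ n * ∑ i, (∑ j, A i j * g j) ^ 2 := by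
    have : ∑ i, ∑ j, A i j * (f i * g j) = ∑ i, f i * ∑ j, A i j * g j := by
      refine Finset.sum_congr rfl fun i _ => ?_
      rw [Finset.mul_sum]; exact Finset.sum_congr rfl fun j _ => by ring
    rw [this]
    refine (Finset.sum_mul_sq_le_sq_mul_sq _ _ _).trans ?_
    refine mul_le_mul_of_nonneg_right ?_ (Finset.sum_nonneg fun i _ => sq_nonneg _)
    calc ∑ i, f i ^ 2 ≤ ∑ i : Fin n, (1:ℝ) := Finset.sum_le_sum fun i _ => sq1 (hf i)
      _ = n := by simp
  have e2 : ∑ i, (∑ j, A i j * g j) ^ 2 = ∑ p : Fin n × Fin n, (g p.1 * g p.2) * ∑ i, A i p.1 * A i p.2 := by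
    rw [Fintype.sum_prod_type]
    simp only [Finset.mul_sum]
    simp only [sq, Finset.sum_mul_sum]
    rw [Finset.sum_comm]
    refine Finset.sum_congr rfl fun j _ => ?_
    rw [Finset.sum_comm]
    exact Finset.sum_congr rfl fun j _ => Finset.sum_congr rfl fun j _ => by ring
  have e3 : (∑ i, (∑ j, A i j * g j) ^ 2) ^ 2 ≤
      (n:ℝ)^2 * ∑ j, ∑ j', ∑ i, ∑ i', (A i j * A i j') * (A i' j * A i' j') := by
    rw [e2]
    refine (Finset.sum_mul_sq_le_sq_mul_sq _ _ _).trans ?_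
    have : ∑ p : Fin n × Fin n, (∑ i, A i p.1 * A i p.2) ^ 2 =
        ∑ j, ∑ j', ∑ i, ∑ i', (A i j * A i j') * (A i' j * A i' j') := by
      rw [Fintype.sum_prod_type]
      simp only [sq, Finset.sum_mul_sum]
    rw [← this]
    refine mul_le_mul_of_nonneg_right ?_ (Finset.sum_nonneg fun i _ => sq_nonneg _)
    calc ∑ p : Fin n × Fin n, (g p.1 * g p.2) ^ 2 ≤ ∑ p : Fin n × Fin n, (1:ℝ) :=
          Finset.sum_le_sum fun p _ => by
            rw [mul_pow]; exact mul_le_one₀ (sq1 (hg _)) (sq_nonneg _) (sq1 (hg _))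
      _ = n ^ 2 := by simp [sq]
  calc (∑ i, ∑ j, A i j * (f i * g j)) ^ 4 = ((∑ i, ∑ j, A i j * (f i * g j)) ^ 2) ^ 2 := by ring
    _ ≤ (n * ∑ i, (∑ j, A i j * g j) ^ 2) ^ 2 := pow_le_pow_left₀ (sq_nonneg _) e1 2
    _ = n ^ 2 * (∑ i, (∑ j, A i j * g j) ^ 2) ^ 2 := by ring
    _ ≤ n ^ 2 * ((n:ℝ)^2 * ∑ j, ∑ j', ∑ i, ∑ i', (A i j * A i j') * (A i' j * A i' j')) := by gcongr
    _ = _ := by ring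

def C4 {n : ℕ} (D : ℝ → ℝ → ℝ) (X : Fin n → ℝ) : ℝ :=
  ∑ j, ∑ j', ∑ i, ∑ i', (D (X i) (X j) * D (X i) (X j')) * (D (X i') (X j) * D (X i') (X j'))

theorem c4_exp {D : ℝ → ℝ → ℝ} (hD : Measurable (Function.uncurry D)) {K ε : ℝ} (hK : ∀ x y, |D x y| ≤ K)
    (hε : ∀ f g : ℝ → ℝ, Measurable f → Measurable g → (∀ x, |f x| ≤ 1) → (∀ x, |g x| ≤ 1) →
      |∫ p, D p.1 p.2 * (f p.1 * g p.2) ∂(lam.prod lam)| ≤ ε) (K1 : 0 < K) (n : ℕ) :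
    ∫ X, C4 D X ∂(PX n) ≤ (n:ℝ)^4 * (K^3 * ε) + 5 * K^4 * (n:ℝ)^3 := by
  have hm : ∀ i j : Fin n, Measurable fun X : Fin n → ℝ => D (X i) (X j) := fun i j =>
    hD.comp (Measurable.prodMk (f := fun X : Fin n → ℝ => X i) (g := fun X : Fin n → ℝ => X j)
      (measurable_pi_apply i) (measurable_pi_apply j))
  have ε0 : 0 ≤ ε := (abs_nonneg _).trans (hε 0 0 measurable_const measurable_const (by simp) (by simp))
  have prodb : ∀ a b c d : ℝ, |a| ≤ K → |b| ≤ K → |c| ≤ K → |d| ≤ K → |(a * b) * (c * d)| ≤ K ^ 4 := by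
    intro a b c d ha hb hc hd
    rw [abs_mul, abs_mul, abs_mul, show K^4 = (K*K)*(K*K) by ring]
    gcongr
  have mt : ∀ i i' j j' : Fin n, Measurable fun X : Fin n → ℝ =>
      (D (X i) (X j) * D (X i) (X j')) * (D (X i') (X j) * D (X i') (X j')) := fun i i' j j' =>
    ((hm _ _).mul (hm _ _)).mul ((hm _ _).mul (hm _ _))
  have it : ∀ i i' j j' : Fin n, Integrable (fun X : Fin n → ℝ =>
      (D (X i) (X j) * D (X i) (X j')) * (D (X i') (X j) * D (X i') (X j'))) (PX n) :=
    fun i i' j j' => bint (mt i i' j j') (K^4) fun X => prodb _ _ _ _ (hK _ _) (hK _ _) (hK _ _) (hK _ _)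
  have hterm : ∀ i i' j j' : Fin n, ∫ X, (D (X i) (X j) * D (X i) (X j')) * (D (X i') (X j) * D (X i') (X j'))
      ∂(PX n) ≤ K^3 * ε + K^4 * ((if i = j then 1 else 0) + (if i = i' then 1 else 0) +
        (if i = j' then 1 else 0) + (if j = i' then 1 else 0) + (if j = j' then 1 else 0)) := by
    intro i i' j j'
    have triv : ∫ X, (D (X i) (X j) * D (X i) (X j')) * (D (X i') (X j) * D (X i') (X j'))
      ∂(PX n) ≤ K^4 := by
      have := integral_mono (it i i' j j') (integrable_const (K^4)) fun X =>
        (abs_le.1 (prodb _ _ _ _ (hK _ _) (hK _ _) (hK _ _) (hK _ _))).2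
      simpa using this
    have hKe : 0 ≤ K^3 * ε := by positivity
    have hK4 : 0 ≤ K^4 := by positivity
    have bad : ∀ s : ℝ, 1 ≤ s → ∫ X, (D (X i) (X j) * D (X i) (X j')) * (D (X i') (X j) * D (X i') (X j'))
      ∂(PX n) ≤ K^3 * ε + K^4 * s := fun s hs => by nlinarith
    by_cases h1 : i = j
    · apply bad; simp only [h1, if_true]; split_ifs <;> norm_num
    by_cases h2 : i = i'
    · apply bad; simp only [h2, if_true]; split_ifs <;> norm_num
    by_cases h3 : i = j'
    · apply bad; simp only [h3, if_true]; split_ifs <;> norm_num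
    by_cases h4 : j = i'
    · apply bad; simp only [h4, if_true]; split_ifs <;> norm_num
    by_cases h5 : j = j'
    · apply bad; simp only [h5, if_true]; split_ifs <;> norm_num
    simp only [h1, h2, h3, h4, h5, if_false]
    let H : (ℝ × ℝ) × (ℝ × ℝ) → ℝ := fun w =>
      (D w.2.1 w.2.2 * D w.2.1 w.1.2) * (D w.1.1 w.2.2 * D w.1.1 w.1.2)
    have Hm : Measurable H := by
      refine Measurable.mul (Measurable.mul ?_ ?_) (Measurable.mul ?_ ?_)
      · exact hD.comp measurable_snd
      · exact hD.comp ((measurable_fst.comp measurable_snd).prodMk (measurable_snd.comp measurable_fst))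
      · exact hD.comp ((measurable_fst.comp measurable_fst).prodMk (measurable_snd.comp measurable_snd))
      · exact hD.comp measurable_fst
    have mq : ∀ a b : Fin n, Measurable fun X : Fin n → ℝ => (X a, X b) := fun a b =>
      (measurable_pi_apply a).prodMk (measurable_pi_apply b)
    have e1 : ∫ X, (D (X i) (X j) * D (X i) (X j')) * (D (X i') (X j) * D (X i') (X j')) ∂(PX n) =
        ∫ w, H w ∂((PX n).map fun X => ((X i', X j'), (X i, X j))) := by
      rw [integral_map ((mq i' j').prodMk (mq i j)).aemeasurable Hm.aestronglyMeasurable]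
    rw [e1, PX_quad h1 (Ne.symm h2) (Ne.symm h4) (Ne.symm h3) (Ne.symm h5)]
    have : IsProbabilityMeasure ((PX n).map fun X => (X i', X j')) :=
      Measure.isProbabilityMeasure_map (mq i' j').aemeasurable
    have Hi : Integrable H (((PX n).map fun X => (X i', X j')).prod (lam.prod lam)) :=
      bint Hm (K^4) fun X => prodb _ _ _ _ (hK _ _) (hK _ _) (hK _ _) (hK _ _)
    rw [integral_prod _ Hi]
    have : ∀ q : ℝ × ℝ, ∫ p, H (q, p) ∂(lam.prod lam) ≤ K^3 * ε := by
      intro q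
      have hb := hε (fun x => D x q.2 / K) (fun y => D q.1 y / K)
        ((hD.comp (measurable_id.prodMk measurable_const)).div_const K)
        ((hD.comp (measurable_const.prodMk measurable_id)).div_const K)
        (fun x => by rw [abs_div, abs_of_pos K1, div_le_one K1]; exact hK _ _)
        (fun x => by rw [abs_div, abs_of_pos K1, div_le_one K1]; exact hK _ _)
      have e : ∀ p : ℝ × ℝ, H (q, p) = (K^2 * D q.1 q.2) *
          (D p.1 p.2 * (D p.1 q.2 / K * (D q.1 p.2 / K))) := by
        intro p; simp only [H]; field_simp
      simp only [e, integral_const_mul]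
      refine (le_abs_self _).trans ?_
      rw [abs_mul, abs_mul, abs_of_nonneg (sq_nonneg K), show K^3 * ε = (K^2*K)*ε by ring]
      gcongr
      exact hK _ _
    calc _ ≤ ∫ q, K^3 * ε ∂((PX n).map fun X => (X i', X j')) :=
          integral_mono Hi.integral_prod_left (integrable_const _) this
      _ = _ := by simp
  unfold C4
  rw [integral_finsetSum _ fun j _ => integrable_finsetSum _ fun j' _ => integrable_finsetSum _ fun i _ =>
    integrable_finsetSum _ fun i' _ => it i i' j j']
  have hsum : ∑ j : Fin n, ∑ j' : Fin n, ∑ i : Fin n, ∑ i' : Fin n, (K^3 * ε + K^4 * ((if i = j then (1:ℝ) else 0) + (if i = i' then 1 else 0) +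
        (if i = j' then 1 else 0) + (if j = i' then 1 else 0) + (if j = j' then 1 else 0))) =
      (n:ℝ)^4 * (K^3 * ε) + 5 * K^4 * (n:ℝ)^3 := by
    simp only [Finset.sum_add_distrib, ← Finset.mul_sum]
    simp
    ring
  rw [← hsum]
  refine Finset.sum_le_sum fun j _ => ?_
  rw [integral_finsetSum _ fun j' _ => integrable_finsetSum _ fun i _ =>
    integrable_finsetSum _ fun i' _ => it i i' j j']
  refine Finset.sum_le_sum fun j' _ => ?_
  rw [integral_finsetSum _ fun i _ => integrable_finsetSum _ fun i' _ => it i i' j j']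
  refine Finset.sum_le_sum fun i _ => ?_
  rw [integral_finsetSum _ fun i' _ => it i i' j j']
  exact Finset.sum_le_sum fun i' _ => hterm i i' j j'

def E1 {n : ℕ} (D : ℝ → ℝ → ℝ) (η : ℝ) (X : Fin n → ℝ) : Prop :=
  ∀ f g : Fin n → ℝ, (∀ i, |f i| ≤ 1) → (∀ i, |g i| ≤ 1) →
    |∑ i, ∑ j, D (X i) (X j) * (f i * g j)| ≤ η * (n:ℝ)^2

theorem E1_prob {D : ℝ → ℝ → ℝ} (hD : Measurable (Function.uncurry D)) {K ε : ℝ} (hK : ∀ x y, |D x y| ≤ K)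
    (hε : ∀ f g : ℝ → ℝ, Measurable f → Measurable g → (∀ x, |f x| ≤ 1) → (∀ x, |g x| ≤ 1) →
      |∫ p, D p.1 p.2 * (f p.1 * g p.2) ∂(lam.prod lam)| ≤ ε) (K1 : 0 < K) {n : ℕ} (hn : 0 < n)
    {η : ℝ} (hη : 0 < η) :
    (PX n).real {X | ¬ E1 D η X} ≤ (K^3 * ε + 5 * K^4 / n) / η^4 := by
  have n0 : (0:ℝ) < n := by exact_mod_cast hn
  have hm : ∀ i j : Fin n, Measurable fun X : Fin n → ℝ => D (X i) (X j) := fun i j =>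
    hD.comp (Measurable.prodMk (f := fun X : Fin n → ℝ => X i) (g := fun X : Fin n → ℝ => X j)
      (measurable_pi_apply i) (measurable_pi_apply j))
  have hsub : {X : Fin n → ℝ | ¬ E1 D η X} ⊆ {X | η^4 * (n:ℝ)^4 ≤ C4 D X} := by
    intro X hX
    simp only [E1, Set.mem_ofPred_eq, not_forall, not_le] at hX
    obtain ⟨f, g, hf, hg, h⟩ := hX
    have h1 := c4_det (fun i j => D (X i) (X j)) f g hf hg
    have h2 : (η * (n:ℝ)^2)^4 ≤ (∑ i, ∑ j, D (X i) (X j) * (f i * g j)) ^ 4 := by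
      calc (η * (n:ℝ)^2)^4 ≤ |∑ i, ∑ j, D (X i) (X j) * (f i * g j)| ^ 4 :=
            pow_le_pow_left₀ (by positivity) h.le 4
        _ = _ := Even.pow_abs (by decide) _
    have h3 : (n:ℝ)^4 * (η^4 * (n:ℝ)^4) ≤ (n:ℝ)^4 * C4 D X := by
      calc _ = (η * (n:ℝ)^2)^4 := by ring
        _ ≤ _ := h2.trans h1
    exact le_of_mul_le_mul_left h3 (by positivity)
  have C0 : ∀ X : Fin n → ℝ, 0 ≤ C4 D X := by
    intro X
    have : C4 D X = ∑ j, ∑ j', (∑ i, D (X i) (X j) * D (X i) (X j')) ^ 2 := by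
      unfold C4; simp only [sq, Finset.sum_mul_sum]
    rw [this]
    exact Finset.sum_nonneg fun j _ => Finset.sum_nonneg fun j' _ => sq_nonneg _
  have Ci : Integrable (fun X : Fin n → ℝ => C4 D X) (PX n) := by
    unfold C4
    refine integrable_finsetSum _ fun j _ => integrable_finsetSum _ fun j' _ => integrable_finsetSum _ fun i _ =>
      integrable_finsetSum _ fun i' _ => ?_
    refine bint (((hm _ _).mul (hm _ _)).mul ((hm _ _).mul (hm _ _))) (K^4) fun X => ?_
    rw [abs_mul, abs_mul, abs_mul, show K^4 = (K*K)*(K*K) by ring]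
    gcongr <;> exact hK _ _
  have hmk := mul_meas_ge_le_integral_of_nonneg (ae_of_all _ C0) Ci (η^4 * (n:ℝ)^4)
  have h2 := hmk.trans (c4_exp hD hK hε K1 n)
  have h3 : (PX n).real {X | ¬ E1 D η X} ≤ (PX n).real {X | η^4 * (n:ℝ)^4 ≤ C4 D X} :=
    measureReal_mono hsub
  rw [le_div_iff₀ (by positivity)]
  have h4 : (η^4 * (n:ℝ)^4) * (PX n).real {X | ¬ E1 D η X} ≤ (n:ℝ)^4 * (K^3 * ε + 5 * K^4 / n) := by
    calc _ ≤ (η^4 * (n:ℝ)^4) * (PX n).real {X | η^4 * (n:ℝ)^4 ≤ C4 D X} := by gcongr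
      _ ≤ _ := h2
      _ = _ := by field_simp
  have h5 : (n:ℝ)^4 * ((PX n).real {X | ¬ E1 D η X} * η^4) ≤ (n:ℝ)^4 * (K^3 * ε + 5 * K^4 / n) := by
    linarith
  exact le_of_mul_le_mul_left h5 (by positivity)

theorem E2_prob {φ : ℝ → ℝ} (hφ : MeasurePreserving φ lam lam) {ψ : ℝ → ℝ} (hψ : Measurable ψ) {C : ℝ}
    (hC : ∀ x, |ψ x| ≤ C) {n : ℕ} (hn : 0 < n) {η : ℝ} (hη : 0 < η) :
    (PX n).real {X | ¬ |∑ i, ψ (φ (X i)) - n * ∫ x, ψ x ∂lam| ≤ η * n} ≤ (2*C)^2 / n / η^2 := by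
  have n0 : (0:ℝ) < n := by exact_mod_cast hn
  set I := ∫ x, ψ x ∂lam with hI
  have C0 : 0 ≤ C := (abs_nonneg _).trans (hC 0)
  have IC : |I| ≤ C := by
    have := norm_integral_le_of_norm_le_const (μ := lam) (f := ψ) (C := C) (ae_of_all _ hC)
    simpa using this
  let χ : ℝ → ℝ := fun x => ψ (φ x) - I
  have χm : Measurable χ := (hψ.comp hφ.measurable).sub_const I
  have χb : ∀ x, |χ x| ≤ 2 * C := fun x => by
    have := abs_sub (ψ (φ x)) I
    have := hC (φ x)
    simp only [χ]; linarith
  have χi : Integrable χ lam := bint χm _ χb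
  have χ0 : ∫ x, χ x ∂lam = 0 := by
    simp only [χ]
    have ii : Integrable (fun x => ψ (φ x)) lam := bint (hψ.comp hφ.measurable) C fun x => hC _
    rw [integral_sub ii (integrable_const _)]
    have : ∫ x, ψ (φ x) ∂lam = I := by
      rw [hI]
      conv_rhs => rw [← hφ.map_eq]
      rw [integral_map hφ.measurable.aemeasurable hψ.aestronglyMeasurable]
    simp [this]
  have pi : ∀ i j : Fin n, Integrable (fun X : Fin n → ℝ => χ (X i) * χ (X j)) (PX n) := fun i j =>
    bint ((χm.comp (measurable_pi_apply i)).mul (χm.comp (measurable_pi_apply j))) ((2*C)*(2*C)) fun X => by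
      rw [abs_mul]; exact mul_le_mul (χb _) (χb _) (abs_nonneg _) (by positivity)
  have hpair : ∀ i j : Fin n, ∫ X, χ (X i) * χ (X j) ∂(PX n) ≤ if i = j then (2*C)^2 else 0 := by
    intro i j
    split_ifs with h
    · have := integral_mono (pi i j) (integrable_const ((2*C)^2)) fun X => by
        refine (le_abs_self _).trans ?_
        rw [abs_mul, sq]; exact mul_le_mul (χb _) (χb _) (abs_nonneg _) (by positivity)
      simpa using this
    · have e : ∫ X, χ (X i) * χ (X j) ∂(PX n) = ∫ p, χ p.1 * χ p.2 ∂((PX n).map fun X => (X i, X j)) := by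
        rw [integral_map ((measurable_pi_apply i).prodMk (measurable_pi_apply j)).aemeasurable]
        exact ((χm.comp measurable_fst).mul (χm.comp measurable_snd)).aestronglyMeasurable
      rw [e, PX_pair h, integral_prod_mul, χ0, zero_mul]
  have e1 : ∀ X : Fin n → ℝ, ∑ i, ψ (φ (X i)) - n * I = ∑ i, χ (X i) := fun X => by
    simp [χ, Finset.sum_sub_distrib]
  have hi : Integrable (fun X : Fin n → ℝ => (∑ i, χ (X i)) ^ 2) (PX n) := by
    simp only [sq, Finset.sum_mul_sum]
    exact integrable_finsetSum _ fun i _ => integrable_finsetSum _ fun j _ => pi i j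
  have hE : ∫ X, (∑ i, χ (X i)) ^ 2 ∂(PX n) ≤ n * (2*C)^2 := by
    simp only [sq, Finset.sum_mul_sum]
    rw [integral_finsetSum _ fun i _ => integrable_finsetSum _ fun j _ => pi i j]
    calc _ ≤ ∑ i : Fin n, ∑ j : Fin n, (if i = j then (2*C)^2 else 0) := by
          refine Finset.sum_le_sum fun i _ => ?_
          rw [integral_finsetSum _ fun j _ => pi i j]
          exact Finset.sum_le_sum fun j _ => hpair i j
      _ = _ := by simp only [Finset.sum_ite_eq, Finset.mem_univ, if_true, Finset.sum_const, Finset.card_univ, Fintype.card_fin, nsmul_eq_mul]; ring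
  have hsub : {X : Fin n → ℝ | ¬ |∑ i, ψ (φ (X i)) - n * I| ≤ η * n} ⊆
      {X | η^2 * (n:ℝ)^2 ≤ (∑ i, χ (X i)) ^ 2} := by
    intro X hX
    simp only [Set.mem_ofPred_eq, not_le, e1] at hX ⊢
    rw [← mul_pow, ← sq_abs (∑ i, χ (X i))]
    exact pow_le_pow_left₀ (by positivity) hX.le 2
  have hmk := (mul_meas_ge_le_integral_of_nonneg (ae_of_all _ fun X => sq_nonneg _) hi (η^2 * (n:ℝ)^2)).trans hE
  have h3 := measureReal_mono (μ := PX n) hsub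
  rw [le_div_iff₀ (by positivity), le_div_iff₀ n0]
  have h5 : n * ((PX n).real {X | ¬ |∑ i, ψ (φ (X i)) - n * I| ≤ η * n} * η^2 * n) ≤ n * (2*C)^2 := by
    calc _ = (η^2 * (n:ℝ)^2) * (PX n).real {X | ¬ |∑ i, ψ (φ (X i)) - n * I| ≤ η * n} := by ring
      _ ≤ (η^2 * (n:ℝ)^2) * (PX n).real {X | η^2 * (n:ℝ)^2 ≤ (∑ i, χ (X i)) ^ 2} := by gcongr
      _ ≤ _ := hmk
  exact le_of_mul_le_mul_left h5 n0

end Percolation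
end

open MeasureTheory Filter Topology ProbabilityTheory
noncomputable section
namespace Percolation

def II (D : ℝ → ℝ → ℝ) (f g : ℝ → ℝ) : ℝ := ∫ p : ℝ × ℝ, D p.1 p.2 * (f p.1 * g p.2) ∂(lam.prod lam)

section
variable {D : ℝ → ℝ → ℝ} (hD : Measurable (Function.uncurry D)) {K : ℝ} (hK : ∀ x y, |D x y| ≤ K)
  {f g : ℝ → ℝ} (hf : Measurable f) (hg : Measurable g) (f1 : ∀ x, |f x| ≤ 1) (g1 : ∀ x, |g x| ≤ 1)
include hD hK hf hg f1 g1

theorem II_int : Integrable (fun p : ℝ × ℝ => D p.1 p.2 * (f p.1 * g p.2)) (lam.prod lam) := by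
  have hm : Measurable (fun p : ℝ × ℝ => D p.1 p.2 * (f p.1 * g p.2)) :=
    hD.mul ((hf.comp measurable_fst).mul (hg.comp measurable_snd))
  refine bint hm (K * (1 * 1)) fun p => ?_
  have hK0 : 0 ≤ K := (abs_nonneg _).trans (hK 0 0)
  rw [abs_mul, abs_mul]
  have := f1 p.1
  have := g1 p.2
  have := hK p.1 p.2
  gcongr

theorem II_eq : II D f g = ∫ x, f x * (∫ y, D x y * g y ∂lam) ∂lam := by
  unfold II
  rw [integral_prod _ (II_int hD hK hf hg f1 g1)]
  refine integral_congr_ae (ae_of_all _ fun x => ?_)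
  simp only
  rw [← integral_const_mul]
  refine integral_congr_ae (ae_of_all _ fun y => ?_)
  simp only
  ring

theorem II_swap : II D f g = II (fun x y => D y x) g f := by
  unfold II
  rw [← integral_prod_swap]
  refine integral_congr_ae (ae_of_all _ fun p => ?_)
  simp only [Prod.fst_swap, Prod.snd_swap]
  ring

theorem II_ind (f0 : ∀ x, 0 ≤ f x) : ∃ A, MeasurableSet A ∧ II D f g ≤ II D (A.indicator 1) g := by
  set h : ℝ → ℝ := fun x => ∫ y, D x y * g y ∂lam with hh
  have hm : Measurable h := by
    have : StronglyMeasurable (Function.uncurry fun x y => D x y * g y) :=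
      (hD.mul (hg.comp measurable_snd)).stronglyMeasurable
    exact this.integral_prod_right.measurable
  have hb : ∀ x, |h x| ≤ K := by
    intro x
    have := norm_integral_le_of_norm_le_const (μ := lam) (f := fun y => D x y * g y) (C := K)
      (ae_of_all _ fun y => by
        rw [Real.norm_eq_abs, abs_mul]
        calc _ ≤ |D x y| * 1 := by have := g1 y; gcongr
          _ ≤ K := by rw [mul_one]; exact hK _ _)
    simpa using this
  have hA : MeasurableSet {x | 0 < h x} := measurableSet_lt measurable_const hm
  have i1 : ∀ x, |({x | 0 < h x} : Set ℝ).indicator (1 : ℝ → ℝ) x| ≤ 1 := by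
    intro x; by_cases hx : x ∈ {x | 0 < h x} <;> simp [Set.indicator, hx]
  have im : Measurable (({x | 0 < h x} : Set ℝ).indicator (1 : ℝ → ℝ)) := measurable_one.indicator hA
  refine ⟨_, hA, ?_⟩
  rw [II_eq hD hK hf hg f1 g1, II_eq hD hK im hg i1 g1]
  have ib : ∀ u : ℝ → ℝ, Measurable u → (∀ x, |u x| ≤ 1) → Integrable (fun x => u x * h x) lam := by
    intro u hu u1
    refine bint (hu.mul hm) (1 * K) fun x => ?_
    rw [abs_mul]
    exact mul_le_mul (u1 x) (hb x) (abs_nonneg _) zero_le_one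
  refine integral_mono (ib f hf f1) (ib _ im i1) fun x => ?_
  simp only
  change f x * h x ≤ _ * h x
  by_cases hx : 0 < h x
  · rw [Set.indicator_of_mem (by exact hx)]
    have := (abs_le.1 (f1 x)).2
    simp only [Pi.one_apply]; nlinarith
  · rw [Set.indicator_of_notMem (by exact hx)]
    have := f0 x
    push Not at hx
    nlinarith

end

theorem ind_one (A : Set ℝ) (x : ℝ) : |A.indicator (1 : ℝ → ℝ) x| ≤ 1 := by
  by_cases hx : x ∈ A <;> simp [hx]

theorem II_AB {D : ℝ → ℝ → ℝ} (hD : Measurable (Function.uncurry D)) {K : ℝ} (hK : ∀ x y, |D x y| ≤ K)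
    {A B : Set ℝ} (hA : MeasurableSet A) (hB : MeasurableSet B) :
    II D (A.indicator 1) (B.indicator 1) = ∫ x in A ∩ I01, ∫ y in B ∩ I01, D x y := by
  rw [II_eq hD hK (measurable_one.indicator hA) (measurable_one.indicator hB) (ind_one A) (ind_one B)]
  have h1 : ∀ x, ∫ y, D x y * B.indicator 1 y ∂lam = ∫ y in B ∩ I01, D x y := by
    intro x
    rw [lam, ← Measure.restrict_restrict hB, ← integral_indicator hB]
    congr 1; ext y; by_cases hy : y ∈ B <;> simp [hy]
  simp only [h1]
  rw [lam, ← Measure.restrict_restrict hA, ← integral_indicator hA]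
  congr 1; ext y; by_cases hy : y ∈ A <;> simp [hy]

theorem cut01 {D : ℝ → ℝ → ℝ} (hD : Measurable (Function.uncurry D)) {K C : ℝ} (hK : ∀ x y, |D x y| ≤ K)
    (hC : ∀ A B : Set ℝ, MeasurableSet A → MeasurableSet B → A ⊆ I01 → B ⊆ I01 →
      ∫ x in A, ∫ y in B, D x y ≤ C) {f g : ℝ → ℝ} (hf : Measurable f) (hg : Measurable g)
    (f0 : ∀ x, 0 ≤ f x) (g0 : ∀ x, 0 ≤ g x) (f1 : ∀ x, f x ≤ 1) (g1 : ∀ x, g x ≤ 1) : II D f g ≤ C := by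
  have f1' : ∀ x, |f x| ≤ 1 := fun x => by rw [abs_of_nonneg (f0 x)]; exact f1 x
  have g1' : ∀ x, |g x| ≤ 1 := fun x => by rw [abs_of_nonneg (g0 x)]; exact g1 x
  obtain ⟨A, hA, h1⟩ := II_ind hD hK hf hg f1' g1' f0
  have hD' : Measurable (Function.uncurry fun x y => D y x) := hD.comp measurable_swap
  have mA := (measurable_one.indicator hA : Measurable (A.indicator (1 : ℝ → ℝ)))
  obtain ⟨B, hB, h2⟩ := II_ind hD' (fun x y => hK y x) hg mA g1' (ind_one A) g0
  have mB := (measurable_one.indicator hB : Measurable (B.indicator (1 : ℝ → ℝ)))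
  rw [II_swap hD hK mA hg (ind_one A) g1'] at h1
  rw [← II_swap hD hK mA mB (ind_one A) (ind_one B), II_AB hD hK hA hB] at h2
  exact (h1.trans h2).trans (hC _ _ (hA.inter mI) (hB.inter mI) Set.inter_subset_right Set.inter_subset_right)

theorem cut4 {D : ℝ → ℝ → ℝ} (hD : Measurable (Function.uncurry D)) {K C : ℝ} (hK : ∀ x y, |D x y| ≤ K)
    (hC : ∀ A B : Set ℝ, MeasurableSet A → MeasurableSet B → A ⊆ I01 → B ⊆ I01 →
      |∫ x in A, ∫ y in B, D x y| ≤ C) {f g : ℝ → ℝ} (hf : Measurable f) (hg : Measurable g)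
    (f1 : ∀ x, |f x| ≤ 1) (g1 : ∀ x, |g x| ≤ 1) : |II D f g| ≤ 4 * C := by
  have key : ∀ u v : ℝ → ℝ, Measurable u → Measurable v → (∀ x, 0 ≤ u x) → (∀ x, 0 ≤ v x) →
      (∀ x, u x ≤ 1) → (∀ x, v x ≤ 1) → |II D u v| ≤ C := by
    intro u v hu hv u0 v0 u1 v1
    rw [abs_le]; constructor
    · have := cut01 (D := fun x y => -D x y) (K := K) (C := C) hD.neg (fun x y => by rw [abs_neg]; exact hK x y)
        (fun A B hA hB a b => by
          simp only [integral_neg]; exact (neg_le_abs _).trans (hC A B hA hB a b)) hu hv u0 v0 u1 v1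
      have e : II (fun x y => -D x y) u v = -II D u v := by
        unfold II; rw [← integral_neg]; congr 1; ext p; ring
      rw [e] at this; linarith
    · exact cut01 hD hK (fun A B hA hB a b => (le_abs_self _).trans (hC A B hA hB a b)) hu hv u0 v0 u1 v1
  set fp : ℝ → ℝ := fun x => max (f x) 0
  set fn : ℝ → ℝ := fun x => max (-f x) 0
  set gp : ℝ → ℝ := fun x => max (g x) 0
  set gn : ℝ → ℝ := fun x => max (-g x) 0
  have mfp : Measurable fp := hf.max measurable_const
  have mfn : Measurable fn := hf.neg.max measurable_const
  have mgp : Measurable gp := hg.max measurable_const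
  have mgn : Measurable gn := hg.neg.max measurable_const
  have bp : ∀ {u : ℝ}, |u| ≤ 1 → max u 0 ≤ 1 := fun h => max_le (abs_le.1 h).2 zero_le_one
  have bn : ∀ {u : ℝ}, |u| ≤ 1 → max (-u) 0 ≤ 1 := fun h => max_le (by linarith [(abs_le.1 h).1]) zero_le_one
  have ba : ∀ {u : ℝ}, u ≤ 1 → |max u 0| ≤ 1 := fun h => by
    rw [abs_of_nonneg (le_max_right _ _)]; exact max_le h zero_le_one
  have bb : ∀ {u : ℝ}, |u| ≤ 1 → -u ≤ 1 := fun h => by linarith [(abs_le.1 h).1]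
  have k1 := key fp gp mfp mgp (fun x => le_max_right _ _) (fun x => le_max_right _ _) (fun x => bp (f1 x)) (fun x => bp (g1 x))
  have k2 := key fp gn mfp mgn (fun x => le_max_right _ _) (fun x => le_max_right _ _) (fun x => bp (f1 x)) (fun x => bn (g1 x))
  have k3 := key fn gp mfn mgp (fun x => le_max_right _ _) (fun x => le_max_right _ _) (fun x => bn (f1 x)) (fun x => bp (g1 x))
  have k4 := key fn gn mfn mgn (fun x => le_max_right _ _) (fun x => le_max_right _ _) (fun x => bn (f1 x)) (fun x => bn (g1 x))
  have i1 := II_int hD hK mfp mgp (fun x => ba (abs_le.1 (f1 x)).2) (fun x => ba (abs_le.1 (g1 x)).2)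
  have i2 := II_int hD hK mfp mgn (fun x => ba (abs_le.1 (f1 x)).2) (fun x => ba (bb (g1 x)))
  have i3 := II_int hD hK mfn mgp (fun x => ba (bb (f1 x))) (fun x => ba (abs_le.1 (g1 x)).2)
  have i4 := II_int hD hK mfn mgn (fun x => ba (bb (f1 x))) (fun x => ba (bb (g1 x)))
  have e : II D f g = II D fp gp - II D fp gn - II D fn gp + II D fn gn := by
    unfold II
    rw [← integral_sub i1 i2, ← integral_sub (by exact i1.sub i2) i3,
      ← integral_add (by exact (i1.sub i2).sub i3) i4]
    congr 1; ext p
    have d : ∀ u : ℝ, u = max u 0 - max (-u) 0 := by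
      intro u
      rcases le_total u 0 with h | h
      · rw [max_eq_right h, max_eq_left (by linarith)]; ring
      · rw [max_eq_left h, max_eq_right (by linarith)]; ring
    calc D p.1 p.2 * (f p.1 * g p.2) = D p.1 p.2 * ((fp p.1 - fn p.1) * (gp p.2 - gn p.2)) := by
          rw [← d (f p.1), ← d (g p.2)]
      _ = _ := by ring
  rw [e]
  rw [abs_le] at *
  constructor <;> linarith [k1.1, k1.2, k2.1, k2.2, k3.1, k3.2, k4.1, k4.2]

theorem cutNorm_bd {D : ℝ → ℝ → ℝ} (hD : Measurable (Function.uncurry D)) {K : ℝ} (hK : ∀ x y, |D x y| ≤ K)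
    {A B : Set ℝ} (hA : MeasurableSet A) (hB : MeasurableSet B) (a : A ⊆ I01) (b : B ⊆ I01) :
    |∫ x in A, ∫ y in B, D x y| ≤ cutNorm D := by
  refine le_csSup ⟨K, ?_⟩ ⟨A, B, hA, hB, a, b, rfl⟩
  rintro r ⟨A, B, hA, hB, a, b, rfl⟩
  have := II_AB hD hK hA hB
  rw [Set.inter_eq_left.2 a, Set.inter_eq_left.2 b] at this
  rw [← this]
  unfold II
  have hm : |∫ p : ℝ × ℝ, D p.1 p.2 * (A.indicator 1 p.1 * B.indicator 1 p.2) ∂(lam.prod lam)| ≤ K := by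
    have := norm_integral_le_of_norm_le_const (μ := lam.prod lam)
      (f := fun p : ℝ × ℝ => D p.1 p.2 * (A.indicator 1 p.1 * B.indicator 1 p.2)) (C := K)
      (ae_of_all _ fun p => by
        rw [Real.norm_eq_abs, abs_mul, abs_mul]
        calc _ ≤ |D p.1 p.2| * (1 * 1) := by
              have := ind_one A p.1
              have := ind_one B p.2
              gcongr
          _ ≤ K := by simpa using hK _ _)
    simpa using this
  exact hm

theorem exists_phi {Wseq : ℕ → ℝ → ℝ → ℝ} {W : ℝ → ℝ → ℝ} {M : ℝ} (hS : ∀ n, Ker (Wseq n) M) (hW : Ker W M)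
    (hconv : Tendsto (fun n => cutDist (Wseq n) W) atTop (𝓝 0)) :
    ∃ φ : ℕ → ℝ → ℝ, ∃ ε : ℕ → ℝ, (∀ n, MeasurePreserving (φ n) lam lam) ∧ Tendsto ε atTop (𝓝 0) ∧
      ∀ n (f g : ℝ → ℝ), Measurable f → Measurable g → (∀ x, |f x| ≤ 1) → (∀ x, |g x| ≤ 1) →
        |II (fun x y => Wseq n x y - W (φ n x) (φ n y)) f g| ≤ ε n := by
  have h : ∀ n, ∃ φ : ℝ → ℝ, MeasurePreserving φ lam lam ∧
      cutNorm (fun x y => Wseq n x y - W (φ x) (φ y)) < cutDist (Wseq n) W + 1 / ((n:ℝ) + 1) := by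
    intro n
    have hne : {r | ∃ φ : ℝ → ℝ,
      MeasurePreserving φ (volume.restrict I01) (volume.restrict I01) ∧
      Set.BijOn φ I01 I01 ∧ r = cutNorm fun x y => Wseq n x y - W (φ x) (φ y)}.Nonempty :=
      ⟨_, id, MeasurePreserving.id _, Set.bijOn_id _, rfl⟩
    obtain ⟨r, ⟨φ, h1, h2, rfl⟩, h3⟩ := exists_lt_of_csInf_lt hne
      (show sInf _ < cutDist (Wseq n) W + 1 / ((n:ℝ) + 1) from lt_add_of_pos_right _ (by positivity))
    exact ⟨φ, h1, h3⟩
  choose φ h1 h2 using h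
  refine ⟨φ, fun n => 4 * (cutDist (Wseq n) W + 1 / ((n:ℝ) + 1)), h1, ?_, ?_⟩
  · have := (hconv.add tendsto_one_div_add_atTop_nhds_zero_nat).const_mul (4:ℝ)
    simpa using this
  · intro n f g hf hg f1 g1
    have hD : Measurable (Function.uncurry (fun x y => Wseq n x y - W (φ n x) (φ n y))) :=
      (hS n).meas.sub (hW.meas.comp (((h1 n).measurable.comp measurable_fst).prodMk
        ((h1 n).measurable.comp measurable_snd)))
    have hK : ∀ x y, |Wseq n x y - W (φ n x) (φ n y)| ≤ M := fun x y => by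
      have a := (hS n).nn x y
      have b := (hS n).le x y
      have a' := hW.nn (φ n x) (φ n y)
      have b' := hW.le (φ n x) (φ n y)
      rw [abs_le]; constructor <;> linarith
    refine (cut4 hD hK (fun A B hA hB a b => cutNorm_bd hD hK hA hB a b) hf hg f1 g1).trans ?_
    linarith [h2 n]

def Dn (c : ℝ) (Wn : ℝ → ℝ → ℝ) {m : ℕ} (U : Fin (m+1) → Fin (m+1) → ℝ) (φ : ℝ → ℝ) (x y : ℝ) : ℝ :=
  c * Wn x y - U (blk m (φ x)) (blk m (φ y))

theorem samp1 {Wseq : ℕ → ℝ → ℝ → ℝ} {W : ℝ → ℝ → ℝ} {M c : ℝ} (hS : ∀ n, Ker (Wseq n) M) (hW : Ker W M)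
    (hc : 0 < c) {φ : ℕ → ℝ → ℝ} {ε : ℕ → ℝ} (hφ : ∀ n, MeasurePreserving (φ n) lam lam)
    (ht : Tendsto ε atTop (𝓝 0))
    (hε : ∀ n (f g : ℝ → ℝ), Measurable f → Measurable g → (∀ x, |f x| ≤ 1) → (∀ x, |g x| ≤ 1) →
        |II (fun x y => Wseq n x y - W (φ n x) (φ n y)) f g| ≤ ε n) (M0 : 0 < M)
    {m : ℕ} {U : Fin (m+1) → Fin (m+1) → ℝ} (hU : ∀ a b, 0 ≤ U a b ∧ U a b ≤ c * M) {e0 η : ℝ}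
    (hU2 : ∫ p : ℝ × ℝ, |c * W p.1 p.2 - U (blk m p.1) (blk m p.2)| ∂(lam.prod lam) ≤ e0) (hη : 0 < η)
    (he : (c * M)^3 * e0 < η ^ 5) :
    ∀ᶠ n in atTop, (PX n).real {X | ¬ E1 (Dn c (Wseq n) U (φ n)) η X} ≤ η := by
  have mU : Measurable (fun p : ℝ × ℝ => U (blk m p.1) (blk m p.2)) := by
    have : Measurable (fun q : Fin (m+1) × Fin (m+1) => U q.1 q.2) := measurable_of_finite _
    exact this.comp (((blk_meas m).comp measurable_fst).prodMk ((blk_meas m).comp measurable_snd))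
  have hb : ∀ n (f g : ℝ → ℝ), Measurable f → Measurable g → (∀ x, |f x| ≤ 1) → (∀ x, |g x| ≤ 1) →
      |∫ p, Dn c (Wseq n) U (φ n) p.1 p.2 * (f p.1 * g p.2) ∂(lam.prod lam)| ≤ c * ε n + e0 := by
    intro n f g hf hg f1 g1
    have hpm : Measurable (fun p : ℝ × ℝ => (φ n p.1, φ n p.2)) :=
      ((hφ n).measurable.comp measurable_fst).prodMk ((hφ n).measurable.comp measurable_snd)
    have hD1 : Measurable (Function.uncurry (fun x y => Wseq n x y - W (φ n x) (φ n y))) :=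
      (hS n).meas.sub (hW.meas.comp hpm)
    have hD2 : Measurable (Function.uncurry (fun x y => c * W (φ n x) (φ n y) - U (blk m (φ n x)) (blk m (φ n y)))) :=
      ((hW.meas.comp hpm).const_mul c).sub (mU.comp hpm)
    have hK1 : ∀ x y, |Wseq n x y - W (φ n x) (φ n y)| ≤ M := fun x y => by
      have a := (hS n).nn x y
      have b := (hS n).le x y
      have a' := hW.nn (φ n x) (φ n y)
      have b' := hW.le (φ n x) (φ n y)
      rw [abs_le]; constructor <;> linarith
    have hK2 : ∀ x y, |c * W x y - U (blk m x) (blk m y)| ≤ c * M := fun x y => by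
      have a' := mul_nonneg hc.le (hW.nn x y)
      have b' := mul_le_mul_of_nonneg_left (hW.le x y) hc.le
      have := hU (blk m x) (blk m y)
      rw [abs_le]; constructor <;> linarith [this.1, this.2]
    have e : ∫ p, Dn c (Wseq n) U (φ n) p.1 p.2 * (f p.1 * g p.2) ∂(lam.prod lam) =
        c * II (fun x y => Wseq n x y - W (φ n x) (φ n y)) f g +
        II (fun x y => c * W (φ n x) (φ n y) - U (blk m (φ n x)) (blk m (φ n y))) f g := by
      unfold II
      rw [← integral_const_mul, ← integral_add ((II_int hD1 hK1 hf hg f1 g1).const_mul c)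
        (II_int hD2 (fun x y => hK2 _ _) hf hg f1 g1)]
      congr 1; ext p; unfold Dn; ring
    rw [e]
    have h2 : |II (fun x y => c * W (φ n x) (φ n y) - U (blk m (φ n x)) (blk m (φ n y))) f g| ≤ e0 := by
      have mp : MeasurePreserving (Prod.map (φ n) (φ n)) (lam.prod lam) (lam.prod lam) := (hφ n).prod (hφ n)
      have mF : Measurable (fun p : ℝ × ℝ => |c * W p.1 p.2 - U (blk m p.1) (blk m p.2)|) :=
        ((hW.meas.const_mul c).sub mU).abs
      have iF : Integrable (fun p : ℝ × ℝ => |c * W p.1 p.2 - U (blk m p.1) (blk m p.2)|) (lam.prod lam) :=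
        bint mF (c * M) fun p => by rw [abs_abs]; exact hK2 _ _
      have h3 : ∫ p, |c * W p.1 p.2 - U (blk m p.1) (blk m p.2)| ∂(lam.prod lam) =
          ∫ p : ℝ × ℝ, |c * W (φ n p.1) (φ n p.2) - U (blk m (φ n p.1)) (blk m (φ n p.2))| ∂(lam.prod lam) := by
        conv_lhs => rw [← mp.map_eq]
        rw [integral_map mp.measurable.aemeasurable mF.aestronglyMeasurable]
        rfl
      refine le_trans ?_ hU2
      rw [h3]
      unfold II
      rw [← Real.norm_eq_abs]
      refine (norm_integral_le_integral_norm _).trans ?_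
      have i4 : Integrable (fun p : ℝ × ℝ => |c * W (φ n p.1) (φ n p.2) - U (blk m (φ n p.1)) (blk m (φ n p.2))|)
          (lam.prod lam) := bint hD2.abs (c * M) fun p => by
            change |(|_|)| ≤ _
            rw [abs_abs]; exact hK2 _ _
      refine integral_mono (II_int hD2 (fun x y => hK2 _ _) hf hg f1 g1).norm i4 fun p => ?_
      simp only [Real.norm_eq_abs]
      rw [abs_mul, abs_mul]
      calc _ ≤ |c * W (φ n p.1) (φ n p.2) - U (blk m (φ n p.1)) (blk m (φ n p.2))| * (1 * 1) := by
            have := f1 p.1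
            have := g1 p.2
            gcongr
        _ = _ := by ring
    calc _ ≤ |c * II (fun x y => Wseq n x y - W (φ n x) (φ n y)) f g| + _ := abs_add_le _ _
      _ ≤ c * ε n + e0 := by
        rw [abs_mul, abs_of_pos hc]
        exact add_le_add (mul_le_mul_of_nonneg_left (hε n f g hf hg f1 g1) hc.le) h2
  have hlim : Tendsto (fun n : ℕ => ((c*M)^3 * (c * ε n + e0) + 5 * (c*M)^4 / n) / η^4) atTop
      (𝓝 (((c*M)^3 * (c * 0 + e0) + 0) / η^4)) := by
    refine ((((ht.const_mul c).add_const e0).const_mul _).add ?_).div_const _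
    exact tendsto_const_div_atTop_nhds_zero_nat _
  have hlt : ((c*M)^3 * (c * 0 + e0) + 0) / η^4 < η := by
    rw [div_lt_iff₀ (by positivity)]; ring_nf at he ⊢; linarith
  filter_upwards [hlim.eventually (gt_mem_nhds hlt), eventually_gt_atTop 0] with n h1 h2
  refine (E1_prob ?_ (K := c * M) ?_ (hb n) (by positivity) h2 hη).trans h1.le
  · have hpm : Measurable (fun p : ℝ × ℝ => (φ n p.1, φ n p.2)) :=
      ((hφ n).measurable.comp measurable_fst).prodMk ((hφ n).measurable.comp measurable_snd)
    exact ((hS n).meas.const_mul c).sub (mU.comp hpm)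
  · intro x y
    have a' := mul_nonneg hc.le ((hS n).nn x y)
    have b' := mul_le_mul_of_nonneg_left ((hS n).le x y) hc.le
    have := hU (blk m (φ n x)) (blk m (φ n y))
    unfold Dn
    rw [abs_le]; constructor <;> linarith [this.1, this.2]

def E2 {n : ℕ} {ι : Type*} (ψ : ι → ℝ → ℝ) (φ : ℝ → ℝ) (η : ℝ) (X : Fin n → ℝ) : Prop :=
  ∀ a, |∑ i, ψ a (φ (X i)) - n * ∫ x, ψ a x ∂lam| ≤ η * n

theorem samp2 {φ : ℕ → ℝ → ℝ} (hφ : ∀ n, MeasurePreserving (φ n) lam lam) {ι : Type*} [Fintype ι] {ψ : ι → ℝ → ℝ}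
    (hψ : ∀ a, Measurable (ψ a)) {C : ℝ} (hC : ∀ a x, |ψ a x| ≤ C) {η θ : ℝ} (hη : 0 < η) (hθ : 0 < θ) :
    ∀ᶠ n in atTop, (PX n).real {X | ¬ E2 ψ (φ n) η X} ≤ θ := by
  have hlim : Tendsto (fun n : ℕ => Fintype.card ι * ((2*C)^2 / n / η^2)) atTop (𝓝 (Fintype.card ι * (0 / η^2))) :=
    ((tendsto_const_div_atTop_nhds_zero_nat _).div_const _).const_mul _
  simp only [zero_div, mul_zero] at hlim
  filter_upwards [hlim.eventually (gt_mem_nhds hθ), eventually_gt_atTop 0] with n h1 h2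
  refine le_trans ?_ h1.le
  have hs : {X : Fin n → ℝ | ¬ E2 ψ (φ n) η X} ⊆
      ⋃ a, {X | ¬ |∑ i, ψ a (φ n (X i)) - n * ∫ x, ψ a x ∂lam| ≤ η * n} := by
    intro X hX
    change ¬ E2 _ _ _ _ at hX
    unfold E2 at hX
    push Not at hX
    obtain ⟨a, ha⟩ := hX
    exact Set.mem_iUnion.2 ⟨a, not_le.2 ha⟩
  refine (measureReal_mono hs).trans ((measureReal_iUnion_fintype_le _).trans ?_)
  calc _ ≤ ∑ a : ι, (2*C)^2 / n / η^2 := Finset.sum_le_sum fun a _ => E2_prob (hφ n) (hψ a) (hC a) h2 hη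
    _ = _ := by simp

end Percolation
end

open MeasureTheory Filter Topology ProbabilityTheory
noncomputable section
namespace Percolation
set_option linter.unusedSectionVars false

section
variable {V : Type*} [Fintype V] [DecidableEq V]

def wt (p : Sym2 V → ℝ) (e : Sym2 V → Bool) : ℝ := ∏ f, if e f then p f else 1 - p f

def EE (p : Sym2 V → ℝ) (F : (Sym2 V → Bool) → ℝ) : ℝ := ∑ e, wt p e * F e

structure PP (p : Sym2 V → ℝ) (B : ℝ) : Prop where
  nn : ∀ f, 0 ≤ p f
  le1 : ∀ f, p f ≤ 1
  le : ∀ f, p f ≤ B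

def ev (e : Sym2 V → Bool) (f : Sym2 V) : ℝ := if e f then 1 else 0

theorem ev0 (e : Sym2 V → Bool) (f : Sym2 V) : 0 ≤ ev e f := by unfold ev; split_ifs <;> norm_num
theorem ev1 (e : Sym2 V → Bool) (f : Sym2 V) : ev e f ≤ 1 := by unfold ev; split_ifs <;> norm_num

theorem wt_nn {p : Sym2 V → ℝ} {B : ℝ} (hp : PP p B) (e : Sym2 V → Bool) : 0 ≤ wt p e :=
  Finset.prod_nonneg fun f _ => by
    split_ifs
    · exact hp.nn f
    · linarith [hp.le1 f]

theorem wt_sum (p : Sym2 V → ℝ) : ∑ e, wt p e = 1 := by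
  unfold wt
  have := Fintype.prod_sum (κ := fun _ : Sym2 V => Bool) (fun f (b : Bool) => if b then p f else 1 - p f)
  rw [← this]
  simp

theorem EE_mono {p : Sym2 V → ℝ} {B : ℝ} (hp : PP p B) {F G : (Sym2 V → Bool) → ℝ} (h : ∀ e, F e ≤ G e) :
    EE p F ≤ EE p G :=
  Finset.sum_le_sum fun e _ => mul_le_mul_of_nonneg_left (h e) (wt_nn hp e)

theorem EE_const (p : Sym2 V → ℝ) (c : ℝ) : EE p (fun _ => c) = c := by
  unfold EE; rw [← Finset.sum_mul, wt_sum, one_mul]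

theorem EE_add (p : Sym2 V → ℝ) (F G : (Sym2 V → Bool) → ℝ) :
    EE p (fun e => F e + G e) = EE p F + EE p G := by
  unfold EE; rw [← Finset.sum_add_distrib]; congr 1; ext e; ring

theorem EE_mul (p : Sym2 V → ℝ) (c : ℝ) (F : (Sym2 V → Bool) → ℝ) :
    EE p (fun e => c * F e) = c * EE p F := by
  unfold EE; rw [Finset.mul_sum]; congr 1; ext e; ring

theorem EE_sum {ι : Type*} (s : Finset ι) (p : Sym2 V → ℝ) (F : ι → (Sym2 V → Bool) → ℝ) :
    EE p (fun e => ∑ i ∈ s, F i e) = ∑ i ∈ s, EE p (F i) := by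
  unfold EE; rw [Finset.sum_comm]; congr 1; ext e; rw [Finset.mul_sum]

def Free (f : Sym2 V) (F : (Sym2 V → Bool) → ℝ) : Prop := ∀ e b, F (Function.update e f b) = F e

theorem EE_edge (p : Sym2 V → ℝ) {f : Sym2 V} {G : (Sym2 V → Bool) → ℝ} (hG : Free f G) :
    EE p (fun e => ev e f * G e) = p f * EE p G := by
  rw [← EE_mul, ← sub_eq_zero]
  unfold EE
  rw [← Finset.sum_sub_distrib]
  refine Finset.sum_involution (fun e _ => Function.update e f (!e f)) ?_ ?_ ?_ ?_
  · intro e _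
    have hw : ∀ e' : Sym2 V → Bool, wt p e' = (if e' f then p f else 1 - p f) *
        ∏ g ∈ Finset.univ.erase f, if e' g then p g else 1 - p g := fun e' =>
      (Finset.mul_prod_erase Finset.univ (fun g => if e' g then p g else 1 - p g) (Finset.mem_univ f)).symm
    have hr : ∏ g ∈ Finset.univ.erase f, (if (Function.update e f (!e f)) g then p g else 1 - p g) =
        ∏ g ∈ Finset.univ.erase f, if e g then p g else 1 - p g :=
      Finset.prod_congr rfl fun g hg => by rw [Function.update_of_ne (Finset.ne_of_mem_erase hg)]
    beta_reduce
    rw [hG, hw e, hw (Function.update e f (!e f)), hr]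
    unfold ev
    rw [Function.update_self]
    cases e f <;> simp <;> ring
  · intro e _ _ h
    have := congrFun h f
    rw [Function.update_self] at this
    cases h2 : e f <;> rw [h2] at this <;> simp at this
  · intro e _; exact Finset.mem_univ _
  · intro e _; simp

theorem Free.mul {f : Sym2 V} {F G : (Sym2 V → Bool) → ℝ} (hF : Free f F) (hG : Free f G) :
    Free f (fun e => F e * G e) := fun e b => by simp only [hF e b, hG e b]

theorem Free.one_sub {f : Sym2 V} {F : (Sym2 V → Bool) → ℝ} (hF : Free f F) (c : ℝ) :
    Free f (fun e => 1 - c * F e) := fun e b => by simp only [hF e b]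

theorem ev_upd {f g : Sym2 V} (h : g ≠ f) (e : Sym2 V → Bool) (b : Bool) : ev (Function.update e f b) g = ev e g := by
  unfold ev; rw [Function.update_of_ne h]

theorem EE_prod {ι : Type*} [DecidableEq ι] (p : Sym2 V → ℝ) (T : Finset ι) (d : ι → Sym2 V) (x : ι → (Sym2 V → Bool) → ℝ)
    (hd : ∀ f ∈ T, ∀ g ∈ T, d f = d g → f = g)
    (hx : ∀ f ∈ T, ∀ g ∈ T, Free (d f) (x g)) :
    ∀ (y : (Sym2 V → Bool) → ℝ), (∀ f ∈ T, Free (d f) y) →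
    EE p (fun e => (∏ f ∈ T, (1 - ev e (d f) * x f e)) * y e) =
      EE p (fun e => (∏ f ∈ T, (1 - p (d f) * x f e)) * y e) := by
  induction T using Finset.induction_on with
  | empty => intro y _; simp
  | insert f T hf ih =>
    intro y hy
    have hfree : Free (d f) (fun e => x f e * ((∏ g ∈ T, (1 - ev e (d g) * x g e)) * y e)) := by
      refine (hx f (by simp) f (by simp)).mul (Free.mul ?_ (hy f (by simp)))
      intro e b
      refine Finset.prod_congr rfl fun g hg => ?_
      rw [hx f (by simp) g (by simp [hg]) e b,
        ev_upd (show d g ≠ d f from fun h => hf (hd g (by simp [hg]) f (by simp) h ▸ hg)) e b]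
    have h1 := EE_edge p hfree
    have h2 : EE p (fun e => (∏ g ∈ insert f T, (1 - ev e (d g) * x g e)) * y e) =
        EE p (fun e => (∏ g ∈ T, (1 - ev e (d g) * x g e)) * y e) -
        EE p (fun e => ev e (d f) * (x f e * ((∏ g ∈ T, (1 - ev e (d g) * x g e)) * y e))) := by
      rw [eq_sub_iff_add_eq, ← EE_add]; congr 1; ext e; rw [Finset.prod_insert hf]; ring
    have h3 : EE p (fun e => (∏ g ∈ T, (1 - ev e (d g) * x g e)) * ((1 - p (d f) * x f e) * y e)) =
        EE p (fun e => (∏ g ∈ T, (1 - ev e (d g) * x g e)) * y e) -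
        p (d f) * EE p (fun e => (x f e * ((∏ g ∈ T, (1 - ev e (d g) * x g e)) * y e))) := by
      rw [eq_sub_iff_add_eq, ← EE_mul, ← EE_add]; congr 1; ext e; ring
    rw [h2, h1, ← h3, ih (fun f h g hg => hd f (by simp [h]) g (by simp [hg]))
      (fun f' h' g hg => hx f' (by simp [h']) g (by simp [hg])) _
      (fun g hg => ((hx g (by simp [hg]) f (by simp)).one_sub _).mul (hy g (by simp [hg])))]
    congr 1; ext e; rw [Finset.prod_insert hf]; ring

def NN (e : Sym2 V → Bool) : ℕ → V → Finset V → ℝ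
  | 0 => fun _ _ => 0
  | h + 1 => fun v S => ∏ w ∈ (insert v S)ᶜ, (1 - ev e s(v, w) * (1 - NN e h w (insert v S)))

def BB (e : Sym2 V → Bool) : ℕ → V → Finset V → ℝ
  | 0 => fun _ _ => 1
  | h + 1 => fun v S => 1 + ∑ w ∈ (insert v S)ᶜ, ev e s(v, w) * BB e h w (insert v S)

def rr (p : Sym2 V → ℝ) : ℕ → V → ℝ
  | 0 => fun _ => 0
  | h + 1 => fun v => Real.exp (-∑ w, p s(v, w) * (1 - rr p h w))

theorem NN01 (e : Sym2 V → Bool) (h : ℕ) : ∀ v S, 0 ≤ NN e h v S ∧ NN e h v S ≤ 1 := by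
  induction h with
  | zero => intro v S; simp [NN]
  | succ h ih =>
    intro v S
    have a : ∀ w, 0 ≤ ev e s(v, w) * (1 - NN e h w (insert v S)) := fun w =>
      mul_nonneg (ev0 _ _) (by linarith [(ih w (insert v S)).2])
    have b : ∀ w, ev e s(v, w) * (1 - NN e h w (insert v S)) ≤ 1 := fun w =>
      mul_le_one₀ (ev1 _ _) (by linarith [(ih w (insert v S)).2]) (by linarith [(ih w (insert v S)).1])
    exact ⟨Finset.prod_nonneg fun w _ => by linarith [b w],
      Finset.prod_le_one (fun w _ => by linarith [b w]) fun w _ => by linarith [a w]⟩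

theorem NNdi (e : Sym2 V → Bool) (h : ℕ) : ∀ v S, NN e h v S = 0 ∨ NN e h v S = 1 := by
  induction h with
  | zero => intro v S; simp [NN]
  | succ h ih =>
    intro v S
    by_cases hz : ∃ w ∈ (insert v S)ᶜ, 1 - ev e s(v, w) * (1 - NN e h w (insert v S)) = 0
    · obtain ⟨w, hw, h0⟩ := hz
      exact Or.inl (Finset.prod_eq_zero hw h0)
    · right
      refine Finset.prod_eq_one fun w hw => ?_
      push Not at hz
      have := hz w hw
      unfold ev at this ⊢
      rcases ih w (insert v S) with h1 | h1 <;> rw [h1] at this ⊢ <;> split_ifs at this ⊢ <;> simp_all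

theorem NNmono (e : Sym2 V → Bool) (h : ℕ) : ∀ v {S S' : Finset V}, S ⊆ S' → NN e h v S ≤ NN e h v S' := by
  induction h with
  | zero => intro v S S' _; simp [NN]
  | succ h ih =>
    intro v S S' hS
    have hi : insert v S ⊆ insert v S' := Finset.insert_subset_insert _ hS
    have b : ∀ w S, 0 ≤ 1 - ev e s(v, w) * (1 - NN e h w (insert v S)) := fun w S => by
      have := mul_le_one₀ (ev1 e s(v, w)) (b := 1 - NN e h w (insert v S)) (by linarith [(NN01 e h w (insert v S)).2])
        (by linarith [(NN01 e h w (insert v S)).1])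
      linarith
    have a : ∀ w S, 1 - ev e s(v, w) * (1 - NN e h w (insert v S)) ≤ 1 := fun w S => by
      have := mul_nonneg (ev0 e s(v, w)) (b := 1 - NN e h w (insert v S)) (by linarith [(NN01 e h w (insert v S)).2])
      linarith
    calc NN e (h+1) v S = ∏ w ∈ (insert v S)ᶜ, (1 - ev e s(v, w) * (1 - NN e h w (insert v S))) := rfl
      _ ≤ ∏ w ∈ (insert v S')ᶜ, (1 - ev e s(v, w) * (1 - NN e h w (insert v S))) :=
by
        rw [← Finset.prod_sdiff (Finset.compl_subset_compl.2 hi)]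
        exact mul_le_of_le_one_left (Finset.prod_nonneg fun w _ => b w S)
          (Finset.prod_le_one (fun w _ => b w S) fun w _ => a w S)
      _ ≤ ∏ w ∈ (insert v S')ᶜ, (1 - ev e s(v, w) * (1 - NN e h w (insert v S'))) :=
        Finset.prod_le_prod (fun w _ => b w S) fun w _ => by
          have := ih w hi
          have := ev0 e s(v, w)
          gcongr

theorem NNfree (h : ℕ) : ∀ (v : V) (S : Finset V), v ∉ S → ∀ a ∈ S, ∀ b, Free s(a, b) (fun e => NN e h v S) := by
  induction h with
  | zero => intro v S _ a _ b e c; rfl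
  | succ h ih =>
    intro v S hv a ha b e c
    refine Finset.prod_congr rfl fun w hw => ?_
    have hw' : w ∉ insert v S := Finset.mem_compl.1 hw
    have hi := ih w _ hw' a (Finset.mem_insert_of_mem ha) b e c
    beta_reduce at hi ⊢
    rw [hi, ev_upd (g := s(v, w)) ?_ e c]
    intro h
    rcases Sym2.eq_iff.1 h with ⟨h1, _⟩ | ⟨_, h1⟩
    · exact hv (h1 ▸ ha)
    · exact hw' (Finset.mem_insert_of_mem (h1 ▸ ha))

theorem BB0 (e : Sym2 V → Bool) (h : ℕ) : ∀ v S, 1 ≤ BB e h v S := by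
  induction h with
  | zero => intro v S; simp [BB]
  | succ h ih =>
    intro v S
    have : 0 ≤ ∑ w ∈ (insert v S)ᶜ, ev e s(v, w) * BB e h w (insert v S) :=
      Finset.sum_nonneg fun w _ => mul_nonneg (ev0 _ _) (by linarith [ih w (insert v S)])
    simp only [BB]; linarith

theorem BBfree (h : ℕ) : ∀ (v : V) (S : Finset V), v ∉ S → ∀ a ∈ S, ∀ b, Free s(a, b) (fun e => BB e h v S) := by
  induction h with
  | zero => intro v S _ a _ b e c; rfl
  | succ h ih =>
    intro v S hv a ha b e c
    simp only [BB]
    congr 1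
    refine Finset.sum_congr rfl fun w hw => ?_
    have hw' : w ∉ insert v S := Finset.mem_compl.1 hw
    have hi := ih w _ hw' a (Finset.mem_insert_of_mem ha) b e c
    beta_reduce at hi ⊢
    rw [hi, ev_upd (g := s(v, w)) ?_ e c]
    intro h
    rcases Sym2.eq_iff.1 h with ⟨h1, _⟩ | ⟨_, h1⟩
    · exact hv (h1 ▸ ha)
    · exact hw' (Finset.mem_insert_of_mem (h1 ▸ ha))

def Cb (K : ℝ) : ℕ → ℝ
  | 0 => 1
  | h + 1 => 1 + K * Cb K h

theorem Cb1 {K : ℝ} (hK : 0 ≤ K) (h : ℕ) : 1 ≤ Cb K h := by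
  induction h with
  | zero => simp [Cb]
  | succ h ih => simp only [Cb]; nlinarith

theorem EBB {p : Sym2 V → ℝ} {B K : ℝ} (hp : PP p B) (hK : Fintype.card V * B ≤ K) (B0 : 0 ≤ B) (h : ℕ) :
    ∀ v S, v ∉ S → EE p (fun e => BB e h v S) ≤ Cb K h := by
  have K0 : 0 ≤ K := le_trans (by positivity) hK
  induction h with
  | zero => intro v S _; simp only [BB, Cb]; rw [EE_const]
  | succ h ih =>
    intro v S hv
    simp only [BB, Cb]
    rw [EE_add, EE_const, EE_sum]
    gcongr
    calc _ ≤ ∑ w ∈ (insert v S)ᶜ, B * Cb K h := by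
          refine Finset.sum_le_sum fun w hw => ?_
          have hw' : w ∉ insert v S := Finset.mem_compl.1 hw
          rw [EE_edge p (BBfree h w _ hw' v (Finset.mem_insert_self _ _) w)]
          have h1 := ih w _ hw'
          have h2 := hp.nn s(v, w)
          have h3 := hp.le s(v, w)
          calc _ ≤ p s(v, w) * Cb K h := by gcongr
            _ ≤ _ := by
              have := Cb1 K0 h
              gcongr
      _ ≤ (Fintype.card V : ℝ) * (B * Cb K h) := by
          rw [Finset.sum_const, nsmul_eq_mul]
          have := Cb1 K0 h
          gcongr
          exact Finset.card_le_univ _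
      _ ≤ K * Cb K h := by
          rw [← mul_assoc]
          have := Cb1 K0 h
          gcongr

end
end Percolation
end

open MeasureTheory Filter Topology ProbabilityTheory
noncomputable section
namespace Percolation
set_option linter.unusedSectionVars false

section
variable {V : Type*} [Fintype V] [DecidableEq V]

theorem rr01 {p : Sym2 V → ℝ} {B : ℝ} (hp : PP p B) (h : ℕ) : ∀ v, 0 ≤ rr p h v ∧ rr p h v ≤ 1 := by
  induction h with
  | zero => intro v; simp [rr]
  | succ h ih =>
    intro v
    refine ⟨(Real.exp_pos _).le, Real.exp_le_one_iff.2 ?_⟩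
    rw [neg_nonpos]
    exact Finset.sum_nonneg fun w _ => mul_nonneg (hp.nn _) (by linarith [(ih w).2])

theorem exp_lip {a b : ℝ} (ha : 0 ≤ a) (hb : 0 ≤ b) : |Real.exp (-a) - Real.exp (-b)| ≤ |a - b| := by
  wlog h : a ≤ b generalizing a b
  · rw [abs_sub_comm, abs_sub_comm a]; exact this hb ha (le_of_not_ge h)
  rw [abs_of_nonneg (sub_nonneg.2 (Real.exp_le_exp.2 (by linarith))), abs_of_nonpos (by linarith)]
  have h1 : Real.exp (-b) = Real.exp (-a) * Real.exp (-(b - a)) := by rw [← Real.exp_add]; congr 1; ring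
  have h2 := Real.add_one_le_exp (-(b - a))
  have h3 : Real.exp (-a) ≤ 1 := Real.exp_le_one_iff.2 (by linarith)
  have h4 := Real.exp_pos (-a)
  rw [h1]
  nlinarith

theorem EE_exp {p : Sym2 V → ℝ} {B : ℝ} (hp : PP p B) {Z : (Sym2 V → Bool) → ℝ} {z θ : ℝ} (hZ : ∀ e, 0 ≤ Z e) (hz : 0 ≤ z)
    (hθ : 0 < θ) (h : EE p (fun e => (Z e - z)^2) ≤ θ^2) :
    |EE p (fun e => Real.exp (-Z e)) - Real.exp (-z)| ≤ 2 * θ := by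
  have key : ∀ e, |Real.exp (-Z e) - Real.exp (-z)| ≤ θ + θ⁻¹ * (Z e - z)^2 := by
    intro e
    refine (exp_lip (hZ e) hz).trans ?_
    have h1 : 0 ≤ (|Z e - z| - θ)^2 := sq_nonneg _
    have h2 : |Z e - z|^2 = (Z e - z)^2 := sq_abs _
    have h3 : |Z e - z| * θ ≤ (θ + θ⁻¹ * (Z e - z)^2) * θ := by
      have : (θ + θ⁻¹ * (Z e - z)^2) * θ = θ^2 + (Z e - z)^2 := by field_simp
      rw [this]; nlinarith [abs_nonneg (Z e - z)]
    exact le_of_mul_le_mul_right h3 hθ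
  have hE : EE p (fun e => θ + θ⁻¹ * (Z e - z)^2) ≤ 2 * θ := by
    rw [EE_add, EE_const, EE_mul]
    have : θ⁻¹ * EE p (fun e => (Z e - z)^2) ≤ θ⁻¹ * θ^2 := by gcongr
    have h2 : θ⁻¹ * θ^2 = θ := by field_simp
    linarith
  rw [abs_le]
  constructor
  · have := EE_mono hp (F := fun e => Real.exp (-z)) (G := fun e => Real.exp (-Z e) + (θ + θ⁻¹ * (Z e - z)^2))
      (fun e => by linarith [(abs_le.1 (key e)).1])
    rw [EE_const, EE_add] at this; linarith
  · have := EE_mono hp (G := fun e => Real.exp (-z) + (θ + θ⁻¹ * (Z e - z)^2)) (F := fun e => Real.exp (-Z e))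
      (fun e => by linarith [(abs_le.1 (key e)).2])
    rw [EE_add, EE_const] at this; linarith

theorem prod_lower {ι : Type*} [DecidableEq ι] (T : Finset ι) (x : ι → ℝ) (h0 : ∀ i, 0 ≤ x i) (h1 : ∀ i, x i ≤ 1) :
    Real.exp (-∑ i ∈ T, x i) - ∑ i ∈ T, x i ^ 2 ≤ ∏ i ∈ T, (1 - x i) := by
  induction T using Finset.induction_on with
  | empty => simp
  | insert i T hi ih =>
    rw [Finset.sum_insert hi, Finset.sum_insert hi, Finset.prod_insert hi, neg_add, Real.exp_add]
    set E := Real.exp (-∑ i ∈ T, x i)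
    set s := ∑ i ∈ T, x i ^ 2
    set P := ∏ i ∈ T, (1 - x i)
    have s0 : 0 ≤ s := Finset.sum_nonneg fun i _ => sq_nonneg _
    have E0 : 0 ≤ E := (Real.exp_pos _).le
    have E1 : E ≤ 1 := Real.exp_le_one_iff.2 (neg_nonpos.2 (Finset.sum_nonneg fun i _ => h0 i))
    have a0 := h0 i
    have a1 := h1 i
    have he : Real.exp (-x i) ≤ 1 - x i + x i ^ 2 := by
      have := Real.abs_exp_sub_one_sub_id_le (x := -x i) (by rw [abs_neg, abs_of_nonneg a0]; exact a1)
      have := (abs_le.1 this).2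
      nlinarith
    have e1 : (1 - x i) * (E - s) ≤ (1 - x i) * P := mul_le_mul_of_nonneg_left ih (by linarith)
    have e2 : Real.exp (-x i) * E ≤ (1 - x i + x i ^ 2) * E := mul_le_mul_of_nonneg_right he E0
    nlinarith [mul_nonneg a0 s0, mul_le_mul_of_nonneg_left E1 (sq_nonneg (x i))]

theorem prod_upper {ι : Type*} [DecidableEq ι] (T : Finset ι) (x : ι → ℝ) (h1 : ∀ i, x i ≤ 1) :
    ∏ i ∈ T, (1 - x i) ≤ Real.exp (-∑ i ∈ T, x i) := by
  rw [← Finset.sum_neg_distrib, Real.exp_sum]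
  exact Finset.prod_le_prod (fun i _ => by linarith [h1 i]) fun i _ => by
    have := Real.add_one_le_exp (-x i); linarith

end

def SM (K : ℝ) (h : ℕ) : Prop := ∀ (s : ℕ) (A : ℝ), 0 < A → ∀ η > 0, ∀ᶠ n : ℕ in atTop, ∀ p : Sym2 (Fin n) → ℝ,
  PP p (K / n) → ∀ S : Finset (Fin n), S.card ≤ s → ∀ a : Fin n → ℝ, (∀ w, 0 ≤ a w ∧ a w ≤ A / n) →
  EE p (fun e => (∑ w ∈ Sᶜ, a w * (NN e h w S - rr p h w))^2) ≤ η

def PR (K : ℝ) (h : ℕ) : Prop := ∀ (s : ℕ), ∀ η > 0, ∀ᶠ n : ℕ in atTop, ∀ p : Sym2 (Fin n) → ℝ,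
  PP p (K / n) → ∀ S : Finset (Fin n), S.card ≤ s → ∀ v ∉ S,
  rr p h v - η ≤ EE p (fun e => NN e h v S) ∧
  ∀ v' ∉ S, v ≠ v' → EE p (fun e => NN e h v S * NN e h v' S) ≤ rr p h v * rr p h v' + η

theorem SM_zero (K : ℝ) : SM K 0 := by
  intro s A hA η hη
  refine Eventually.of_forall fun n p hp S hS a ha => ?_
  simp only [NN, rr, sub_zero, mul_zero, Finset.sum_const_zero]
  rw [EE_const]; nlinarith

theorem SM_of_PR {K : ℝ} {h : ℕ} (H : PR K h) : SM K h := by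
  intro s A hA η hη
  set η' := η / (6 * A^2) with hη'
  have e0 : 0 < η' := by positivity
  have hl : Tendsto (fun n : ℕ => A^2 / (n:ℝ)) atTop (𝓝 0) := tendsto_const_div_atTop_nhds_zero_nat _
  filter_upwards [H s η' e0, hl.eventually (gt_mem_nhds (show (0:ℝ) < η / 2 by positivity)), eventually_gt_atTop 0]
    with n h1 h2 h3 p hp S hS a ha
  have n0 : (0:ℝ) < n := by exact_mod_cast h3
  have e1 : EE p (fun e => (∑ w ∈ Sᶜ, a w * (NN e h w S - rr p h w))^2) =
      ∑ w ∈ Sᶜ, ∑ w' ∈ Sᶜ, a w * a w' * EE p (fun e => (NN e h w S - rr p h w) * (NN e h w' S - rr p h w')) := by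
    simp only [sq, Finset.sum_mul_sum]
    rw [EE_sum]
    refine Finset.sum_congr rfl fun w _ => ?_
    rw [EE_sum]
    refine Finset.sum_congr rfl fun w' _ => ?_
    rw [← EE_mul]; congr 1; ext e; ring
  rw [e1]
  have hb : ∀ w ∈ Sᶜ, ∀ w' ∈ Sᶜ, EE p (fun e => (NN e h w S - rr p h w) * (NN e h w' S - rr p h w')) ≤
      3 * η' + if w = w' then 1 else 0 := by
    intro w hw w' hw'
    have r := rr01 hp h w
    have r' := rr01 hp h w'
    split_ifs with hww
    · subst hww
      refine (EE_mono hp (G := fun _ => 1) fun e => ?_).trans (by rw [EE_const]; linarith)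
      have := NN01 e h w S
      nlinarith
    · obtain ⟨l, u⟩ := h1 p hp S hS w (Finset.mem_compl.1 hw)
      have u := u w' (Finset.mem_compl.1 hw') hww
      have l' := (h1 p hp S hS w' (Finset.mem_compl.1 hw')).1
      have : EE p (fun e => (NN e h w S - rr p h w) * (NN e h w' S - rr p h w')) =
          EE p (fun e => NN e h w S * NN e h w' S) + ((-rr p h w) * EE p (fun e => NN e h w' S) +
          ((-rr p h w') * EE p (fun e => NN e h w S) + rr p h w * rr p h w')) := by
        rw [← EE_mul, ← EE_mul, ← EE_const p (rr p h w * rr p h w'), ← EE_add, ← EE_add, ← EE_add]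
        congr 1; ext e; ring
      rw [this]
      nlinarith [mul_le_mul_of_nonneg_left l' r.1, mul_le_mul_of_nonneg_left l r'.1]
  calc _ ≤ ∑ w ∈ Sᶜ, ∑ w' ∈ Sᶜ, (A/n) * (A/n) * (3 * η' + if w = w' then 1 else 0) := by
        refine Finset.sum_le_sum fun w hw => Finset.sum_le_sum fun w' hw' => ?_
        have c0 : 0 ≤ 3 * η' + if w = w' then (1:ℝ) else 0 := by split_ifs <;> positivity
        calc _ ≤ a w * a w' * (3 * η' + if w = w' then 1 else 0) :=
              mul_le_mul_of_nonneg_left (hb w hw w' hw') (mul_nonneg (ha w).1 (ha w').1)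
          _ ≤ _ := by
              refine mul_le_mul_of_nonneg_right ?_ c0
              exact mul_le_mul (ha w).2 (ha w').2 (ha w').1 (by positivity)
    _ ≤ ∑ w : Fin n, ∑ w' : Fin n, (A/n) * (A/n) * (3 * η' + if w = w' then 1 else 0) := by
        have c0 : ∀ w w' : Fin n, 0 ≤ (A/n) * (A/n) * (3 * η' + if w = w' then (1:ℝ) else 0) := fun w w' => by
          split_ifs <;> positivity
        refine (Finset.sum_le_sum fun w _ => Finset.sum_le_univ_sum_of_nonneg fun w' => c0 w w').trans ?_
        exact Finset.sum_le_univ_sum_of_nonneg fun w => Finset.sum_nonneg fun w' _ => c0 w w'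
    _ = A^2 * (3 * η') + A^2 / n := by
        simp only [← Finset.mul_sum, Finset.sum_add_distrib, Finset.sum_const, Finset.sum_ite_eq, Finset.mem_univ,
          if_true, Finset.card_univ, Fintype.card_fin, nsmul_eq_mul]
        field_simp
    _ ≤ η := by
        have : A^2 * (3 * η') = η / 2 := by rw [hη']; field_simp; norm_num
        linarith

theorem PR_succ {K : ℝ} (hK : 0 < K) {h : ℕ} (H : SM K h) : PR K (h+1) := by
  intro s η hη
  set θ := η / 8 with hθ
  have t0 : 0 < θ := by positivity
  have hl : Tendsto (fun n : ℕ => (K^2 + (s+2) * (2*K)) / (n:ℝ)) atTop (𝓝 0) := tendsto_const_div_atTop_nhds_zero_nat _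
  filter_upwards [H (s+2) (2*K) (by positivity) (θ^2) (by positivity),
    hl.eventually (gt_mem_nhds (show (0:ℝ) < η / 2 by positivity)), eventually_gt_atTop 0]
    with n h1 h2 h3 p hp S hS v hv
  have n0 : (0:ℝ) < n := by exact_mod_cast h3
  have hx0 : ∀ (e) (S' : Finset (Fin n)) w, 0 ≤ 1 - NN e h w S' := fun e S' w => by linarith [(NN01 e h w S').2]
  have hx1 : ∀ (e) (S' : Finset (Fin n)) w, 1 - NN e h w S' ≤ 1 := fun e S' w => by linarith [(NN01 e h w S').1]
  have hr0 : ∀ w, 0 ≤ 1 - rr p h w := fun w => by linarith [(rr01 hp h w).2]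
  have hr1 : ∀ w, 1 - rr p h w ≤ 1 := fun w => by linarith [(rr01 hp h w).1]
  have hZ : ∀ (S' : Finset (Fin n)), S'.card ≤ s + 2 → ∀ a : Fin n → ℝ, (∀ w, 0 ≤ a w ∧ a w ≤ 2*K/n) →
      |EE p (fun e => Real.exp (-∑ w ∈ S'ᶜ, a w * (1 - NN e h w S'))) -
        Real.exp (-∑ w ∈ S'ᶜ, a w * (1 - rr p h w))| ≤ 2 * θ := by
    intro S' hS' a ha
    refine EE_exp hp (fun e => Finset.sum_nonneg fun w _ => mul_nonneg (ha w).1 (hx0 e S' w))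
      (Finset.sum_nonneg fun w _ => mul_nonneg (ha w).1 (hr0 w)) t0 ?_
    refine le_trans (le_of_eq ?_) (h1 p hp S' hS' a ha)
    congr 1; ext e
    rw [← Finset.sum_sub_distrib, ← neg_sq, ← Finset.sum_neg_distrib]
    congr 1
    exact Finset.sum_congr rfl fun w _ => by ring
  have hfull : ∀ (S' : Finset (Fin n)) (a : Fin n → ℝ), (∀ w, 0 ≤ a w ∧ a w ≤ 2*K/n) → S'.card ≤ s + 2 →
      Real.exp (-∑ w, a w * (1 - rr p h w)) ≤ Real.exp (-∑ w ∈ S'ᶜ, a w * (1 - rr p h w)) ∧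
      Real.exp (-∑ w ∈ S'ᶜ, a w * (1 - rr p h w)) ≤ Real.exp (-∑ w, a w * (1 - rr p h w)) + (s+2) * (2*K) / n := by
    intro S' a ha hS'
    have e := Finset.sum_add_sum_compl S' (fun w => a w * (1 - rr p h w))
    have q0 : ∀ w, 0 ≤ a w * (1 - rr p h w) := fun w => mul_nonneg (ha w).1 (hr0 w)
    have s0 : 0 ≤ ∑ w ∈ S', a w * (1 - rr p h w) := Finset.sum_nonneg fun w _ => q0 w
    have s1 : ∑ w ∈ S', a w * (1 - rr p h w) ≤ (s+2) * (2*K) / n := by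
      calc _ ≤ ∑ w ∈ S', 2*K/n := Finset.sum_le_sum fun w _ => by
            have := (ha w).1; have := (ha w).2; have := hr1 w; have := hr0 w
            nlinarith
        _ = S'.card * (2*K/n) := by simp
        _ ≤ (s+2) * (2*K/n) := by
            have : (S'.card : ℝ) ≤ s + 2 := by exact_mod_cast hS'
            gcongr
        _ = _ := by ring
    refine ⟨Real.exp_le_exp.2 (by linarith), ?_⟩
    have := (abs_le.1 (exp_lip (a := ∑ w ∈ S'ᶜ, a w * (1 - rr p h w)) (b := ∑ w, a w * (1 - rr p h w))
      (Finset.sum_nonneg fun w _ => q0 w) (Finset.sum_nonneg fun w _ => q0 w))).2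
    rw [abs_of_nonpos (by linarith)] at this
    linarith
  have hsplit : (K^2 + (s+2) * (2*K)) / (n:ℝ) = K^2/n + (s+2) * (2*K) / n := by ring
  have k1 : 0 ≤ K^2 / (n:ℝ) := by positivity
  have k2 : 0 ≤ (s+2) * (2*K) / (n:ℝ) := by positivity
  have hKn : 0 ≤ K / (n:ℝ) := by positivity
  constructor
  · set S' := insert v S with hS'
    have hc : S'.card ≤ s + 2 := (Finset.card_insert_le _ _).trans (by omega)
    have ha : ∀ w, 0 ≤ p s(v, w) ∧ p s(v, w) ≤ 2*K/n := fun w => ⟨hp.nn _, (hp.le _).trans (by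
      rw [mul_div_assoc]; linarith)⟩
    have e1 := EE_prod p S'ᶜ (fun w => s(v, w)) (fun w e => 1 - NN e h w S')
      (fun w hw w' hw' hd => by
        rcases Sym2.eq_iff.1 hd with ⟨_, h⟩ | ⟨h, h'⟩
        · exact h
        · rw [h', ← h])
      (fun w hw w' hw' e b => by
        have := NNfree h w' S' (Finset.mem_compl.1 hw') v (Finset.mem_insert_self _ _) w e b
        beta_reduce at this ⊢; rw [this]) (fun _ => 1) (fun w hw e b => rfl)
    have e2 : EE p (fun e => NN e (h+1) v S) =
        EE p (fun e => ∏ w ∈ S'ᶜ, (1 - p s(v, w) * (1 - NN e h w S'))) := by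
      simp only [mul_one] at e1; exact e1
    rw [e2]
    have e3 : EE p (fun e => Real.exp (-∑ w ∈ S'ᶜ, p s(v, w) * (1 - NN e h w S')) + (-(K^2/n))) ≤
        EE p (fun e => ∏ w ∈ S'ᶜ, (1 - p s(v, w) * (1 - NN e h w S'))) := by
      refine EE_mono hp fun e => ?_
      have q0 : ∀ w, 0 ≤ p s(v, w) * (1 - NN e h w S') := fun w => mul_nonneg (hp.nn _) (hx0 e S' w)
      have := prod_lower S'ᶜ (fun w => p s(v, w) * (1 - NN e h w S')) q0
        (fun w => mul_le_one₀ (hp.le1 _) (hx0 e S' w) (hx1 e S' w))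
      have q : ∑ w ∈ S'ᶜ, (p s(v, w) * (1 - NN e h w S'))^2 ≤ K^2/n := by
        calc _ ≤ ∑ w ∈ S'ᶜ, (K/n)^2 := Finset.sum_le_sum fun w _ => by
              refine pow_le_pow_left₀ (q0 w) ?_ 2
              calc _ ≤ p s(v, w) * 1 := mul_le_mul_of_nonneg_left (hx1 e S' w) (hp.nn _)
                _ ≤ _ := by rw [mul_one]; exact hp.le _
          _ ≤ ∑ w : Fin n, (K/n)^2 := Finset.sum_le_univ_sum_of_nonneg fun w => sq_nonneg _
          _ = _ := by simp; field_simp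
      linarith
    rw [EE_add, EE_const] at e3
    have e4 := (abs_le.1 (hZ S' hc _ ha)).1
    have e5 := (hfull S' _ ha hc).1
    have e6 : rr p (h+1) v = Real.exp (-∑ w, p s(v, w) * (1 - rr p h w)) := rfl
    rw [e6]
    linarith
  · intro v' hv' hvv
    set S' := insert v (insert v' S) with hS'
    have hS2 : S' = insert v' (insert v S) := Finset.insert_comm _ _ _
    have hc : S'.card ≤ s + 2 := (Finset.card_insert_le _ _).trans (by
      have := Finset.card_insert_le v' S; omega)
    have mv : v ∈ S' := Finset.mem_insert_self _ _
    have mv' : v' ∈ S' := Finset.mem_insert_of_mem (Finset.mem_insert_self _ _)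
    have hfree : ∀ u ∈ S', ∀ w ∈ S'ᶜ, ∀ w', Free s(u, w') (fun e => 1 - NN e h w S') := by
      intro u hu w hw w' e b
      have := NNfree h w S' (Finset.mem_compl.1 hw) u hu w' e b
      beta_reduce at this ⊢; rw [this]
    have hinj : ∀ u : Fin n, ∀ w ∈ S'ᶜ, ∀ w' ∈ S'ᶜ, s(u, w) = s(u, w') → w = w' := by
      intro u w _ w' _ hd
      rcases Sym2.eq_iff.1 hd with ⟨_, h⟩ | ⟨h, h'⟩
      · exact h
      · rw [h', ← h]
    have e1 := EE_prod p S'ᶜ (fun w => s(v, w)) (fun w e => 1 - NN e h w S') (hinj v)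
      (fun w hw w' hw' => hfree v mv w' hw' w) (fun e => ∏ w ∈ S'ᶜ, (1 - ev e s(v', w) * (1 - NN e h w S')))
      (fun w hw e b => Finset.prod_congr rfl fun w' hw' => by
        have := hfree v mv w' hw' w e b
        beta_reduce at this ⊢
        rw [this, ev_upd]
        intro hd
        rcases Sym2.eq_iff.1 hd with ⟨h1, _⟩ | ⟨_, h1⟩
        · exact hvv h1.symm
        · exact (Finset.mem_compl.1 hw') (h1 ▸ mv))
    have e2 := EE_prod p S'ᶜ (fun w => s(v', w)) (fun w e => 1 - NN e h w S') (hinj v')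
      (fun w hw w' hw' => hfree v' mv' w' hw' w) (fun e => ∏ w ∈ S'ᶜ, (1 - p s(v, w) * (1 - NN e h w S')))
      (fun w hw e b => Finset.prod_congr rfl fun w' hw' => by
        have := hfree v' mv' w' hw' w e b
        beta_reduce at this ⊢
        rw [this])
    set a : Fin n → ℝ := fun w => p s(v', w) + p s(v, w) with haa
    have ha : ∀ w, 0 ≤ a w ∧ a w ≤ 2*K/n := fun w => ⟨add_nonneg (hp.nn _) (hp.nn _), by
      have := hp.le s(v', w); have := hp.le s(v, w)
      rw [mul_div_assoc]; simp only [haa]; linarith⟩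
    have e3 : EE p (fun e => NN e (h+1) v S * NN e (h+1) v' S) ≤
        EE p (fun e => (∏ w ∈ S'ᶜ, (1 - ev e s(v, w) * (1 - NN e h w S'))) *
          ∏ w ∈ S'ᶜ, (1 - ev e s(v', w) * (1 - NN e h w S'))) := by
      refine EE_mono hp fun e => ?_
      have q1 := NNmono e (h+1) v (Finset.subset_insert v' S)
      have q2 := NNmono e (h+1) v' (Finset.subset_insert v S)
      have q3 : NN e (h+1) v' (insert v S) = ∏ w ∈ S'ᶜ, (1 - ev e s(v', w) * (1 - NN e h w S')) := by
        rw [hS2]; rfl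
      rw [← q3]
      exact mul_le_mul q1 q2 (NN01 _ _ _ _).1 (NN01 e (h+1) v (insert v' S)).1
    have e4 : EE p (fun e => (∏ w ∈ S'ᶜ, (1 - p s(v', w) * (1 - NN e h w S'))) *
          ∏ w ∈ S'ᶜ, (1 - p s(v, w) * (1 - NN e h w S'))) ≤
        EE p (fun e => Real.exp (-∑ w ∈ S'ᶜ, a w * (1 - NN e h w S'))) := by
      refine EE_mono hp fun e => ?_
      have q : ∀ u, ∀ w, p s(u, w) * (1 - NN e h w S') ≤ 1 := fun u w => mul_le_one₀ (hp.le1 _) (hx0 e S' w) (hx1 e S' w)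
      have q1 := prod_upper S'ᶜ (fun w => p s(v', w) * (1 - NN e h w S')) (q v')
      have q2 := prod_upper S'ᶜ (fun w => p s(v, w) * (1 - NN e h w S')) (q v)
      have q3 : Real.exp (-∑ w ∈ S'ᶜ, a w * (1 - NN e h w S')) = Real.exp (-∑ w ∈ S'ᶜ, p s(v', w) * (1 - NN e h w S')) *
          Real.exp (-∑ w ∈ S'ᶜ, p s(v, w) * (1 - NN e h w S')) := by
        rw [← Real.exp_add, ← neg_add, ← Finset.sum_add_distrib]
        congr 2; exact Finset.sum_congr rfl fun w _ => by simp only [haa]; ring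
      rw [q3]
      exact mul_le_mul q1 q2 (Finset.prod_nonneg fun w _ => by linarith [q v w]) (Real.exp_pos _).le
    have e5 := (abs_le.1 (hZ S' hc a ha)).2
    have e6 := (hfull S' a ha hc).2
    have e7 : rr p (h+1) v * rr p (h+1) v' = Real.exp (-∑ w, a w * (1 - rr p h w)) := by
      simp only [rr]
      rw [← Real.exp_add, ← neg_add, ← Finset.sum_add_distrib]
      congr 2; exact Finset.sum_congr rfl fun w _ => by simp only [haa]; ring
    rw [e7]
    rw [e1] at e3
    have e8 : EE p (fun e => (∏ w ∈ S'ᶜ, (1 - p s(v, w) * (1 - NN e h w S'))) *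
          ∏ w ∈ S'ᶜ, (1 - ev e s(v', w) * (1 - NN e h w S'))) = _ :=
      (congrArg (EE p) (funext fun e => mul_comm _ _)).trans e2
    rw [e8] at e3
    linarith

theorem SM_all {K : ℝ} (hK : 0 < K) (h : ℕ) : SM K h := by
  induction h with
  | zero => exact SM_zero K
  | succ h ih => exact SM_of_PR (PR_succ hK ih)

end Percolation
end

open MeasureTheory Filter Topology ProbabilityTheory
noncomputable section
namespace Percolation
set_option linter.unusedSectionVars false

section
variable {V : Type*} [Fintype V] [DecidableEq V]

theorem gadj (e : Sym2 V → Bool) (i j : V) : (graphOf e).Adj i j ↔ i ≠ j ∧ e s(i, j) = true := by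
  unfold graphOf
  rw [SimpleGraph.fromRel_adj, Sym2.eq_swap (a := j)]
  simp

theorem NN_zero (e : Sym2 V → Bool) (h : ℕ) : ∀ v S, v ∉ S → NN e h v S = 0 →
    ∃ T : Finset V, T.card = h + 1 ∧ Disjoint T S ∧ ∀ w ∈ T, (graphOf e).Reachable v w := by
  induction h with
  | zero =>
    intro v S hv _
    exact ⟨{v}, by simp, by simpa using hv, by simp⟩
  | succ h ih =>
    intro v S hv hz
    obtain ⟨w, hw, h0⟩ := Finset.prod_eq_zero_iff.1 hz
    have hw' : w ∉ insert v S := Finset.mem_compl.1 hw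
    have h1 : e s(v, w) = true ∧ NN e h w (insert v S) = 0 := by
      unfold ev at h0
      rcases NNdi e h w (insert v S) with h1 | h1 <;> rw [h1] at h0 <;> split_ifs at h0 with h2 <;> simp_all
    obtain ⟨T, hc, hd, hr⟩ := ih w _ hw' h1.2
    have hvT : v ∉ T := fun hm => Finset.disjoint_left.1 hd hm (Finset.mem_insert_self _ _)
    refine ⟨insert v T, by rw [Finset.card_insert_of_notMem hvT, hc], ?_, ?_⟩
    · rw [Finset.disjoint_insert_left]
      exact ⟨hv, hd.mono_right (Finset.subset_insert _ _)⟩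
    · have ha : (graphOf e).Adj v w := (gadj e v w).2 ⟨fun h => hw' (h ▸ Finset.mem_insert_self _ _), h1.1⟩
      intro x hx
      rcases Finset.mem_insert.1 hx with rfl | hx
      · exact SimpleGraph.Reachable.refl _
      · exact ha.reachable.trans (hr x hx)

theorem NN_one (e : Sym2 V → Bool) (h : ℕ) : ∀ v S, v ∉ S → NN e h v S ≠ 0 →
    ∃ U : Finset V, v ∈ U ∧ (∀ a ∈ U, ∀ b, b ∉ S → (graphOf e).Adj a b → b ∈ U) ∧ (U.card : ℝ) ≤ BB e h v S := by
  induction h with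
  | zero => intro v S hv hz; exact absurd rfl hz
  | succ h ih =>
    intro v S hv hz
    have hf : ∀ w ∈ (insert v S)ᶜ, e s(v, w) = true → NN e h w (insert v S) ≠ 0 := by
      intro w hw hew h0
      apply hz
      refine Finset.prod_eq_zero hw ?_
      rw [h0]; simp [ev, hew]
    have hU : ∀ w, ∃ U : Finset V, w ∈ (insert v S)ᶜ → e s(v, w) = true → w ∈ U ∧
        (∀ a ∈ U, ∀ b, b ∉ insert v S → (graphOf e).Adj a b → b ∈ U) ∧ (U.card : ℝ) ≤ BB e h w (insert v S) := by
      intro w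
      by_cases hw : w ∈ (insert v S)ᶜ ∧ e s(v, w) = true
      · obtain ⟨U, h1⟩ := ih w _ (Finset.mem_compl.1 hw.1) (hf w hw.1 hw.2)
        exact ⟨U, fun _ _ => h1⟩
      · exact ⟨∅, fun h1 h2 => absurd ⟨h1, h2⟩ hw⟩
    choose U hU using hU
    set N := (insert v S)ᶜ.filter fun w => e s(v, w) = true with hN
    have hN' : ∀ w, w ∈ N ↔ w ∈ (insert v S)ᶜ ∧ e s(v, w) = true := fun w => Finset.mem_filter
    refine ⟨insert v (N.biUnion U), Finset.mem_insert_self _ _, ?_, ?_⟩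
    · intro a ha b hb hab
      by_cases hbv : b = v
      · rw [hbv]; exact Finset.mem_insert_self _ _
      have hbS : b ∉ insert v S := fun h => (Finset.mem_insert.1 h).elim hbv hb
      refine Finset.mem_insert_of_mem (Finset.mem_biUnion.2 ?_)
      rcases Finset.mem_insert.1 ha with rfl | ha
      · have h1 : b ∈ N := (hN' b).2 ⟨Finset.mem_compl.2 hbS, ((gadj e _ b).1 hab).2⟩
        exact ⟨b, h1, (hU b ((hN' b).1 h1).1 ((hN' b).1 h1).2).1⟩
      · obtain ⟨w, hw, haw⟩ := Finset.mem_biUnion.1 ha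
        exact ⟨w, hw, (hU w ((hN' w).1 hw).1 ((hN' w).1 hw).2).2.1 a haw b hbS hab⟩
    · have h1 : ((insert v (N.biUnion U)).card : ℝ) ≤ 1 + ∑ w ∈ N, ((U w).card : ℝ) := by
        have := (Finset.card_insert_le v (N.biUnion U)).trans
          (Nat.add_le_add_right (Finset.card_biUnion_le (s := N) (t := U)) 1)
        have h2 : ((insert v (N.biUnion U)).card : ℝ) ≤ ((∑ w ∈ N, (U w).card + 1 : ℕ) : ℝ) := by exact_mod_cast this
        push_cast at h2; linarith
      refine h1.trans ?_
      simp only [BB]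
      rw [hN, Finset.sum_filter]
      gcongr with w hw
      unfold ev
      split_ifs with h2
      · rw [one_mul]; exact (hU w hw h2).2.2
      · simp

theorem closed_reach {G : SimpleGraph V} {U : Set V} (hU : ∀ a ∈ U, ∀ b, G.Adj a b → b ∈ U) {v w : V} (hv : v ∈ U)
    (h : G.Reachable v w) : w ∈ U := by
  obtain ⟨q⟩ := h
  induction q with
  | nil => exact hv
  | cons ha _ ih => exact ih (hU _ hv _ ha)

theorem comp_ge {G : SimpleGraph V} {v : V} {T : Finset V} (h : ∀ w ∈ T, G.Reachable v w) : T.card ≤ compSize G v := by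
  unfold compSize
  rw [← Set.ncard_coe_finset]
  exact Set.ncard_le_ncard (fun w hw => h w hw) (Set.toFinite _)

theorem comp_le {G : SimpleGraph V} {v : V} {U : Finset V} (hv : v ∈ U) (hU : ∀ a ∈ U, ∀ b, G.Adj a b → b ∈ U) :
    compSize G v ≤ U.card := by
  unfold compSize
  rw [← Set.ncard_coe_finset]
  exact Set.ncard_le_ncard (fun w hw => closed_reach (U := (U : Set V)) hU hv hw) (Set.toFinite _)

theorem NN_comp_ge {e : Sym2 V → Bool} {h : ℕ} {v : V} (hN : NN e h v ∅ = 0) : h + 1 ≤ compSize (graphOf e) v := by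
  obtain ⟨T, hc, _, hr⟩ := NN_zero e h v ∅ (by simp) hN
  rw [← hc]; exact comp_ge hr

theorem NN_comp_le {e : Sym2 V → Bool} {h : ℕ} {v : V} (hN : NN e h v ∅ ≠ 0) :
    (compSize (graphOf e) v : ℝ) ≤ BB e h v ∅ := by
  obtain ⟨U, hv, hU, hc⟩ := NN_one e h v ∅ (by simp) hN
  refine le_trans ?_ hc
  exact_mod_cast comp_le hv fun a ha b hab => hU a ha b (by simp) hab

def PL (V : Type*) [Fintype V] : Measure (Sym2 V → ℝ) := Measure.pi fun _ => lam

instance PL_prob : IsProbabilityMeasure (PL V) := by unfold PL; infer_instance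

def cfg (p u : Sym2 V → ℝ) : Sym2 V → Bool := fun f => decide (u f < p f)

theorem lam_Iio {a : ℝ} (h0 : 0 ≤ a) (h1 : a ≤ 1) : lam.real (Set.Iio a) = a := by
  have e : Set.Iio a ∩ I01 = Set.Ico 0 a := by
    ext x; simp only [I01, Set.mem_inter_iff, Set.mem_Iio, Set.mem_Icc, Set.mem_Ico]
    constructor
    · rintro ⟨h, h2, _⟩; exact ⟨h2, h⟩
    · rintro ⟨h, h2⟩; exact ⟨h2, h, by linarith⟩
  rw [lam, measureReal_restrict_apply measurableSet_Iio, e]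
  simp [measureReal_def, h0]

theorem lam_Ici {a : ℝ} (h0 : 0 ≤ a) (h1 : a ≤ 1) : lam.real (Set.Ici a) = 1 - a := by
  rw [← Set.compl_Iio, probReal_compl_eq_one_sub measurableSet_Iio, lam_Iio h0 h1]

theorem PL_box (S : Sym2 V → Set ℝ) : (PL V).real (Set.univ.pi S) = ∏ f, lam.real (S f) := by
  simp only [measureReal_def]; unfold PL
  rw [Measure.pi_pi, ENNReal.toReal_prod]

theorem PL_wt {p : Sym2 V → ℝ} {B : ℝ} (hp : PP p B) (g : Sym2 V → Bool) : (PL V).real {u | cfg p u = g} = wt p g := by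
  have e : {u : Sym2 V → ℝ | cfg p u = g} = Set.univ.pi fun f => if g f then Set.Iio (p f) else Set.Ici (p f) := by
    ext u
    change cfg p u = g ↔ _
    rw [funext_iff, Set.mem_univ_pi]
    refine forall_congr' fun f => ?_
    unfold cfg
    cases g f <;> simp
  rw [e, PL_box]
  refine Finset.prod_congr rfl fun f _ => ?_
  split_ifs
  · exact lam_Iio (hp.nn f) (hp.le1 f)
  · exact lam_Ici (hp.nn f) (hp.le1 f)

theorem cfg_meas (p : Sym2 V → ℝ) (g : Sym2 V → Bool) : MeasurableSet {u : Sym2 V → ℝ | cfg p u = g} := by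
  have e : {u : Sym2 V → ℝ | cfg p u = g} = Set.univ.pi fun f => if g f then Set.Iio (p f) else Set.Ici (p f) := by
    ext u
    change cfg p u = g ↔ _
    rw [funext_iff, Set.mem_univ_pi]
    refine forall_congr' fun f => ?_
    unfold cfg
    cases g f <;> simp
  rw [e]
  refine MeasurableSet.univ_pi fun f => ?_
  split_ifs
  · exact measurableSet_Iio
  · exact measurableSet_Ici

open Classical in
theorem PL_le {p : Sym2 V → ℝ} {B : ℝ} (hp : PP p B) (Q : (Sym2 V → Bool) → Prop) :
    (PL V).real {u | Q (cfg p u)} ≤ EE p (fun e => if Q e then 1 else 0) := by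
  have hs : {u : Sym2 V → ℝ | Q (cfg p u)} ⊆ ⋃ g ∈ (Finset.univ.filter Q), {u | cfg p u = g} := by
    intro u hu
    simp only [Set.mem_iUnion]
    exact ⟨cfg p u, Finset.mem_filter.2 ⟨Finset.mem_univ _, hu⟩, rfl⟩
  refine (measureReal_mono hs (measure_ne_top _ _)).trans ((measureReal_biUnion_finset_le _ _).trans (le_of_eq ?_))
  unfold EE
  rw [Finset.sum_filter]
  refine Finset.sum_congr rfl fun g _ => ?_
  by_cases hQ : Q g <;> simp [hQ, PL_wt hp]

theorem PL_markov {p : Sym2 V → ℝ} {B : ℝ} (hp : PP p B) {F : (Sym2 V → Bool) → ℝ} (F0 : ∀ e, 0 ≤ F e) {a : ℝ}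
    (ha : 0 < a) : (PL V).real {u | a ≤ F (cfg p u)} ≤ EE p F / a := by
  classical
  refine (PL_le hp (fun e => a ≤ F e)).trans ?_
  rw [le_div_iff₀ ha, mul_comm, ← EE_mul]
  refine EE_mono hp fun e => ?_
  split_ifs with h
  · simpa using h
  · simpa using F0 e

theorem PL_cut {p : Sym2 V → ℝ} {B t : ℝ} (hp : PP p B) (t0 : 0 ≤ t) (t1 : t ≤ 1) (g : Sym2 V → Bool) (C : Finset (Sym2 V)) :
    (PL V).real {u | cfg (fun f => t * p f) u = g ∧ ∀ f ∈ C, cfg p u f = false} ≤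
      wt (fun f => t * p f) g * Real.exp (-((1 - t) * ∑ f ∈ C, p f)) := by
  have hs : {u : Sym2 V → ℝ | cfg (fun f => t * p f) u = g ∧ ∀ f ∈ C, cfg p u f = false} ⊆
      Set.univ.pi fun f => if f ∈ C then (if g f then ∅ else Set.Ici (p f)) else
        (if g f then Set.Iio (t * p f) else Set.Ici (t * p f)) := by
    rintro u ⟨h1, h2⟩
    rw [Set.mem_univ_pi]
    intro f
    have e1 := congrFun h1 f
    have tp : t * p f ≤ p f := by nlinarith [hp.nn f]
    unfold cfg at e1 h2
    split_ifs with hC hg hg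
    · have := h2 f hC
      rw [hg] at e1
      simp at e1 this
      linarith
    · have := h2 f hC
      simpa using this
    · rw [hg] at e1; simpa using e1
    · simp only [Bool.not_eq_true] at hg
      rw [hg] at e1; simpa using e1
  refine (measureReal_mono hs).trans ?_
  rw [PL_box]
  have e2 : Real.exp (-((1 - t) * ∑ f ∈ C, p f)) = ∏ f, if f ∈ C then Real.exp (-((1 - t) * p f)) else 1 := by
    rw [Finset.mul_sum, ← Finset.sum_neg_distrib, Real.exp_sum, Finset.prod_ite_mem, Finset.univ_inter]
  rw [e2]
  unfold wt
  rw [← Finset.prod_mul_distrib]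
  refine Finset.prod_le_prod (fun f _ => measureReal_nonneg) fun f _ => ?_
  have p0 := hp.nn f
  have p1 := hp.le1 f
  have q0 : 0 ≤ t * p f := mul_nonneg t0 p0
  have q1 : t * p f ≤ 1 := by nlinarith
  split_ifs with hC hg hg
  · simp only [measureReal_empty]; positivity
  · rw [lam_Ici p0 p1]
    have := Real.add_one_le_exp (-((1 - t) * p f))
    calc 1 - p f ≤ (1 - t * p f) * (-((1-t) * p f) + 1) := by nlinarith [mul_nonneg q0 (mul_nonneg (sub_nonneg.2 t1) p0)]
      _ ≤ _ := mul_le_mul_of_nonneg_left this (by linarith)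
  · rw [lam_Iio q0 q1, mul_one]
  · rw [lam_Ici q0 q1, mul_one]

theorem PL_spr {p : Sym2 V → ℝ} {B t : ℝ} (hp : PP p B) (t0 : 0 ≤ t) (t1 : t ≤ 1)
    (C : (Sym2 V → Bool) → Finset V → Finset (Sym2 V)) (𝒜 : (Sym2 V → Bool) → Finset (Finset V)) {N b : ℝ}
    (hN : ∀ g, ((𝒜 g).card : ℝ) ≤ N) (hC : ∀ g, ∀ A ∈ 𝒜 g, b ≤ ∑ f ∈ C g A, p f) :
    (PL V).real {u | ∃ A ∈ 𝒜 (cfg (fun f => t * p f) u), ∀ f ∈ C (cfg (fun f => t * p f) u) A, cfg p u f = false} ≤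
      N * Real.exp (-((1 - t) * b)) := by
  have hp' : PP (fun f => t * p f) 1 := ⟨fun f => mul_nonneg t0 (hp.nn f),
    fun f => mul_le_one₀ t1 (hp.nn f) (hp.le1 f), fun f => mul_le_one₀ t1 (hp.nn f) (hp.le1 f)⟩
  have hs : {u : Sym2 V → ℝ | ∃ A ∈ 𝒜 (cfg (fun f => t * p f) u), ∀ f ∈ C (cfg (fun f => t * p f) u) A, cfg p u f = false} ⊆
      ⋃ g ∈ (Finset.univ : Finset (Sym2 V → Bool)), ⋃ A ∈ 𝒜 g,
        {u | cfg (fun f => t * p f) u = g ∧ ∀ f ∈ C g A, cfg p u f = false} := by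
    rintro u ⟨A, hA, h⟩
    simp only [Set.mem_iUnion]
    exact ⟨_, Finset.mem_univ _, A, hA, rfl, h⟩
  refine (measureReal_mono hs (measure_ne_top _ _)).trans ((measureReal_biUnion_finset_le _ _).trans ?_)
  calc _ ≤ ∑ g : Sym2 V → Bool, wt (fun f => t * p f) g * (N * Real.exp (-((1 - t) * b))) := by
        refine Finset.sum_le_sum fun g _ => (measureReal_biUnion_finset_le _ _).trans ?_
        have w0 := wt_nn hp' g
        calc _ ≤ ∑ A ∈ 𝒜 g, wt (fun f => t * p f) g * Real.exp (-((1 - t) * b)) := by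
              refine Finset.sum_le_sum fun A hA => (PL_cut hp t0 t1 g (C g A)).trans ?_
              have := hC g A hA
              have : 0 ≤ 1 - t := by linarith
              gcongr
          _ = (𝒜 g).card * (wt (fun f => t * p f) g * Real.exp (-((1 - t) * b))) := by simp
          _ ≤ N * (wt (fun f => t * p f) g * Real.exp (-((1 - t) * b))) := by
              have := hN g
              gcongr
          _ = _ := by ring
    _ = _ := by rw [← Finset.sum_mul, wt_sum, one_mul]

end
end Percolation
end

open MeasureTheory Filter Topology ProbabilityTheory
noncomputable section
namespace Percolation
set_option linter.unusedSectionVars false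

section
variable {V : Type*} [Fintype V] [DecidableEq V]

def Cl (G : SimpleGraph V) (A : Finset V) : Prop := ∀ a ∈ A, ∀ b, G.Adj a b → b ∈ A

theorem Cl.reach {G : SimpleGraph V} {A : Finset V} (h : Cl G A) {v w : V} (hr : G.Reachable v w) : v ∈ A ↔ w ∈ A :=
  ⟨fun hv => closed_reach (U := (A : Set V)) h hv hr, fun hv => closed_reach (U := (A : Set V)) h hv hr.symm⟩

def Lh (g : Sym2 V → Bool) (h : ℕ) : Finset V := Finset.univ.filter fun v => h + 1 ≤ compSize (graphOf g) v

theorem mem_Lh {g : Sym2 V → Bool} {h : ℕ} {v : V} : v ∈ Lh g h ↔ h + 1 ≤ compSize (graphOf g) v := by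
  simp [Lh]

def rep (G : SimpleGraph V) (v : V) : V := (G.connectedComponentMk v).out

theorem rep_reach (G : SimpleGraph V) (v : V) : G.Reachable v (rep G v) :=
  (SimpleGraph.ConnectedComponent.exact (Quot.out_eq (G.connectedComponentMk v))).symm

theorem rep_eq {G : SimpleGraph V} {v w : V} : rep G v = rep G w ↔ G.Reachable v w := by
  constructor
  · intro h
    have := rep_reach G w
    rw [← h] at this
    exact (rep_reach G v).trans this.symm
  · intro h
    unfold rep
    rw [SimpleGraph.ConnectedComponent.sound h]

theorem compSize_eq (G : SimpleGraph V) (v : V) : compSize G v = (Finset.univ.filter fun w => rep G w = rep G v).card := by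
  unfold compSize
  rw [← Set.ncard_coe_finset]
  congr 1
  ext w
  simp only [Finset.coe_filter, Finset.mem_univ, true_and]
  change G.Reachable v w ↔ rep G w = rep G v
  rw [rep_eq]; exact ⟨fun h => h.symm, fun h => h.symm⟩

theorem rep_card (g : Sym2 V → Bool) (h : ℕ) : ((Lh g h).image (rep (graphOf g))).card * (h + 1) ≤ Fintype.card V := by
  set G := graphOf g
  set R := (Lh g h).image (rep G)
  calc R.card * (h + 1) = ∑ r ∈ R, (h + 1) := by simp
    _ ≤ ∑ r ∈ R, (Finset.univ.filter fun w => rep G w = r).card := by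
        refine Finset.sum_le_sum fun r hr => ?_
        obtain ⟨v, hv, rfl⟩ := Finset.mem_image.1 hr
        rw [← compSize_eq]; exact mem_Lh.1 hv
    _ = (R.biUnion fun r => Finset.univ.filter fun w => rep G w = r).card := by
        rw [Finset.card_biUnion]
        intro a _ b _ hab
        refine Finset.disjoint_left.2 ?_
        intro w h1 h2
        exact hab ((Finset.mem_filter.1 h1).2.symm.trans (Finset.mem_filter.1 h2).2)
    _ ≤ _ := Finset.card_le_univ _

theorem spr_count {p : Sym2 V → ℝ} {B t : ℝ} (hp : PP p B) (t0 : 0 ≤ t) (t1 : t ≤ 1) (h : ℕ) (b : ℝ) :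
    (PL V).real {u | ∃ A : Finset V, Cl (graphOf (cfg p u)) A ∧
      b ≤ ∑ i ∈ A ∩ Lh (cfg (fun f => t * p f) u) h, ∑ j ∈ Lh (cfg (fun f => t * p f) u) h \ A, p s(i, j)} ≤
      Real.exp (Fintype.card V / (h + 1)) * Real.exp (-((1 - t) * b)) := by
  classical
  let C : (Sym2 V → Bool) → Finset V → Finset (Sym2 V) := fun g A => (A ×ˢ (Lh g h \ A)).image fun q => s(q.1, q.2)
  let 𝒜 : (Sym2 V → Bool) → Finset (Finset V) := fun g => ((((Lh g h).image (rep (graphOf g))).powerset).image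
    fun B => (Lh g h).filter fun v => rep (graphOf g) v ∈ B).filter fun A => b ≤ ∑ f ∈ C g A, p f
  refine le_trans (measureReal_mono ?_ (measure_ne_top _ _)) (PL_spr hp t0 t1 C 𝒜 (N := Real.exp (Fintype.card V / (h + 1))) (b := b) ?_ ?_)
  · rintro u ⟨A', hA', hb⟩
    set g := cfg (fun f => t * p f) u with hg
    have hsub : Cl (graphOf g) A' := by
      intro a ha b hab
      refine hA' a ha b ?_
      rw [gadj] at hab ⊢
      refine ⟨hab.1, ?_⟩
      have := hab.2
      simp only [hg, cfg, decide_eq_true_eq] at this ⊢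
      have := mul_le_of_le_one_left (hp.nn s(a, b)) t1
      linarith
    have hdiff : Lh g h \ (A' ∩ Lh g h) = Lh g h \ A' := by
      ext x; simp only [Finset.mem_sdiff, Finset.mem_inter]; tauto
    refine ⟨A' ∩ Lh g h, ?_, ?_⟩
    · refine Finset.mem_filter.2 ⟨Finset.mem_image.2 ⟨((Lh g h).image (rep (graphOf g))).filter (· ∈ A'),
        Finset.mem_powerset.2 (Finset.filter_subset _ _), ?_⟩, ?_⟩
      · ext v
        simp only [Finset.mem_filter, Finset.mem_inter, Finset.mem_image]
        have := hsub.reach (rep_reach (graphOf g) v)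
        constructor
        · rintro ⟨h1, _, h2⟩; exact ⟨this.2 h2, h1⟩
        · rintro ⟨h1, h2⟩; exact ⟨h2, ⟨v, h2, rfl⟩, this.1 h1⟩
      · have : ∑ f ∈ C g (A' ∩ Lh g h), p f = ∑ q ∈ (A' ∩ Lh g h) ×ˢ (Lh g h \ (A' ∩ Lh g h)), p s(q.1, q.2) := by
          refine Finset.sum_image ?_
          rintro ⟨a, b⟩ h1 ⟨a', b'⟩ h2 he
          have h1' := Finset.mem_product.1 (Finset.mem_coe.1 h1)
          have h2' := Finset.mem_product.1 (Finset.mem_coe.1 h2)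
          simp only [Sym2.eq_iff] at he
          rcases he with ⟨rfl, rfl⟩ | ⟨rfl, rfl⟩
          · rfl
          · exact absurd h1'.1 (Finset.mem_sdiff.1 h2'.2).2
        rw [this, Finset.sum_product, hdiff]
        exact hb
    · intro f hf
      obtain ⟨⟨a, b⟩, hq, rfl⟩ := Finset.mem_image.1 hf
      have hq' := Finset.mem_product.1 hq
      have ha := Finset.mem_inter.1 hq'.1
      have hb' := hq'.2
      rw [hdiff] at hb'
      have hb'' := Finset.mem_sdiff.1 hb'
      by_contra hne
      have := hA' a ha.1 b ((gadj _ _ _).2 ⟨fun h => hb''.2 (h ▸ ha.1), by simpa using hne⟩)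
      exact hb''.2 this
  · intro g
    have h1 : (𝒜 g).card ≤ 2 ^ ((Lh g h).image (rep (graphOf g))).card :=
      (Finset.card_filter_le _ _).trans (Finset.card_image_le.trans (by rw [Finset.card_powerset]))
    have h2 := rep_card g h
    set r := ((Lh g h).image (rep (graphOf g))).card
    calc ((𝒜 g).card : ℝ) ≤ 2 ^ r := by exact_mod_cast h1
      _ ≤ (Real.exp 1) ^ r := by
          gcongr
          have := Real.add_one_le_exp (1:ℝ); linarith
      _ = Real.exp r := by rw [← Real.exp_nat_mul, mul_one]
      _ ≤ _ := by
          apply Real.exp_le_exp.2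
          rw [le_div_iff₀ (by positivity)]
          exact_mod_cast h2
  · intro g A hA
    exact (Finset.mem_filter.1 hA).2

theorem big_comp {G : SimpleGraph V} {L : Finset V} {d : ℝ} (hL : 3 * d < L.card) (d0 : 0 < d)
    (H : ∀ A, Cl G A → ((A ∩ L).card : ℝ) < d ∨ ((L \ A).card : ℝ) < d) : ∃ v, (L.card : ℝ) - d ≤ compSize G v := by
  classical
  obtain ⟨A, ⟨hA, hd⟩, hmin⟩ := (WellFounded.has_min (measure (fun A : Finset V => A.card)).wf
    {A | Cl G A ∧ d ≤ ((A ∩ L).card : ℝ)} ⟨Finset.univ, fun _ _ _ _ => Finset.mem_univ _, by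
      rw [Finset.univ_inter]; linarith⟩)
  have hmin' : ∀ A', Cl G A' → d ≤ ((A' ∩ L).card : ℝ) → A.card ≤ A'.card := fun A' h1 h2 => not_lt.1 (hmin A' ⟨h1, h2⟩)
  have hLA : ((L \ A).card : ℝ) < d := (H A hA).resolve_left (not_lt.2 hd)
  have hne : (A ∩ L).Nonempty := by
    rw [← Finset.card_pos]
    have : (0:ℝ) < ((A ∩ L).card : ℝ) := by linarith
    exact_mod_cast this
  obtain ⟨v, hv⟩ := hne
  have hvA := (Finset.mem_inter.1 hv).1
  set C := Finset.univ.filter fun w => rep G w = rep G v with hC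
  have hCm : ∀ w, w ∈ C ↔ G.Reachable w v := fun w => by simp [hC, rep_eq]
  have hCcl : Cl G C := fun a ha b hab => (hCm b).2 (hab.symm.reachable.trans ((hCm a).1 ha))
  have hCA : C ⊆ A := fun w hw => (hA.reach ((hCm w).1 hw)).2 hvA
  have hvC : v ∈ C := (hCm v).2 (SimpleGraph.Reachable.refl _)
  have hcard : (L.card : ℝ) = ((A ∩ L).card : ℝ) + ((L \ A).card : ℝ) := by
    have := Finset.card_inter_add_card_sdiff L A
    rw [Finset.inter_comm] at this
    exact_mod_cast this.symm
  refine ⟨v, ?_⟩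
  rw [compSize_eq, ← hC]
  by_cases hCd : d ≤ ((C ∩ L).card : ℝ)
  · have : C = A := Finset.eq_of_subset_of_card_le hCA (hmin' C hCcl hCd)
    rw [this]
    have : ((A ∩ L).card : ℝ) ≤ A.card := by exact_mod_cast Finset.card_le_card Finset.inter_subset_left
    linarith
  · exfalso
    have hcl : Cl G (A \ C) := by
      intro a ha b hab
      have := Finset.mem_sdiff.1 ha
      refine Finset.mem_sdiff.2 ⟨hA a this.1 b hab, fun hb => this.2 (hCcl b hb a hab.symm)⟩
    have hlt : (((A \ C) ∩ L).card : ℝ) < d := by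
      by_contra hge
      have h1 := hmin' _ hcl (not_lt.1 hge)
      have h2 : (A \ C).card < A.card := Finset.card_lt_card (Finset.ssubset_iff_subset_ne.2 ⟨Finset.sdiff_subset, fun h => by
        rw [← h] at hvA; exact (Finset.mem_sdiff.1 hvA).2 hvC⟩)
      omega
    have : ((A ∩ L).card : ℝ) ≤ ((C ∩ L).card : ℝ) + (((A \ C) ∩ L).card : ℝ) := by
      have : A ∩ L ⊆ (C ∩ L) ∪ ((A \ C) ∩ L) := by
        intro x; simp only [Finset.mem_inter, Finset.mem_union, Finset.mem_sdiff]; tauto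
      exact_mod_cast (Finset.card_le_card this).trans (Finset.card_union_le _ _)
    push Not at hCd
    linarith

theorem EE_col {f g : Sym2 V} (h : f ≠ g) : EE (fun _ => (1/2:ℝ)) (fun e => ev e f * (1 - ev e g)) = 1/4 := by
  have h1 : Free f (fun e : Sym2 V → Bool => 1 - ev e g) := fun e b => by
    change 1 - ev _ g = 1 - ev e g
    rw [ev_upd h.symm]
  rw [EE_edge _ h1]
  have h2 : (fun e : Sym2 V → Bool => 1 - ev e g) = fun e => 1 + (-1) * (ev e g * 1) := by funext e; ring
  have h3 : Free g (fun _ : Sym2 V → Bool => (1:ℝ)) := fun e b => rfl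
  rw [h2, EE_add, EE_mul, EE_edge _ h3, EE_const]
  norm_num

theorem cut_avg {G : SimpleGraph V} {L : Finset V} (w : V → V → ℝ) (w0 : ∀ i j, 0 ≤ w i j) {b : ℝ}
    (H : ∀ A, Cl G A → ∑ i ∈ A ∩ L, ∑ j ∈ L \ A, w i j ≤ b) :
    ∑ i ∈ L, ∑ j ∈ L, w i j ≤ 4 * b + ∑ i, ∑ j with rep G j = rep G i, w i j := by
  classical
  let c : V → Sym2 V := fun v => s(rep G v, rep G v)
  have hc : ∀ i j, c i = c j ↔ rep G i = rep G j := fun i j => by simp [c]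
  have h1 : ∀ e : Sym2 V → Bool, ∑ i ∈ L, ∑ j ∈ L, w i j * (ev e (c i) * (1 - ev e (c j))) ≤ b := by
    intro e
    refine le_trans (le_of_eq ?_) (H (Finset.univ.filter fun v => e (c v) = true) ?_)
    · have e1 : (Finset.univ.filter fun v => e (c v) = true) ∩ L = L.filter fun v => e (c v) = true := by
        ext x; simp [and_comm]
      have e2 : L \ (Finset.univ.filter fun v => e (c v) = true) = L.filter fun v => ¬ (e (c v) = true) := by
        ext x; simp
      rw [e1, e2, Finset.sum_filter]
      refine Finset.sum_congr rfl fun i _ => ?_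
      unfold ev
      split_ifs with hi
      · rw [Finset.sum_filter]
        refine Finset.sum_congr rfl fun j _ => ?_
        by_cases hj : e (c j) = true <;> simp [hj]
      · simp
    · intro a ha b hab
      simp only [Finset.mem_filter, Finset.mem_univ, true_and] at ha ⊢
      rwa [← (hc a b).2 (rep_eq.2 hab.reachable)]
  have hp : PP (fun _ : Sym2 V => (1/2:ℝ)) 1 := ⟨fun _ => by norm_num, fun _ => by norm_num, fun _ => by norm_num⟩
  have h2 := EE_mono hp h1
  rw [EE_const, EE_sum] at h2
  have h3 : ∀ i j, EE (fun _ => (1/2:ℝ)) (fun e => w i j * (ev e (c i) * (1 - ev e (c j)))) ≥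
      1/4 * w i j - 1/4 * (if rep G j = rep G i then w i j else 0) := by
    intro i j
    rw [EE_mul]
    split_ifs with hr
    · have : 0 ≤ EE (fun _ => (1/2:ℝ)) (fun e => ev e (c i) * (1 - ev e (c j))) := by
        have := EE_mono hp (F := fun _ => 0) (G := fun e => ev e (c i) * (1 - ev e (c j)))
          (fun e => mul_nonneg (ev0 _ _) (sub_nonneg.2 (ev1 _ _)))
        rwa [EE_const] at this
      nlinarith [w0 i j]
    · rw [EE_col fun h => hr ((hc i j).1 h).symm]; linarith
  have h4 : ∑ i ∈ L, ∑ j ∈ L, (1/4 * w i j - 1/4 * (if rep G j = rep G i then w i j else 0)) ≤ b := by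
    refine le_trans (Finset.sum_le_sum fun i _ => ?_) h2
    rw [EE_sum]
    exact Finset.sum_le_sum fun j _ => h3 i j
  simp only [Finset.sum_sub_distrib, ← Finset.mul_sum] at h4
  have h5 : ∑ i ∈ L, ∑ j ∈ L, (if rep G j = rep G i then w i j else 0) ≤ ∑ i, ∑ j with rep G j = rep G i, w i j := by
    have n0 : ∀ i j, 0 ≤ (if rep G j = rep G i then w i j else 0) := fun i j => by
      split_ifs; exacts [w0 i j, le_rfl]
    calc _ ≤ ∑ i ∈ L, ∑ j, (if rep G j = rep G i then w i j else 0) :=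
          Finset.sum_le_sum fun i _ => Finset.sum_le_univ_sum_of_nonneg fun j => n0 i j
      _ ≤ ∑ i, ∑ j, (if rep G j = rep G i then w i j else 0) :=
          Finset.sum_le_univ_sum_of_nonneg fun i => Finset.sum_nonneg fun j _ => n0 i j
      _ = _ := by simp only [Finset.sum_filter]
  linarith

def Bg (G : SimpleGraph V) (k : ℝ) : Finset V := Finset.univ.filter fun v => k ≤ compSize G v

theorem comp_Bg {G : SimpleGraph V} {k : ℝ} {v : V} (hv : k ≤ compSize G v) :
    (Finset.univ.filter fun w => rep G w = rep G v) ⊆ Bg G k := by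
  intro w hw
  simp only [Bg, Finset.mem_filter, Finset.mem_univ, true_and] at hw ⊢
  rw [compSize_eq] at hv ⊢
  rwa [hw]

theorem C1_Bg [Nonempty V] {G : SimpleGraph V} {k : ℝ} (h : k ≤ C1 G) : k ≤ (Bg G k).card := by
  obtain ⟨v, _, hv⟩ := Finset.exists_mem_eq_sup Finset.univ Finset.univ_nonempty (fun v => compSize G v)
  unfold C1 at h
  rw [hv] at h
  refine h.trans ?_
  have := Finset.card_le_card (comp_Bg h)
  rw [← compSize_eq] at this
  exact_mod_cast this

theorem le_C1 (G : SimpleGraph V) (v : V) : compSize G v ≤ C1 G := Finset.le_sup (f := fun v => compSize G v) (Finset.mem_univ v)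

theorem C2_Bg [Nonempty V] {G : SimpleGraph V} {k : ℝ} (k0 : 0 < k) (h : k ≤ C2 G) : C1 G + k ≤ (Bg G k).card := by
  set S := {m | ∃ v w : V, ¬G.Reachable v w ∧ m = min (compSize G v) (compSize G w)} with hS
  have hne : S.Nonempty := by
    by_contra hE
    rw [Set.not_nonempty_iff_eq_empty] at hE
    unfold C2 at h
    rw [← hS, hE] at h
    simp at h; linarith
  have hbd : BddAbove S := ⟨C1 G, by rintro m ⟨v, w, _, rfl⟩; exact (min_le_left _ _).trans (le_C1 G v)⟩
  obtain ⟨v, w, hvw, he⟩ := Nat.sSup_mem hne hbd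
  unfold C2 at h
  rw [← hS, he] at h
  have hv : k ≤ compSize G v := h.trans (by exact_mod_cast min_le_left _ _)
  have hw : k ≤ compSize G w := h.trans (by exact_mod_cast min_le_right _ _)
  obtain ⟨x, _, hx⟩ := Finset.exists_mem_eq_sup Finset.univ Finset.univ_nonempty (fun v => compSize G v)
  have hx' : C1 G = compSize G x := hx
  have hxk : k ≤ compSize G x := by
    rw [← hx']; exact hv.trans (by exact_mod_cast le_C1 G v)
  have key : ∀ z, k ≤ compSize G z → ¬ G.Reachable x z → C1 G + k ≤ (Bg G k).card := by
    intro z hz hxz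
    rw [hx']
    have h1 := Finset.card_le_card (Finset.union_subset (comp_Bg hxk) (comp_Bg hz))
    rw [Finset.card_union_of_disjoint, ← compSize_eq, ← compSize_eq] at h1
    · have : (compSize G x : ℝ) + compSize G z ≤ (Bg G k).card := by exact_mod_cast h1
      linarith
    · refine Finset.disjoint_left.2 fun a h1 h2 => hxz (rep_eq.1 ?_)
      exact (Finset.mem_filter.1 h1).2.symm.trans (Finset.mem_filter.1 h2).2
  by_cases hxv : G.Reachable x v
  · exact key w hw fun hxw => hvw (hxv.symm.trans hxw)
  · exact key v hv hxv

end
end Percolation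
end

open MeasureTheory Filter Topology ProbabilityTheory
noncomputable section
namespace Percolation
set_option linter.unusedSectionVars false

def LT (θ : ℝ) (Q : ∀ n : ℕ, (Fin n → ℝ) → (Sym2 (Fin n) → ℝ) → Prop) : Prop :=
  ∀ᶠ n in atTop, (PX n).real {X | ¬ (PL (Fin n)).real {u | ¬ Q n X u} ≤ θ} ≤ θ

def Lk (Q : ∀ n : ℕ, (Fin n → ℝ) → (Sym2 (Fin n) → ℝ) → Prop) : Prop := ∀ θ > 0, LT θ Q

theorem LT.mono {θ : ℝ} {Q Q' : ∀ n : ℕ, (Fin n → ℝ) → (Sym2 (Fin n) → ℝ) → Prop} (h : LT θ Q)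
    (hm : ∀ᶠ n in atTop, ∀ X u, Q n X u → Q' n X u) : LT θ Q' := by
  filter_upwards [h, hm] with n h1 h2
  refine (measureReal_mono ?_ (measure_ne_top _ _)).trans h1
  intro X hX h3
  refine hX ((measureReal_mono ?_ (measure_ne_top _ _)).trans h3)
  intro u hu hq
  exact hu (h2 X u hq)

theorem LT.and {a b : ℝ} {Q Q' : ∀ n : ℕ, (Fin n → ℝ) → (Sym2 (Fin n) → ℝ) → Prop} (h : LT a Q) (h' : LT b Q') :
    LT (a + b) (fun n X u => Q n X u ∧ Q' n X u) := by
  filter_upwards [h, h'] with n h1 h2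
  refine le_trans (measureReal_mono ?_ (measure_ne_top _ _)) ((measureReal_union_le
    {X | ¬ (PL (Fin n)).real {u | ¬ Q n X u} ≤ a} {X | ¬ (PL (Fin n)).real {u | ¬ Q' n X u} ≤ b}).trans (add_le_add h1 h2))
  intro X hX
  by_contra hc
  rw [Set.mem_union, not_or] at hc
  refine hX (le_trans (measureReal_mono ?_ (measure_ne_top _ _)) ((measureReal_union_le
    {u | ¬ Q n X u} {u | ¬ Q' n X u}).trans (add_le_add (not_not.1 hc.1) (not_not.1 hc.2))))
  intro u hu
  by_cases hq : Q n X u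
  · exact Or.inr fun hq' => hu ⟨hq, hq'⟩
  · exact Or.inl hq

theorem LT.ofX {θ : ℝ} (h0 : 0 ≤ θ) {Q : ∀ n : ℕ, (Fin n → ℝ) → Prop}
    (h : ∀ᶠ n in atTop, (PX n).real {X | ¬ Q n X} ≤ θ) : LT θ (fun n X _ => Q n X) := by
  filter_upwards [h] with n h1
  refine (measureReal_mono ?_ (measure_ne_top _ _)).trans h1
  intro X hX hQ
  refine hX ?_
  have : {u : Sym2 (Fin n) → ℝ | ¬ Q n X} = ∅ := by ext u; simp [hQ]
  rw [this]; simpa using h0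

theorem LT.ofU {θ : ℝ} (h0 : 0 ≤ θ) {Q : ∀ n : ℕ, (Fin n → ℝ) → (Sym2 (Fin n) → ℝ) → Prop}
    (h : ∀ᶠ n in atTop, ∀ X : Fin n → ℝ, (PL (Fin n)).real {u | ¬ Q n X u} ≤ θ) : LT θ Q := by
  filter_upwards [h] with n h1
  have : {X : Fin n → ℝ | ¬ (PL (Fin n)).real {u | ¬ Q n X u} ≤ θ} = ∅ := by ext X; simpa using h1 X
  rw [this]; simpa using h0

theorem LT.le {a b : ℝ} (hab : a ≤ b) {Q : ∀ n : ℕ, (Fin n → ℝ) → (Sym2 (Fin n) → ℝ) → Prop} (h : LT a Q) : LT b Q := by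
  filter_upwards [h] with n h1
  refine (measureReal_mono ?_ (measure_ne_top _ _)).trans (h1.trans hab)
  intro X hX h2
  exact hX (le_trans h2 hab)

theorem Lk.mono {Q Q' : ∀ n : ℕ, (Fin n → ℝ) → (Sym2 (Fin n) → ℝ) → Prop} (h : Lk Q)
    (hm : ∀ᶠ n in atTop, ∀ X u, Q n X u → Q' n X u) : Lk Q' := fun θ hθ => (h θ hθ).mono hm

theorem Lk.and {Q Q' : ∀ n : ℕ, (Fin n → ℝ) → (Sym2 (Fin n) → ℝ) → Prop} (h : Lk Q) (h' : Lk Q') :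
    Lk (fun n X u => Q n X u ∧ Q' n X u) := fun θ hθ => by
  have := (h (θ/2) (half_pos hθ)).and (h' (θ/2) (half_pos hθ))
  rwa [add_halves] at this

theorem Lk.all {ι : Type*} [DecidableEq ι] (s : Finset ι) {Q : ι → ∀ n : ℕ, (Fin n → ℝ) → (Sym2 (Fin n) → ℝ) → Prop}
    (h : ∀ i, Lk (Q i)) : Lk (fun n X u => ∀ i ∈ s, Q i n X u) := by
  induction s using Finset.induction_on with
  | empty =>
    intro θ hθ
    refine LT.ofX hθ.le (Q := fun n X => ∀ i ∈ (∅ : Finset ι), True) ?_ |>.mono (Eventually.of_forall fun n X u _ i hi => by simp at hi)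
    exact Eventually.of_forall fun n => by simpa using hθ.le
  | insert a s _ ih =>
    refine ((h a).and ih).mono (Eventually.of_forall fun n X u hq i hi => ?_)
    rcases Finset.mem_insert.1 hi with rfl | hi
    exacts [hq.1, hq.2 i hi]

def pX (k : ℝ → ℝ → ℝ) {n : ℕ} (X : Fin n → ℝ) : Sym2 (Fin n) → ℝ := sym2Val fun i j => min (k (X i) (X j) / n) 1

section
variable {k : ℝ → ℝ → ℝ} {K : ℝ} (hk : Ker k K)
include hk

theorem Ker.pX_s {n : ℕ} (X : Fin n → ℝ) (i j : Fin n) : pX k X s(i, j) = min (k (X i) (X j) / n) 1 := by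
  unfold pX sym2Val
  simp only [Sym2.lift_mk]
  rw [hk.sym (X j)]; ring

theorem Ker.pX_PP {n : ℕ} (X : Fin n → ℝ) : PP (pX k X) (K / n) := by
  refine ⟨?_, ?_, ?_⟩ <;> intro f <;> induction f using Sym2.ind with | _ i j => ?_
  · rw [hk.pX_s]; exact le_min (div_nonneg (hk.nn _ _) (by positivity)) zero_le_one
  · rw [hk.pX_s]; exact min_le_right _ _
  · rw [hk.pX_s]; exact (min_le_left _ _).trans (by gcongr; exact hk.le _ _)

theorem Ker.pX_n {n : ℕ} (hn : K ≤ n) (X : Fin n → ℝ) (i j : Fin n) : pX k X s(i, j) = k (X i) (X j) / n := by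
  rw [hk.pX_s, min_eq_left]
  exact div_le_one_of_le₀ ((hk.le _ _).trans hn) (by positivity)

end

theorem PP.smul {V : Type*} [Fintype V] {p : Sym2 V → ℝ} {B t : ℝ} (hp : PP p B) (t0 : 0 ≤ t) (t1 : t ≤ 1) :
    PP (fun f => t * p f) B :=
  ⟨fun f => mul_nonneg t0 (hp.nn f), fun f => mul_le_one₀ t1 (hp.nn f) (hp.le1 f),
    fun f => (mul_le_of_le_one_left (hp.nn f) t1).trans (hp.le f)⟩

theorem sgn {n : ℕ} (s : Fin n → Fin n → ℝ) {B : ℝ}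
    (h : ∀ f : Fin n → ℝ, (∀ i, |f i| ≤ 1) → |∑ i, ∑ j, s i j * f i| ≤ B) : ∑ i, |∑ j, s i j| ≤ B := by
  refine le_trans (le_of_eq ?_) ((le_abs_self _).trans (h (fun i => if 0 ≤ ∑ j, s i j then 1 else -1) ?_))
  · refine Finset.sum_congr rfl fun i _ => ?_
    rw [← Finset.sum_mul]
    split_ifs with h0
    · rw [abs_of_nonneg h0, mul_one]
    · rw [abs_of_neg (not_le.1 h0)]; ring
  · intro i; split_ifs <;> simp

structure Su (κs : ℕ → ℝ → ℝ → ℝ) (κ : ℝ → ℝ → ℝ) (K : ℝ) (φ : ℕ → ℝ → ℝ) : Prop where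
  ks : ∀ n, Ker (κs n) K
  k : Ker κ K
  K0 : 0 < K
  hφ : ∀ n, MeasurePreserving (φ n) lam lam
  s1 : ∀ (m : ℕ) (U : Fin (m+1) → Fin (m+1) → ℝ), (∀ a b, 0 ≤ U a b ∧ U a b ≤ K) → ∀ e0 η : ℝ,
    ∫ p : ℝ × ℝ, |κ p.1 p.2 - U (blk m p.1) (blk m p.2)| ∂(lam.prod lam) ≤ e0 → 0 < η → K^3 * e0 < η ^ 5 →
    ∀ᶠ n in atTop, (PX n).real {X | ¬ E1 (fun x y => κs n x y - U (blk m (φ n x)) (blk m (φ n y))) η X} ≤ η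

section
variable {κs : ℕ → ℝ → ℝ → ℝ} {κ : ℝ → ℝ → ℝ} {K : ℝ} {φ : ℕ → ℝ → ℝ} (hs : Su κs κ K φ)
include hs

theorem Su.U {η : ℝ} (hη : 0 < η) : ∀ᶠ m : ℕ in atTop, ∃ U : Fin (m+1) → Fin (m+1) → ℝ, (∀ a b, 0 ≤ U a b ∧ U a b ≤ K) ∧
    ∫ p : ℝ × ℝ, |κ p.1 p.2 - U (blk m p.1) (blk m p.2)| ∂(lam.prod lam) ≤ η ∧
    ∀ᶠ n in atTop, (PX n).real {X | ¬ E1 (fun x y => κs n x y - U (blk m (φ n x)) (blk m (φ n y))) η X} ≤ η := by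
  have K3 : 0 < K^3 := pow_pos hs.K0 3
  have he : 0 < min η (η^5 / (2 * K^3)) := by positivity
  filter_upwards [step2 (f := fun p => κ p.1 p.2) hs.k.meas (fun p => hs.k.nn _ _) (fun p => hs.k.le _ _) he]
    with m ⟨U, hU, h⟩
  refine ⟨U, hU, h.trans (min_le_left _ _), hs.s1 m U hU _ η h hη ?_⟩
  calc K^3 * min η (η^5 / (2 * K^3)) ≤ K^3 * (η^5 / (2 * K^3)) := by gcongr; exact min_le_right _ _
    _ = η^5 / 2 := by field_simp [hs.K0.ne']
    _ < η^5 := half_lt_self (by positivity)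

theorem Su.lln {ψ : ℝ → ℝ} (hψ : Measurable ψ) {C : ℝ} (hC : ∀ x, |ψ x| ≤ C) {η : ℝ} (hη : 0 < η) :
    Lk (fun n X _ => |∑ i, ψ (φ n (X i)) - n * ∫ x, ψ x ∂lam| ≤ η * n) := by
  intro θ hθ
  refine (LT.ofX hθ.le (samp2 hs.hφ (ι := Unit) (ψ := fun _ => ψ) (fun _ => hψ) (fun _ => hC) hη hθ)).mono ?_
  exact Eventually.of_forall fun n X u h => h ()

theorem Su.D1 {q : ℝ → ℝ} (hq : Measurable q) (q1 : ∀ x, |q x| ≤ 1) {η : ℝ} (hη : 0 < η) :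
    Lk (fun n X _ => ∑ i, |∑ j, κs n (X i) (X j) * q (φ n (X j)) - n * TT κ q (φ n (X i))| ≤ η * (n:ℝ)^2) := by
  intro θ hθ
  set ζ := min (η/4) (θ/2) with hζ
  have z0 : 0 < ζ := lt_min (by positivity) (by positivity)
  obtain ⟨m, U, hU, hU2, hE1⟩ := (hs.U z0).exists
  have mU : Measurable (fun p : ℝ × ℝ => U (blk m p.1) (blk m p.2)) := by
    have : Measurable (fun q : Fin (m+1) × Fin (m+1) => U q.1 q.2) := measurable_of_finite _
    exact this.comp (((blk_meas m).comp measurable_fst).prodMk ((blk_meas m).comp measurable_snd))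
  have mUa : ∀ a, Measurable (fun y => U a (blk m y) * q y) := fun a =>
    ((measurable_of_finite (U a)).comp (blk_meas m)).mul hq
  have bUa : ∀ a y, |U a (blk m y) * q y| ≤ K := fun a y => by
    rw [abs_mul, abs_of_nonneg (hU _ _).1]
    exact (mul_le_of_le_one_right (hU _ _).1 (q1 y)).trans (hU _ _).2
  set d : ℝ → ℝ := fun x => |(∫ y, U (blk m x) (blk m y) * q y ∂lam) - TT κ q x| with hd
  have md : Measurable d := by
    have h1 : Measurable (fun a : Fin (m+1) => ∫ y, U a (blk m y) * q y ∂lam) := measurable_of_finite _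
    have := (h1.comp (blk_meas m)).sub (hs.k.Tmeas hq)
    have h2 : d = fun x => ‖(∫ y, U (blk m x) (blk m y) * q y ∂lam) - TT κ q x‖ := by
      funext x; rw [Real.norm_eq_abs]
    rw [h2]; exact this.norm
  have dle : ∀ x, d x ≤ ∫ y, |κ x y - U (blk m x) (blk m y)| ∂lam := by
    intro x
    simp only [hd, TT]
    rw [abs_sub_comm, ← integral_sub (hs.k.int hq 1 q1 x) (bint (mUa _) K (bUa _)), ← Real.norm_eq_abs]
    refine (norm_integral_le_integral_norm _).trans (integral_mono_of_nonneg (ae_of_all _ fun y => norm_nonneg _) ?_ ?_)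
    · refine (bint ((hs.k.m1 x).sub ((measurable_of_finite (U (blk m x))).comp (blk_meas m))) (K+K) ?_).abs
      intro y; exact (abs_sub _ _).trans (add_le_add (hs.k.abs _ _) (by
        change |U _ _| ≤ _
        rw [abs_of_nonneg (hU _ _).1]; exact (hU _ _).2))
    · refine ae_of_all _ fun y => ?_
      change ‖κ x y * q y - U (blk m x) (blk m y) * q y‖ ≤ |κ x y - U (blk m x) (blk m y)|
      rw [← sub_mul, norm_mul, Real.norm_eq_abs, Real.norm_eq_abs]
      exact mul_le_of_le_one_right (abs_nonneg _) (q1 y)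
  have iD : Integrable (fun p : ℝ × ℝ => |κ p.1 p.2 - U (blk m p.1) (blk m p.2)|) (lam.prod lam) := by
    refine (bint (hs.k.meas.sub mU) (K+K) ?_).abs
    intro p; exact (abs_sub _ _).trans (add_le_add (hs.k.abs _ _) (by
        rw [abs_of_nonneg (hU _ _).1]; exact (hU _ _).2))
  have dint : ∫ x, d x ∂lam ≤ ζ := by
    refine le_trans ?_ hU2
    rw [integral_prod _ iD]
    exact integral_mono_of_nonneg (ae_of_all _ fun x => abs_nonneg _) iD.integral_prod_left (ae_of_all _ dle)
  have dK : ∀ x, |d x| ≤ K + K := by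
    intro x
    rw [abs_of_nonneg (abs_nonneg _)]
    refine (dle x).trans ?_
    calc _ ≤ ∫ y, (K + K) ∂lam := by
          refine integral_mono_of_nonneg (ae_of_all _ fun y => abs_nonneg _) (integrable_const _) (ae_of_all _ fun y => ?_)
          exact (abs_sub _ _).trans (add_le_add (hs.k.abs _ _) (by
            rw [abs_of_nonneg (hU _ _).1]; exact (hU _ _).2))
      _ = _ := by simp
  have K0 := hs.K0
  have hE2 := samp2 hs.hφ (ι := Option (Fin (m+1))) (ψ := fun o => o.elim d fun a y => U a (blk m y) * q y)
    (fun o => by cases o; exacts [md, mUa _]) (C := K + K)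
    (fun o x => by cases o; exacts [dK x, (bUa _ x).trans (by linarith)]) z0 z0
  refine (((LT.ofX z0.le hE1).and (LT.ofX z0.le hE2)).le (b := θ) (by
    have := min_le_right (η/4) (θ/2); linarith)).mono (Eventually.of_forall ?_)
  rintro n X _ ⟨h1, h2⟩
  set y : Fin n → ℝ := fun i => φ n (X i) with hy
  have t1 : ∑ i, |∑ j, (κs n (X i) (X j) - U (blk m (y i)) (blk m (y j))) * q (y j)| ≤ ζ * (n:ℝ)^2 := by
    refine sgn _ fun f hf => ?_
    have := h1 f (fun j => q (y j)) hf (fun j => q1 _)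
    refine le_trans (le_of_eq (congrArg _ (Finset.sum_congr rfl fun i _ => Finset.sum_congr rfl fun j _ => ?_))) this
    simp only [hy]; ring
  have t2 : ∀ a, |∑ j, U a (blk m (y j)) * q (y j) - n * ∫ y, U a (blk m y) * q y ∂lam| ≤ ζ * n := fun a => h2 (some a)
  have t3 : ∑ i, d (y i) ≤ n * ζ + ζ * n := by
    have := h2 none
    change |∑ i, d (y i) - n * ∫ x, d x ∂lam| ≤ ζ * n at this
    have h3 := (abs_le.1 this).2
    have : (n:ℝ) * ∫ x, d x ∂lam ≤ n * ζ := by gcongr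
    linarith
  have key : ∀ i, |∑ j, κs n (X i) (X j) * q (y j) - n * TT κ q (y i)| ≤
      |∑ j, (κs n (X i) (X j) - U (blk m (y i)) (blk m (y j))) * q (y j)| + ζ * n + n * d (y i) := by
    intro i
    have e : ∑ j, κs n (X i) (X j) * q (y j) - n * TT κ q (y i) =
      ∑ j, (κs n (X i) (X j) - U (blk m (y i)) (blk m (y j))) * q (y j) +
      (∑ j, U (blk m (y i)) (blk m (y j)) * q (y j) - n * ∫ z, U (blk m (y i)) (blk m z) * q z ∂lam) +
      n * ((∫ z, U (blk m (y i)) (blk m z) * q z ∂lam) - TT κ q (y i)) := by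
      simp only [sub_mul, Finset.sum_sub_distrib]; ring
    rw [e]
    refine (abs_add_three _ _ _).trans (add_le_add (add_le_add le_rfl (t2 _)) (le_of_eq ?_))
    rw [abs_mul, abs_of_nonneg (by positivity : (0:ℝ) ≤ n)]
  calc _ ≤ ∑ i, (|∑ j, (κs n (X i) (X j) - U (blk m (y i)) (blk m (y j))) * q (y j)| + ζ * n + n * d (y i)) :=
        Finset.sum_le_sum fun i _ => key i
    _ = ∑ i, |∑ j, (κs n (X i) (X j) - U (blk m (y i)) (blk m (y j))) * q (y j)| + n * (ζ * n) + n * ∑ i, d (y i) := by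
        simp only [Finset.sum_add_distrib, Finset.mul_sum, Finset.sum_const, Finset.card_univ, Fintype.card_fin, nsmul_eq_mul]
    _ ≤ ζ * (n:ℝ)^2 + n * (ζ * n) + n * (n * ζ + ζ * n) := by gcongr
    _ = 4 * ζ * (n:ℝ)^2 := by ring
    _ ≤ η * (n:ℝ)^2 := by
        have := min_le_left (η/4) (θ/2)
        gcongr; linarith

end
end Percolation
end

open MeasureTheory Filter Topology ProbabilityTheory
noncomputable section
namespace Percolation
set_option linter.unusedSectionVars false

section
variable {κs : ℕ → ℝ → ℝ → ℝ} {κ : ℝ → ℝ → ℝ} {K : ℝ} {φ : ℕ → ℝ → ℝ} (hs : Su κs κ K φ)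
include hs

theorem Su.tk {t : ℝ} (t0 : 0 ≤ t) : Ker (fun x y => t * κ x y) (t * K) := hs.k.smul t0

theorem Su.bigK : ∀ᶠ n : ℕ in atTop, K ≤ n ∧ (0:ℝ) < n := by
  filter_upwards [eventually_ge_atTop ⌈K⌉₊, eventually_gt_atTop 0] with n h1 h2
  exact ⟨Nat.ceil_le.1 h1, by exact_mod_cast h2⟩

theorem Su.D2 {t : ℝ} (t0 : 0 ≤ t) (t1 : t ≤ 1) (h : ℕ) : ∀ {η : ℝ}, 0 < η →
    Lk (fun n X _ => ∑ i, |1 - rr (fun f => t * pX (κs n) X f) h i - qq (fun x y => t * κ x y) h (φ n (X i))| ≤ η * n) := by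
  have K0 := hs.K0
  induction h with
  | zero =>
    intro η hη
    refine (hs.lln (ψ := fun _ => 0) measurable_const (C := 0) (by simp) hη).mono (Eventually.of_forall fun n X u _ => ?_)
    simp [rr, qq]; positivity
  | succ h ih =>
    intro η hη
    obtain ⟨qm, q01⟩ := (hs.tk t0).q01 h
    set q := qq (fun x y => t * κ x y) h with hq
    refine ((ih (η := η / (2 * K)) (by positivity)).and (hs.D1 (q := q) qm ((hs.tk t0).qabs h) (half_pos hη))).mono ?_
    filter_upwards [hs.bigK] with n hn X u ⟨h1, h2⟩
    have n0 := hn.2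
    set p := pX (κs n) X with hp
    have pp : PP (fun f => t * p f) (K / n) := ((hs.ks n).pX_PP X).smul t0 t1
    have r01 := rr01 pp h
    set r := rr (fun f => t * p f) h with hr
    set e : Fin n → ℝ := fun i => |1 - r i - q (φ n (X i))| with he
    have key : ∀ i, |1 - rr (fun f => t * p f) (h+1) i - qq (fun x y => t * κ x y) (h+1) (φ n (X i))| ≤
        ∑ w, K / n * e w + 1 / n * |∑ j, κs n (X i) (X j) * q (φ n (X j)) - n * TT κ q (φ n (X i))| := by
      intro i
      have a0 : 0 ≤ ∑ w, t * p s(i, w) * (1 - r w) := Finset.sum_nonneg fun w _ =>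
        mul_nonneg (pp.nn _) (sub_nonneg.2 (r01 w).2)
      have b0 : 0 ≤ TT (fun x y => t * κ x y) q (φ n (X i)) := (hs.tk t0).Tnn (fun x => (q01 x).1) _
      have e1 : 1 - rr (fun f => t * p f) (h+1) i - qq (fun x y => t * κ x y) (h+1) (φ n (X i)) =
        -(Real.exp (-(∑ w, t * p s(i, w) * (1 - r w))) - Real.exp (-(TT (fun x y => t * κ x y) q (φ n (X i))))) := by
        simp only [rr, qq, hr, hq]; ring
      rw [e1, abs_neg]
      refine (exp_lip a0 b0).trans ?_
      have e2 : ∑ w, t * p s(i, w) * (1 - r w) - TT (fun x y => t * κ x y) q (φ n (X i)) =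
        ∑ w, t * p s(i, w) * (1 - r w - q (φ n (X w))) +
          t / n * (∑ j, κs n (X i) (X j) * q (φ n (X j)) - n * TT κ q (φ n (X i))) := by
        rw [TT_smul, mul_sub, Finset.mul_sum, ← mul_assoc (t / n), div_mul_cancel₀ _ n0.ne', ← add_sub_assoc, ← Finset.sum_add_distrib]
        congr 1
        refine Finset.sum_congr rfl fun w _ => ?_
        rw [hp, (hs.ks n).pX_n hn.1]; ring
      rw [e2]
      refine (abs_add_le _ _).trans (add_le_add ((Finset.abs_sum_le_sum_abs _ _).trans (Finset.sum_le_sum fun w _ => ?_)) ?_)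
      · rw [abs_mul, abs_of_nonneg (pp.nn _)]
        exact mul_le_mul_of_nonneg_right (pp.le _) (abs_nonneg _)
      · rw [abs_mul, abs_of_nonneg (by positivity : 0 ≤ t / n)]
        gcongr
    calc _ ≤ ∑ i, (∑ w, K / n * e w + 1 / n * |∑ j, κs n (X i) (X j) * q (φ n (X j)) - n * TT κ q (φ n (X i))|) :=
          Finset.sum_le_sum fun i _ => key i
      _ = K * ∑ w, e w + 1 / n * ∑ i, |∑ j, κs n (X i) (X j) * q (φ n (X j)) - n * TT κ q (φ n (X i))| := by
          rw [Finset.sum_add_distrib, Finset.sum_const, Finset.card_univ, Fintype.card_fin, nsmul_eq_mul, ← Finset.mul_sum,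
            ← Finset.mul_sum]
          field_simp
      _ ≤ K * (η / (2 * K) * n) + 1 / n * (η / 2 * (n:ℝ)^2) := by
          gcongr
      _ = η * n := by field_simp; ring

theorem Su.Q1 {t : ℝ} (t0 : 0 ≤ t) (t1 : t ≤ 1) (h : ℕ) {a : ℝ → ℝ} (a01 : ∀ x, 0 ≤ a x ∧ a x ≤ 1) {η : ℝ} (hη : 0 < η) :
    Lk (fun n X u => |∑ v, a (φ n (X v)) * (NN (cfg (fun f => t * pX (κs n) X f) u) h v ∅ -
      rr (fun f => t * pX (κs n) X f) h v)| ≤ η * n) := by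
  intro θ hθ
  refine LT.ofU hθ.le ?_
  filter_upwards [SM_all hs.K0 h 0 1 one_pos (θ * η^2) (by positivity), hs.bigK] with n hn hK X
  have n0 := hK.2
  set p := fun f => t * pX (κs n) X f
  have pp : PP p (K / n) := ((hs.ks n).pX_PP X).smul t0 t1
  have h1 := hn p pp ∅ (by simp) (fun w => a (φ n (X w)) / n) (fun w => ⟨div_nonneg (a01 _).1 n0.le, by
    gcongr; exact (a01 _).2⟩)
  have h2 := PL_markov pp (F := fun e => (∑ w ∈ (∅ : Finset (Fin n))ᶜ, a (φ n (X w)) / n * (NN e h w ∅ - rr p h w))^2)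
    (fun e => sq_nonneg _) (a := η^2) (by positivity)
  refine (measureReal_mono ?_ (measure_ne_top _ _)).trans (h2.trans ((div_le_iff₀ (by positivity)).2 h1))
  intro u hu
  change ¬ _ ≤ η * n at hu
  change η^2 ≤ _
  have e : ∑ w ∈ (∅ : Finset (Fin n))ᶜ, a (φ n (X w)) / n * (NN (cfg p u) h w ∅ - rr p h w) =
      (∑ v, a (φ n (X v)) * (NN (cfg p u) h v ∅ - rr p h v)) / n := by
    rw [Finset.compl_empty, Finset.sum_div]
    exact Finset.sum_congr rfl fun w _ => by ring
  rw [e, ← sq_abs (_ / _), abs_div, abs_of_pos n0]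
  have : η ≤ |∑ v, a (φ n (X v)) * (NN (cfg p u) h v ∅ - rr p h v)| / n := by
    rw [le_div_iff₀ n0]; exact (not_le.1 hu).le
  gcongr

theorem Su.dens {t : ℝ} (t0 : 0 ≤ t) (t1 : t ≤ 1) (h : ℕ) {a : ℝ → ℝ} (am : Measurable a) (a01 : ∀ x, 0 ≤ a x ∧ a x ≤ 1)
    {η : ℝ} (hη : 0 < η) :
    Lk (fun n X u => |∑ v, a (φ n (X v)) * (1 - NN (cfg (fun f => t * pX (κs n) X f) u) h v ∅) -
      n * ∫ x, a x * qq (fun x y => t * κ x y) h x ∂lam| ≤ η * n) := by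
  obtain ⟨qm, q01⟩ := (hs.tk t0).q01 h
  have h3 : (0:ℝ) < η / 3 := by positivity
  refine (((hs.Q1 t0 t1 h a01 h3).and (hs.D2 t0 t1 h h3)).and (hs.lln (am.mul qm) (C := 1) (fun x => ?_) h3)).mono ?_
  · change |a x * qq (fun x y => t * κ x y) h x| ≤ 1
    rw [abs_of_nonneg (mul_nonneg (a01 x).1 (q01 x).1)]
    exact mul_le_one₀ (a01 x).2 (q01 x).1 (q01 x).2
  refine Eventually.of_forall fun n X u ⟨⟨h1, h2⟩, h4⟩ => ?_
  set p := fun f => t * pX (κs n) X f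
  set q := qq (fun x y => t * κ x y) h
  have e : ∑ v, a (φ n (X v)) * (1 - NN (cfg p u) h v ∅) - n * ∫ x, a x * q x ∂lam =
      -(∑ v, a (φ n (X v)) * (NN (cfg p u) h v ∅ - rr p h v)) + ∑ v, a (φ n (X v)) * (1 - rr p h v - q (φ n (X v))) +
      (∑ v, a (φ n (X v)) * q (φ n (X v)) - n * ∫ x, a x * q x ∂lam) := by
    rw [← Finset.sum_neg_distrib, ← add_sub_assoc, ← Finset.sum_add_distrib, ← Finset.sum_add_distrib]
    congr 1
    exact Finset.sum_congr rfl fun v _ => by ring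
  rw [e]
  refine (abs_add_three _ _ _).trans ?_
  rw [abs_neg]
  have h5 : |∑ v, a (φ n (X v)) * (1 - rr p h v - q (φ n (X v)))| ≤ η / 3 * n := by
    refine (Finset.abs_sum_le_sum_abs _ _).trans (le_trans (Finset.sum_le_sum fun v _ => ?_) h2)
    rw [abs_mul, abs_of_nonneg (a01 _).1]
    exact mul_le_of_le_one_left (abs_nonneg _) (a01 _).2
  have h4' : |∑ v, a (φ n (X v)) * q (φ n (X v)) - n * ∫ x, a x * q x ∂lam| ≤ η / 3 * n := h4
  linarith

theorem Su.UB {ε η : ℝ} (hε : 0 < ε) (hη : 0 < η) :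
    Lk (fun n X u => ((Bg (graphOf (cfg (pX (κs n) X) u)) (ε * n)).card : ℝ) ≤ (∫ x, rho κ x ∂lam + η) * n) := by
  have h3 : (0:ℝ) < η / 3 := by positivity
  obtain ⟨h, hh⟩ := ((hs.k.qint).eventually (gt_mem_nhds (show ∫ x, rho κ x ∂lam < ∫ x, rho κ x ∂lam + η/3 by linarith))).exists
  have hB : Lk (fun n X u => ((Finset.univ.filter fun v => ε * n ≤ BB (cfg (pX (κs n) X) u) h v ∅).card : ℝ) ≤ η / 3 * n) := by
    intro θ hθ
    refine LT.ofU hθ.le ?_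
    have hlim : Tendsto (fun n : ℕ => (Cb K h / (ε * (η/3))) / (n:ℝ)) atTop (𝓝 0) := tendsto_const_div_atTop_nhds_zero_nat _
    filter_upwards [hlim.eventually (gt_mem_nhds hθ), hs.bigK] with n h1 hK X
    have n0 := hK.2
    have pp := (hs.ks n).pX_PP X
    have hm := PL_markov pp (F := fun e => ∑ v, BB e h v ∅) (fun e => Finset.sum_nonneg fun v _ => (zero_le_one.trans (BB0 e h v ∅)))
      (a := (η / 3 * n) * (ε * n)) (by positivity)
    refine (measureReal_mono ?_ (measure_ne_top _ _)).trans (hm.trans (le_trans ?_ h1.le))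
    · intro u hu
      change ¬ _ ≤ η / 3 * n at hu
      change η / 3 * n * (ε * n) ≤ ∑ v, BB _ h v ∅
      calc _ ≤ ((Finset.univ.filter fun v => ε * n ≤ BB (cfg (pX (κs n) X) u) h v ∅).card : ℝ) * (ε * n) := by
            have := (not_le.1 hu).le
            gcongr
        _ = ∑ v with ε * n ≤ BB (cfg (pX (κs n) X) u) h v ∅, (ε * n) := by simp
        _ ≤ ∑ v with ε * n ≤ BB (cfg (pX (κs n) X) u) h v ∅, BB (cfg (pX (κs n) X) u) h v ∅ :=
            Finset.sum_le_sum fun v hv => (Finset.mem_filter.1 hv).2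
        _ ≤ _ := Finset.sum_le_univ_sum_of_nonneg fun v => (zero_le_one.trans (BB0 _ h v ∅))
    · rw [EE_sum]
      have : ∑ v : Fin n, EE (pX (κs n) X) (fun e => BB e h v ∅) ≤ n * Cb K h := by
        refine (Finset.sum_le_sum fun v _ => EBB pp (K := K) (le_of_eq (by
          rw [Fintype.card_fin]; field_simp)) (div_nonneg hs.K0.le n0.le) h v ∅ (by simp)).trans (by simp)
      calc _ ≤ n * Cb K h / (η / 3 * n * (ε * n)) := by gcongr
        _ = _ := by field_simp
  refine ((hs.dens zero_le_one le_rfl h (a := fun _ => 1) measurable_const (by simp) h3).and hB).mono (Eventually.of_forall ?_)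
  rintro n X u ⟨h1, h2⟩
  simp only [one_mul] at h1
  have h1' := (abs_le.1 h1).2
  have hc : ((Bg (graphOf (cfg (pX (κs n) X) u)) (ε * n)).card : ℝ) ≤ ∑ v, (1 - NN (cfg (pX (κs n) X) u) h v ∅) +
      ((Finset.univ.filter fun v => ε * n ≤ BB (cfg (pX (κs n) X) u) h v ∅).card : ℝ) := by
    rw [Finset.card_eq_sum_ones, Finset.card_eq_sum_ones, Nat.cast_sum, Nat.cast_sum, Bg, Finset.sum_filter, Finset.sum_filter,
      ← Finset.sum_add_distrib]
    refine Finset.sum_le_sum fun v _ => ?_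
    have := (NN01 (cfg (pX (κs n) X) u) h v ∅)
    rcases NNdi (cfg (pX (κs n) X) u) h v ∅ with h0 | h0
    · rw [h0]; split_ifs <;> norm_num
    · have := NN_comp_le (e := cfg (pX (κs n) X) u) (h := h) (v := v) (by rw [h0]; norm_num)
      rw [h0]
      split_ifs with ha hb
      · norm_num
      · exact absurd (ha.trans this) hb
      · norm_num
      · norm_num
  have : (n:ℝ) * ∫ x, qq κ h x ∂lam ≤ n * (∫ x, rho κ x ∂lam + η/3) := by gcongr
  linarith

end
end Percolation
end

open MeasureTheory Filter Topology ProbabilityTheory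
noncomputable section
namespace Percolation
set_option linter.unusedSectionVars false

theorem blk_int (m : ℕ) (V : Fin (m+1) → ℝ) : ∫ x, V (blk m x) ∂lam = ∑ s, lam.real (blk m ⁻¹' {s}) * V s := by
  rw [← integral_map (φ := blk m) (f := V) (blk_meas m).aemeasurable (measurable_of_finite V).aestronglyMeasurable]
  have : IsProbabilityMeasure (lam.map (blk m)) := Measure.isProbabilityMeasure_map (blk_meas m).aemeasurable
  rw [integral_fintype (Integrable.of_finite)]
  refine Finset.sum_congr rfl fun s _ => ?_
  rw [map_measureReal_apply (blk_meas m) (measurableSet_singleton s), smul_eq_mul]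

def Fb (m : ℕ) {n : ℕ} (y : Fin n → ℝ) (f : Fin n → ℝ) (s : Fin (m+1)) : ℝ :=
  (∑ i, if blk m (y i) = s then f i else 0) / (n * lam.real (blk m ⁻¹' {s}))

def Fd (m : ℕ) {n : ℕ} (y : Fin n → ℝ) (f : Fin n → ℝ) (x : ℝ) : ℝ := Fb m y f (blk m x)

theorem blk_m {m : ℕ} (V : Fin (m+1) → ℝ) : Measurable (fun x => V (blk m x)) := (measurable_of_finite V).comp (blk_meas m)

theorem Fd_meas (m : ℕ) {n : ℕ} (y : Fin n → ℝ) (f : Fin n → ℝ) : Measurable (Fd m y f) := blk_m _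

theorem Fb_mul {m n : ℕ} (n0 : (0:ℝ) < n) (y : Fin n → ℝ) (f : Fin n → ℝ) (s : Fin (m+1)) :
    n * (lam.real (blk m ⁻¹' {s}) * Fb m y f s) = ∑ i, if blk m (y i) = s then f i else 0 := by
  have := (blk_pos m s).ne'
  unfold Fb; field_simp

theorem Fd_int {m n : ℕ} (n0 : (0:ℝ) < n) (y : Fin n → ℝ) (f : Fin n → ℝ) (V : Fin (m+1) → ℝ) :
    n * ∫ x, V (blk m x) * Fd m y f x ∂lam = ∑ i, V (blk m (y i)) * f i := by
  have := blk_int m (fun s => V s * Fb m y f s)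
  change ∫ x, V (blk m x) * Fd m y f x ∂lam = _ at this
  rw [this, Finset.mul_sum]
  calc _ = ∑ s, V s * ∑ i, (if blk m (y i) = s then f i else 0) := by
        refine Finset.sum_congr rfl fun s _ => ?_
        rw [← Fb_mul n0]; ring
    _ = _ := by
        simp only [Finset.mul_sum]
        rw [Finset.sum_comm]
        refine Finset.sum_congr rfl fun i _ => ?_
        simp

theorem Fd_add (m : ℕ) {n : ℕ} (y : Fin n → ℝ) (f g : Fin n → ℝ) (x : ℝ) :
    Fd m y (fun i => f i + g i) x = Fd m y f x + Fd m y g x := by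
  unfold Fd Fb
  rw [← add_div, ← Finset.sum_add_distrib]
  congr 1
  exact Finset.sum_congr rfl fun i _ => by split_ifs <;> simp

theorem Fd_02 {m n : ℕ} (n0 : (0:ℝ) < n) {y : Fin n → ℝ}
    (hN : ∀ s, ∑ i, (if blk m (y i) = s then (1:ℝ) else 0) ≤ 2 * (n * lam.real (blk m ⁻¹' {s})))
    {f : Fin n → ℝ} (hf : ∀ i, 0 ≤ f i ∧ f i ≤ 1) (x : ℝ) : 0 ≤ Fd m y f x ∧ Fd m y f x ≤ 2 := by
  have p := blk_pos m (blk m x)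
  unfold Fd Fb
  refine ⟨div_nonneg (Finset.sum_nonneg fun i _ => ?_) (by positivity), ?_⟩
  · split_ifs; exacts [(hf i).1, le_rfl]
  · rw [div_le_iff₀ (by positivity)]
    refine le_trans (Finset.sum_le_sum fun i _ => ?_) (hN _)
    split_ifs; exacts [(hf i).2, le_rfl]

theorem Fd_form {κ κn : ℝ → ℝ → ℝ} {K : ℝ} (hk : Ker κ K) {m n : ℕ} (n0 : (0:ℝ) < n) {φ : ℝ → ℝ} {X : Fin n → ℝ}
    (hN : ∀ s, ∑ i, (if blk m (φ (X i)) = s then (1:ℝ) else 0) ≤ 2 * (n * lam.real (blk m ⁻¹' {s})))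
    {U : Fin (m+1) → Fin (m+1) → ℝ} (hU : ∀ a b, 0 ≤ U a b ∧ U a b ≤ K) {e η : ℝ}
    (he : ∫ p : ℝ × ℝ, |κ p.1 p.2 - U (blk m p.1) (blk m p.2)| ∂(lam.prod lam) ≤ e)
    (hE : E1 (fun x y => κn x y - U (blk m (φ x)) (blk m (φ y))) η X)
    {f g : Fin n → ℝ} (hf : ∀ i, 0 ≤ f i ∧ f i ≤ 1) (hg : ∀ i, 0 ≤ g i ∧ g i ≤ 1) :
    n^2 * ∫ x, Fd m (fun i => φ (X i)) f x * TT κ (Fd m (fun i => φ (X i)) g) x ∂lam ≤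
      ∑ i, ∑ j, κn (X i) (X j) * (f i * g j) + (η + 4 * e) * n^2 := by
  set y : Fin n → ℝ := fun i => φ (X i)
  set F := Fd m y f
  set G := Fd m y g
  have Fm : Measurable F := Fd_meas _ _ _
  have Gm : Measurable G := Fd_meas _ _ _
  have F2 : ∀ x, 0 ≤ F x ∧ F x ≤ 2 := Fd_02 n0 hN hf
  have G2 : ∀ x, 0 ≤ G x ∧ G x ≤ 2 := Fd_02 n0 hN hg
  have Ga : ∀ x, |G x| ≤ 2 := fun x => by rw [abs_of_nonneg (G2 x).1]; exact (G2 x).2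
  have mU : Measurable (fun p : ℝ × ℝ => U (blk m p.1) (blk m p.2)) := by
    have : Measurable (fun q : Fin (m+1) × Fin (m+1) => U q.1 q.2) := measurable_of_finite _
    exact this.comp (((blk_meas m).comp measurable_fst).prodMk ((blk_meas m).comp measurable_snd))
  have iD : Integrable (fun p : ℝ × ℝ => |κ p.1 p.2 - U (blk m p.1) (blk m p.2)|) (lam.prod lam) := by
    refine (bint (hk.meas.sub mU) (K+K) ?_).abs
    intro p; exact (abs_sub _ _).trans (add_le_add (hk.abs _ _) (by
        rw [abs_of_nonneg (hU _ _).1]; exact (hU _ _).2))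
  have bUG : ∀ a z, |U a (blk m z) * G z| ≤ K * 2 := fun a z => by
    rw [abs_mul, abs_of_nonneg (hU _ _).1]
    exact mul_le_mul (hU _ _).2 (Ga z) (abs_nonneg _) hk.K0
  have iUG : ∀ a, Integrable (fun z => U a (blk m z) * G z) lam := fun a => bint ((blk_m (U a)).mul Gm) _ (bUG a)
  set d : ℝ → ℝ := fun x => ∫ z, |κ x z - U (blk m x) (blk m z)| ∂lam
  set u : Fin (m+1) → ℝ := fun a => ∫ z, U a (blk m z) * G z ∂lam
  have hd : ∫ x, d x ∂lam ≤ e := by rwa [integral_prod _ iD] at he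
  have hT : ∀ x, TT κ G x ≤ u (blk m x) + 2 * d x := by
    intro x
    have i1 : Integrable (fun z => |κ x z - U (blk m x) (blk m z)|) lam := by
      refine (bint ((hk.m1 x).sub (blk_m (U (blk m x)))) (K+K) ?_).abs
      intro p; exact (abs_sub _ _).trans (add_le_add (hk.abs _ _) (by
        rw [abs_of_nonneg (hU _ _).1]; exact (hU _ _).2))
    simp only [TT, u, d]
    rw [← integral_const_mul, ← integral_add (iUG _) (i1.const_mul 2)]
    refine integral_mono (hk.int Gm 2 Ga x) ((iUG _).add (i1.const_mul 2)) fun z => ?_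
    change κ x z * G z ≤ U (blk m x) (blk m z) * G z + 2 * |κ x z - U (blk m x) (blk m z)|
    have h1 := le_abs_self (κ x z - U (blk m x) (blk m z))
    have h2 := G2 z
    have h3 := abs_nonneg (κ x z - U (blk m x) (blk m z))
    nlinarith [mul_le_mul_of_nonneg_right h1 h2.1, mul_le_mul_of_nonneg_left h2.2 h3]
  have u0 : ∀ a, |u a| ≤ K * 2 := fun a => by
    have := norm_integral_le_of_norm_le_const (μ := lam) (f := fun z => U a (blk m z) * G z) (ae_of_all lam (bUG a))
    simpa using this
  have id : Integrable d lam := iD.integral_prod_left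
  have d0 : ∀ x, 0 ≤ d x := fun x => integral_nonneg fun z => abs_nonneg _
  have iu : Integrable (fun x => u (blk m x) * F x) lam := by
    refine bint ((blk_m u).mul Fm) (K * 2 * 2) fun x => ?_
    rw [abs_mul, abs_of_nonneg (F2 x).1]
    exact mul_le_mul (u0 _) (F2 x).2 (F2 x).1 (by have := hk.K0; positivity)
  have iF : Integrable (fun x => F x * TT κ G x) lam := by
    refine bint (Fm.mul (hk.Tmeas Gm)) (2 * (K * ∫ x, G x ∂lam)) fun x => ?_
    have h0 := hk.Tnn (fun x => (G2 x).1) x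
    rw [abs_mul, abs_of_nonneg (F2 x).1, abs_of_nonneg h0]
    exact mul_le_mul (F2 x).2 (hk.Tle Gm 2 Ga (fun x => (G2 x).1) x) h0 (by norm_num)
  have h1 : ∫ x, F x * TT κ G x ∂lam ≤ ∫ x, u (blk m x) * F x ∂lam + 4 * e := by
    calc _ ≤ ∫ x, (u (blk m x) * F x + 4 * d x) ∂lam := by
          refine integral_mono iF (iu.add (id.const_mul 4)) fun x => ?_
          change F x * TT κ G x ≤ u (blk m x) * F x + 4 * d x
          have h1 := hT x
          have h2 := F2 x
          have h3 := d0 x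
          nlinarith [mul_le_mul_of_nonneg_left h1 h2.1, mul_le_mul_of_nonneg_right h2.2 h3]
      _ = ∫ x, u (blk m x) * F x ∂lam + 4 * ∫ x, d x ∂lam := by
          rw [integral_add iu (id.const_mul 4), integral_const_mul]
      _ ≤ _ := by linarith
  have h2 : (n:ℝ)^2 * ∫ x, u (blk m x) * F x ∂lam = ∑ i, ∑ j, U (blk m (y i)) (blk m (y j)) * (f i * g j) := by
    rw [pow_two, mul_assoc, Fd_int n0 y f u, Finset.mul_sum]
    refine Finset.sum_congr rfl fun i _ => ?_
    rw [← mul_assoc, show (n:ℝ) * u (blk m (y i)) = _ from Fd_int n0 y g (U (blk m (y i))), Finset.sum_mul]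
    exact Finset.sum_congr rfl fun j _ => by ring
  have h3 := (abs_le.1 (hE f g (fun i => by rw [abs_of_nonneg (hf i).1]; exact (hf i).2)
    (fun i => by rw [abs_of_nonneg (hg i).1]; exact (hg i).2))).1
  simp only [sub_mul, Finset.sum_sub_distrib] at h3
  have h4 : (n:ℝ)^2 * ∫ x, F x * TT κ G x ∂lam ≤ (n:ℝ)^2 * (∫ x, u (blk m x) * F x ∂lam + 4 * e) := by gcongr
  rw [mul_add, h2] at h4
  simp only [y] at h4
  linarith

theorem Fd_low {r : ℝ → ℝ} (rm : Measurable r) (r1 : ∀ x, |r x| ≤ 1) {m n : ℕ} (n0 : (0:ℝ) < n) {y f : Fin n → ℝ}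
    {V : Fin (m+1) → ℝ} (hV : ∀ a, |V a| ≤ 1) {e η : ℝ} (η0 : 0 ≤ η) (he : ∫ x, |r x - V (blk m x)| ∂lam ≤ e)
    (hf : ∀ s, n * ∫ x, (if blk m x = s then 1 else 0) * r x ∂lam - η * n ≤ ∑ i, if blk m (y i) = s then f i else 0) :
    ∫ x, max (r x - Fd m y f x) 0 ∂lam ≤ 2 * e + (m+1) * η := by
  set w : ℝ → ℝ := fun x => |r x - V (blk m x)| with hw
  have wi : Integrable w lam := by
    refine (bint (rm.sub (blk_m V)) (1+1) fun x => ?_).abs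
    exact (abs_sub _ _).trans (add_le_add (r1 _) (hV _))
  have om : ∀ s : Fin (m+1), Measurable (fun x => if blk m x = s then (1:ℝ) else 0) := fun s => blk_m (fun a => if a = s then (1:ℝ) else 0)
  have wsi : ∀ s : Fin (m+1), Integrable (fun x => (if blk m x = s then (1:ℝ) else 0) * w x) lam := fun s => by
    refine wi.bdd_mul (c := 1) (om s).aestronglyMeasurable (ae_of_all _ fun x => ?_)
    split_ifs <;> simp
  have rsi : ∀ s : Fin (m+1), Integrable (fun x => (if blk m x = s then (1:ℝ) else 0) * r x) lam := fun s => by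
    refine bint ((om s).mul rm) 1 fun x => ?_
    split_ifs <;> simp [r1 x]
  have vint : ∀ s, ∫ x, (if blk m x = s then (1:ℝ) else 0) * V s ∂lam = lam.real (blk m ⁻¹' {s}) * V s := by
    intro s
    rw [blk_int m (fun a => (if a = s then (1:ℝ) else 0) * V s)]
    simp
  have key : ∀ s, lam.real (blk m ⁻¹' {s}) * max (V s - Fb m y f s) 0 ≤
      ∫ x, (if blk m x = s then (1:ℝ) else 0) * w x ∂lam + η := by
    intro s
    have p := blk_pos m s
    have h0 : 0 ≤ ∫ x, (if blk m x = s then (1:ℝ) else 0) * w x ∂lam :=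
      integral_nonneg fun x => mul_nonneg (by split_ifs <;> norm_num) (abs_nonneg _)
    rw [mul_max_of_nonneg _ _ p.le, mul_zero]
    refine max_le ?_ (by linarith)
    have h1 := hf s
    rw [← Fb_mul n0] at h1
    have h2 : ∫ x, (if blk m x = s then 1 else 0) * r x ∂lam - η ≤ lam.real (blk m ⁻¹' {s}) * Fb m y f s := by
      refine le_of_mul_le_mul_left ?_ n0
      linarith
    have h3 : lam.real (blk m ⁻¹' {s}) * V s ≤ ∫ x, (if blk m x = s then (1:ℝ) else 0) * r x ∂lam +
        ∫ x, (if blk m x = s then (1:ℝ) else 0) * w x ∂lam := by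
      rw [← vint, ← integral_add (rsi s) (wsi s)]
      refine integral_mono (bint ((om s).mul measurable_const) 1 fun x => ?_) ((rsi s).add (wsi s)) fun x => ?_
      · split_ifs <;> simp [hV s]
      · change (if blk m x = s then (1:ℝ) else 0) * V s ≤ (if blk m x = s then (1:ℝ) else 0) * r x + (if blk m x = s then (1:ℝ) else 0) * w x
        split_ifs with hb
        · simp only [hw, hb, one_mul]
          have := neg_abs_le (r x - V s)
          linarith
        · simp
    linarith
  have hb : ∫ x, max (V (blk m x) - Fd m y f x) 0 ∂lam ≤ ∫ x, w x ∂lam + (m+1) * η := by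
    have := blk_int m (fun s => max (V s - Fb m y f s) 0)
    change ∫ x, max (V (blk m x) - Fd m y f x) 0 ∂lam = _ at this
    rw [this]
    calc _ ≤ ∑ s, (∫ x, (if blk m x = s then (1:ℝ) else 0) * w x ∂lam + η) := Finset.sum_le_sum fun s _ => key s
      _ = _ := by
        rw [Finset.sum_add_distrib, ← integral_finsetSum _ fun s _ => wsi s]
        congr 1
        · congr 1; funext x; rw [← Finset.sum_mul]; simp
        · simp
  have mi : Integrable (fun x => max (V (blk m x) - Fd m y f x) 0) lam := by
    have hmm : Measurable (fun x => max (V (blk m x) - Fd m y f x) 0) := blk_m (fun s => max (V s - Fb m y f s) 0)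
    refine bint hmm (∑ s, |max (V s - Fb m y f s) 0|) fun x => ?_
    exact Finset.single_le_sum (f := fun s => |max (V s - Fb m y f s) 0|) (fun s _ => abs_nonneg _) (Finset.mem_univ (blk m x))
  calc _ ≤ ∫ x, (w x + max (V (blk m x) - Fd m y f x) 0) ∂lam := by
        refine integral_mono_of_nonneg (ae_of_all _ fun x => le_max_right _ _) (wi.add mi) (ae_of_all _ fun x => ?_)
        change max (r x - Fd m y f x) 0 ≤ |r x - V (blk m x)| + max (V (blk m x) - Fd m y f x) 0
        have h1 := le_abs_self (r x - V (blk m x))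
        have h2 := le_max_left (V (blk m x) - Fd m y f x) 0
        have h3 := le_max_right (V (blk m x) - Fd m y f x) 0
        have h4 := abs_nonneg (r x - V (blk m x))
        exact max_le (by linarith) (by linarith)
    _ = ∫ x, w x ∂lam + ∫ x, max (V (blk m x) - Fd m y f x) 0 ∂lam := integral_add wi mi
    _ ≤ _ := by linarith

end Percolation
end

open MeasureTheory Filter Topology ProbabilityTheory
noncomputable section
namespace Percolation
set_option linter.unusedSectionVars false

def oL {n : ℕ} (A : Finset (Fin n)) (i : Fin n) : ℝ := if i ∈ A then 1 else 0

theorem oL01 {n : ℕ} (A : Finset (Fin n)) (i : Fin n) : 0 ≤ oL A i ∧ oL A i ≤ 1 := by unfold oL; split_ifs <;> norm_num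

theorem oL_sum {n : ℕ} (A : Finset (Fin n)) : ∑ i, oL A i = A.card := by simp [oL]

theorem oL_sum2 {n : ℕ} (A B : Finset (Fin n)) (w : Fin n → Fin n → ℝ) :
    ∑ i, ∑ j, w i j * (oL A i * oL B j) = ∑ i ∈ A, ∑ j ∈ B, w i j := by
  rw [← Finset.sum_filter_add_sum_filter_not Finset.univ (fun i => i ∈ A)]
  rw [Finset.sum_eq_zero (s := Finset.univ.filter fun i => ¬ i ∈ A), add_zero]
  · refine Finset.sum_congr (by ext; simp) fun i hi => ?_
    simp only [oL, hi, if_true, mul_ite, mul_one, mul_zero]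
    rw [← Finset.sum_filter]
    exact Finset.sum_congr (by ext; simp) fun _ _ => rfl
  · intro i hi
    simp only [Finset.mem_filter, Finset.mem_univ, true_and] at hi
    simp [oL, hi]

structure Tr (κn κ : ℝ → ℝ → ℝ) (r : ℝ → ℝ) {n : ℕ} (X : Fin n → ℝ) (L : Finset (Fin n)) (η : ℝ)
    (F : (Fin n → ℝ) → ℝ → ℝ) : Prop where
  meas : ∀ f, Measurable (F f)
  bd : ∀ f, (∀ i, 0 ≤ f i ∧ f i ≤ 1) → ∀ x, 0 ≤ F f x ∧ F f x ≤ 2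
  int : ∀ f, n * ∫ x, F f x ∂lam = ∑ i, f i
  add : ∀ f g x, F (fun i => f i + g i) x = F f x + F g x
  form : ∀ f g, (∀ i, 0 ≤ f i ∧ f i ≤ 1) → (∀ i, 0 ≤ g i ∧ g i ≤ 1) →
    n^2 * ∫ x, F f x * TT κ (F g) x ∂lam ≤ ∑ i, ∑ j, κn (X i) (X j) * (f i * g j) + η * n^2
  low : ∫ x, max (r x - F (oL L) x) 0 ∂lam ≤ η

section
variable {κs : ℕ → ℝ → ℝ → ℝ} {κ : ℝ → ℝ → ℝ} {K : ℝ} {φ : ℕ → ℝ → ℝ} (hs : Su κs κ K φ)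
include hs

theorem Su.tr {t : ℝ} (t0 : 0 ≤ t) (t1 : t ≤ 1) (h : ℕ) {η : ℝ} (hη : 0 < η) :
    Lk (fun n X u => ∃ F, Tr (κs n) κ (rho (fun x y => t * κ x y)) X (Lh (cfg (fun f => t * pX (κs n) X f) u) h) η F) := by
  intro θ hθ
  have hk := hs.tk t0
  set ζ := min (η/5) (θ/3) with hζ
  have z0 : 0 < ζ := lt_min (by positivity) (by positivity)
  have zη : ζ ≤ η / 5 := min_le_left _ _
  have zθ : ζ ≤ θ / 3 := min_le_right _ _
  obtain ⟨m, ⟨U, hU, hU2, hE1⟩, V, hV, hV2⟩ := ((hs.U z0).and (step1 hk.rmeas hk.r0 hk.r1 z0)).exists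
  have om : ∀ s : Fin (m+1), Measurable (fun x => if blk m x = s then (1:ℝ) else 0) := fun s => blk_m (fun a => if a = s then (1:ℝ) else 0)
  obtain ⟨μ0, hμ0, hμ⟩ : ∃ μ0 > 0, ∀ s, μ0 ≤ lam.real (blk m ⁻¹' {s}) := by
    obtain ⟨s0, h0⟩ := Finite.exists_min (fun s => lam.real (blk m ⁻¹' {s}))
    exact ⟨_, blk_pos m s0, h0⟩
  have hE2 := samp2 hs.hφ (ι := Fin (m+1)) (ψ := fun s x => if blk m x = s then (1:ℝ) else 0) om (C := 1)
    (fun s x => by split_ifs <;> simp) hμ0 z0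
  have hζ1 : 0 < ζ / (m+1) := by positivity
  have hd := Lk.all (Finset.univ : Finset (Fin (m+1))) (fun s => hs.dens t0 t1 h (om s) (fun x => by split_ifs <;> norm_num) hζ1)
  refine ((((LT.ofX z0.le hE1).and (LT.ofX z0.le hE2)).and (hd ζ z0)).le (b := θ) (by linarith)).mono ?_
  filter_upwards [hs.bigK] with n hK
  have n0 := hK.2
  rintro X u ⟨⟨h1, h2⟩, h3⟩
  set y : Fin n → ℝ := fun i => φ n (X i) with hy
  have hN : ∀ s, ∑ i, (if blk m (y i) = s then (1:ℝ) else 0) ≤ 2 * (n * lam.real (blk m ⁻¹' {s})) := by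
    intro s
    have := (abs_le.1 (h2 s)).2
    rw [blk_int m (fun a => if a = s then (1:ℝ) else 0)] at this
    simp only [mul_ite, mul_one, mul_zero, Finset.sum_ite_eq', Finset.mem_univ, if_true] at this
    have h5 : μ0 * n ≤ lam.real (blk m ⁻¹' {s}) * n := by gcongr; exact hμ s
    simp only [hy]
    linarith
  refine ⟨Fd m y, fun f => Fd_meas _ _ _, fun f hf => Fd_02 n0 hN hf, fun f => ?_, Fd_add m y, fun f g hf hg => ?_, ?_⟩
  · have := Fd_int n0 y f (fun _ : Fin (m+1) => (1:ℝ))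
    simpa using this
  · refine (Fd_form hs.k n0 hN hU hU2 h1 hf hg).trans ?_
    have : ζ + 4 * ζ ≤ η := by linarith
    gcongr
  · set L := Lh (cfg (fun f => t * pX (κs n) X f) u) h
    refine (Fd_low hk.rmeas hk.rabs n0 (V := V) (fun a => by rw [abs_of_nonneg (hV a).1]; exact (hV a).2) hζ1.le hV2 ?_).trans ?_
    · intro s
      have h4 := (abs_le.1 (h3 s (Finset.mem_univ s))).1
      have h5 : ∫ x, (if blk m x = s then (1:ℝ) else 0) * rho (fun x y => t * κ x y) x ∂lam ≤
          ∫ x, (if blk m x = s then (1:ℝ) else 0) * qq (fun x y => t * κ x y) h x ∂lam := by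
        obtain ⟨qm, q01⟩ := hk.q01 h
        refine integral_mono (bint ((om s).mul hk.rmeas) 1 fun x => ?_) (bint ((om s).mul qm) 1 fun x => ?_) fun x => ?_
        · split_ifs <;> simp [hk.rabs x]
        · have : |qq (fun x y => t * κ x y) h x| ≤ 1 := by rw [abs_of_nonneg (q01 x).1]; exact (q01 x).2
          split_ifs <;> simp [this]
        · change _ * _ ≤ _ * _
          have := hk.rq h x
          split_ifs <;> simp [this]
      have h6 : (n:ℝ) * ∫ x, (if blk m x = s then (1:ℝ) else 0) * rho (fun x y => t * κ x y) x ∂lam ≤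
          n * ∫ x, (if blk m x = s then (1:ℝ) else 0) * qq (fun x y => t * κ x y) h x ∂lam := by gcongr
      have h7 : ∑ v, (if blk m (φ n (X v)) = s then (1:ℝ) else 0) * (1 - NN (cfg (fun f => t * pX (κs n) X f) u) h v ∅) ≤
          ∑ i, if blk m (y i) = s then oL L i else 0 := by
        refine Finset.sum_le_sum fun v _ => ?_
        simp only [hy]
        split_ifs
        · rw [one_mul]
          rcases NNdi (cfg (fun f => t * pX (κs n) X f) u) h v ∅ with h0 | h0
          · have : v ∈ L := mem_Lh.2 (NN_comp_ge h0)
            rw [h0]; simp [oL, this]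
          · rw [h0, sub_self]; exact (oL01 L v).1
        · simp
      linarith
    · have : ((m:ℝ)+1) * (ζ / (m+1)) = ζ := by field_simp
      rw [this]; linarith

end
end Percolation
end

open MeasureTheory Filter Topology ProbabilityTheory
noncomputable section
namespace Percolation
set_option linter.unusedSectionVars false

section
variable {κn κ : ℝ → ℝ → ℝ} {K : ℝ} (hk : Ker κ K) {r : ℝ → ℝ} (rm : Measurable r) (r1 : ∀ x, 0 ≤ r x ∧ r x ≤ 1) {n : ℕ} (n0 : (0:ℝ) < n)
  {X : Fin n → ℝ} {L : Finset (Fin n)} {η : ℝ} {F : (Fin n → ℝ) → ℝ → ℝ} (hT : Tr κn κ r X L η F)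
include hk rm r1 n0 hT

theorem Tr.Fm (A : Finset (Fin n)) : Measurable (F (oL A)) ∧ (∀ x, 0 ≤ F (oL A) x ∧ F (oL A) x ≤ 2) ∧
    (∀ x, |F (oL A) x| ≤ 2) ∧ n * ∫ x, F (oL A) x ∂lam = A.card ∧ Integrable (F (oL A)) lam := by
  have h := hT.bd _ (oL01 A)
  have h2 : ∀ x, |F (oL A) x| ≤ 2 := fun x => by rw [abs_of_nonneg (h x).1]; exact (h x).2
  exact ⟨hT.meas _, h, h2, by rw [hT.int, oL_sum], bint (hT.meas _) 2 h2⟩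

theorem Tr.dm : Measurable (fun x => max (r x - F (oL L) x) 0) ∧ (∀ x, 0 ≤ max (r x - F (oL L) x) 0 ∧ max (r x - F (oL L) x) 0 ≤ 1) ∧
    Integrable (fun x => max (r x - F (oL L) x) 0) lam := by
  have h := hT.bd _ (oL01 L)
  have hm : Measurable (fun x => max (r x - F (oL L) x) 0) := (rm.sub (hT.meas _)).max measurable_const
  have hb : ∀ x, 0 ≤ max (r x - F (oL L) x) 0 ∧ max (r x - F (oL L) x) 0 ≤ 1 := fun x =>
    ⟨le_max_right _ _, max_le (by linarith [(h x).1, (r1 x).2]) zero_le_one⟩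
  exact ⟨hm, hb, bint hm 1 fun x => by rw [abs_of_nonneg (hb x).1]; exact (hb x).2⟩

theorem Tr.dens : (∫ x, r x ∂lam - η) * n ≤ L.card := by
  obtain ⟨_, _, _, h1, h2⟩ := hT.Fm hk rm r1 n0 L
  obtain ⟨_, _, h3⟩ := hT.dm hk rm r1 n0
  have : ∫ x, r x ∂lam ≤ ∫ x, F (oL L) x ∂lam + ∫ x, max (r x - F (oL L) x) 0 ∂lam := by
    rw [← integral_add h2 h3]
    refine integral_mono (bint rm 1 fun x => by rw [abs_of_nonneg (r1 x).1]; exact (r1 x).2) (h2.add h3) fun x => ?_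
    change r x ≤ F (oL L) x + max (r x - F (oL L) x) 0
    linarith [le_max_left (r x - F (oL L) x) 0]
  have h4 := hT.low
  rw [← h1, mul_comm]
  gcongr
  linarith

theorem Tr.TF (A : Finset (Fin n)) (x : ℝ) : 0 ≤ TT κ (F (oL A)) x ∧ TT κ (F (oL A)) x ≤ 2 * K := by
  obtain ⟨g1, g2, g3, g4, g5⟩ := hT.Fm hk rm r1 n0 A
  refine ⟨hk.Tnn (fun x => (g2 x).1) x, (hk.Tle g1 2 g3 (fun x => (g2 x).1) x).trans ?_⟩
  have : ∫ x, F (oL A) x ∂lam ≤ ∫ x, 2 ∂lam := integral_mono g5 (integrable_const _) fun x => (g2 x).2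
  rw [integral_const, probReal_univ, one_smul] at this
  have := hk.K0
  nlinarith

theorem Tr.iFT (A B : Finset (Fin n)) : Integrable (fun x => F (oL A) x * TT κ (F (oL B)) x) lam := by
  obtain ⟨f1, f2, f3, f4, f5⟩ := hT.Fm hk rm r1 n0 A
  obtain ⟨g1, g2, g3, g4, g5⟩ := hT.Fm hk rm r1 n0 B
  refine bint (f1.mul (hk.Tmeas g1)) (2 * (2 * K)) fun x => ?_
  have h := hT.TF hk rm r1 n0 B x
  rw [abs_mul, abs_of_nonneg h.1]
  exact mul_le_mul (f3 x) h.2 h.1 (by norm_num)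

theorem Tr.frm (A B : Finset (Fin n)) :
    n^2 * ∫ x, F (oL A) x * TT κ (F (oL B)) x ∂lam ≤ ∑ i ∈ A, ∑ j ∈ B, κn (X i) (X j) + η * n^2 := by
  have := hT.form (oL A) (oL B) (oL01 A) (oL01 B)
  rwa [oL_sum2 A B (fun i j => κn (X i) (X j))] at this

theorem Tr.cut {δ b : ℝ} (hb : ∀ F G : ℝ → ℝ, Measurable F → Measurable G →
      (∀ x, 0 ≤ F x) → (∀ x, 0 ≤ G x) → (∀ x, F x ≤ 3) → (∀ x, G x ≤ 3) →
      δ ≤ ∫ x, F x ∂lam → δ ≤ ∫ x, G x ∂lam → (∀ᵐ x ∂lam, r x ≤ F x + G x) →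
      b ≤ ∫ x, F x * TT κ G x ∂lam) (A : Finset (Fin n)) (h1 : δ * n ≤ (A ∩ L).card) (h2 : δ * n ≤ (L \ A).card) :
    (b - (2 * K + 1) * η) * n^2 ≤ ∑ i ∈ A ∩ L, ∑ j ∈ L \ A, κn (X i) (X j) := by
  obtain ⟨f1, f2, f3, f4, f5⟩ := hT.Fm hk rm r1 n0 (A ∩ L)
  obtain ⟨g1, g2, g3, g4, g5⟩ := hT.Fm hk rm r1 n0 (L \ A)
  obtain ⟨d1, d2, d3⟩ := hT.dm hk rm r1 n0
  set f := F (oL (A ∩ L))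
  set g := F (oL (L \ A))
  have e : ∀ x, F (oL L) x = f x + g x := fun x => by
    rw [← hT.add]; congr 1; funext i
    by_cases hA : i ∈ A <;> by_cases hL : i ∈ L <;> simp [oL, hA, hL]
  set d := fun x => max (r x - F (oL L) x) 0 with hd
  have hbb := hb (fun x => f x + d x) g (f1.add d1) g1 (fun x => add_nonneg (f2 x).1 (d2 x).1) (fun x => (g2 x).1)
    (fun x => by linarith [(f2 x).2, (d2 x).2]) (fun x => by linarith [(g2 x).2]) (by
      rw [integral_add f5 d3]
      have h3 : 0 ≤ ∫ x, d x ∂lam := integral_nonneg fun x => (d2 x).1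
      have h4 : δ ≤ ∫ x, f x ∂lam := le_of_mul_le_mul_left (by rw [f4]; linarith) n0
      linarith) (le_of_mul_le_mul_left (by rw [g4]; linarith) n0) (ae_of_all _ fun x => by
        have h3 := le_max_left (r x - F (oL L) x) 0
        have h4 := e x
        simp only [hd]
        linarith)
  have h3 := hT.frm hk rm r1 n0 (A ∩ L) (L \ A)
  have h4 : b ≤ ∫ x, f x * TT κ g x ∂lam + 2 * K * η := by
    refine hbb.trans ?_
    have iF := hT.iFT hk rm r1 n0 (A ∩ L) (L \ A)
    calc _ ≤ ∫ x, (f x * TT κ g x + 2 * K * d x) ∂lam := by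
          refine integral_mono_of_nonneg (ae_of_all _ fun x => mul_nonneg (add_nonneg (f2 x).1 (d2 x).1)
            (hT.TF hk rm r1 n0 (L \ A) x).1) (iF.add (d3.const_mul (2 * K))) (ae_of_all _ fun x => ?_)
          change (f x + d x) * TT κ g x ≤ f x * TT κ g x + 2 * K * d x
          have := mul_le_mul_of_nonneg_left (hT.TF hk rm r1 n0 (L \ A) x).2 (d2 x).1
          change d x * TT κ g x ≤ d x * (2 * K) at this
          linarith
      _ = ∫ x, f x * TT κ g x ∂lam + 2 * K * ∫ x, d x ∂lam := by
          rw [integral_add iF (d3.const_mul (2 * K)), integral_const_mul]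
      _ ≤ _ := by
          have := hT.low
          have := hk.K0
          gcongr
  have h5 : (b - 2 * K * η) * (n:ℝ)^2 ≤ n^2 * ∫ x, f x * TT κ g x ∂lam := by
    rw [mul_comm]; gcongr; linarith
  linarith

theorem Tr.self (η0 : 0 ≤ η) : (∫ x, r x * TT κ r x ∂lam - (3 * K + 1) * η) * n^2 ≤ ∑ i ∈ L, ∑ j ∈ L, κn (X i) (X j) := by
  obtain ⟨f1, f2, f3, f4, f5⟩ := hT.Fm hk rm r1 n0 L
  obtain ⟨d1, d2, d3⟩ := hT.dm hk rm r1 n0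
  have h3 := hT.frm hk rm r1 n0 L L
  set f := F (oL L)
  set d := fun x => max (r x - f x) 0 with hd
  have rf : ∀ x, r x ≤ f x + d x := fun x => by
    have h3 := le_max_left (r x - f x) 0
    simp only [hd]
    linarith
  have K0 := hk.K0
  have ra : ∀ x, |r x| ≤ 3 := fun x => by rw [abs_of_nonneg (r1 x).1]; linarith [(r1 x).2]
  have da : ∀ x, |d x| ≤ 1 := fun x => by rw [abs_of_nonneg (d2 x).1]; exact (d2 x).2
  have h1 : ∀ x, TT κ r x ≤ TT κ f x + K * η := fun x => by
    have h2 : TT κ r x ≤ TT κ (fun x => f x + d x) x := hk.Tmono rm (f1.add d1) 3 ra (fun x => by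
      change |f x + d x| ≤ 3
      rw [abs_of_nonneg (add_nonneg (f2 x).1 (d2 x).1)]; linarith [(f2 x).2, (d2 x).2]) (ae_of_all _ rf) x
    have h4 : TT κ (fun x => f x + d x) x = TT κ f x + TT κ d x := by
      simp only [TT, mul_add]
      exact integral_add (hk.int f1 2 f3 x) (hk.int d1 1 da x)
    have h5 := hk.Tle d1 1 da (fun x => (d2 x).1) x
    have h6 : K * ∫ x, d x ∂lam ≤ K * η := by gcongr; exact hT.low
    linarith
  have iF := hT.iFT hk rm r1 n0 L L
  have h4 : ∫ x, r x * TT κ r x ∂lam ≤ ∫ x, f x * TT κ f x ∂lam + 2 * K * η + K * η := by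
    calc _ ≤ ∫ x, (f x * TT κ f x + 2 * K * d x + K * η) ∂lam := by
          refine integral_mono_of_nonneg (ae_of_all _ fun x => mul_nonneg (r1 x).1 (hk.Tnn (fun x => (r1 x).1) x))
            ((iF.add (d3.const_mul (2 * K))).add (integrable_const _)) (ae_of_all _ fun x => ?_)
          change r x * TT κ r x ≤ f x * TT κ f x + 2 * K * d x + K * η
          have t := hT.TF hk rm r1 n0 L x
          have a1 := mul_le_mul_of_nonneg_left (h1 x) (r1 x).1
          have a2 : r x * (K * η) ≤ K * η := mul_le_of_le_one_left (by positivity) (r1 x).2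
          have a3 : r x * TT κ f x ≤ (f x + d x) * TT κ f x := mul_le_mul_of_nonneg_right (rf x) t.1
          have a4 : d x * TT κ f x ≤ d x * (2 * K) := mul_le_mul_of_nonneg_left t.2 (d2 x).1
          linarith
      _ = ∫ x, f x * TT κ f x ∂lam + 2 * K * ∫ x, d x ∂lam + K * η := by
          have i2 : Integrable (fun x => f x * TT κ f x + 2 * K * d x) lam := iF.add (d3.const_mul (2 * K))
          rw [integral_add i2 (integrable_const _), integral_add iF (d3.const_mul (2 * K)), integral_const_mul]
          simp; rfl
      _ ≤ _ := by
          have := hT.low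
          gcongr
  have h5 : (∫ x, r x * TT κ r x ∂lam - 3 * K * η) * (n:ℝ)^2 ≤ n^2 * ∫ x, f x * TT κ f x ∂lam := by
    rw [mul_comm]; gcongr; linarith
  linarith

end
end Percolation
end

open MeasureTheory Filter Topology ProbabilityTheory
noncomputable section
namespace Percolation
set_option linter.unusedSectionVars false

section
variable {κs : ℕ → ℝ → ℝ → ℝ} {κ : ℝ → ℝ → ℝ} {K : ℝ} {φ : ℕ → ℝ → ℝ} (hs : Su κs κ K φ)
include hs

theorem Su.spr {t : ℝ} (t0 : 0 ≤ t) (t1 : t ≤ 1) {h : ℕ} {b : ℝ} (hb : 1 / ((h:ℝ)+1) < (1 - t) * b) :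
    Lk (fun n X u => ∀ A : Finset (Fin n), Cl (graphOf (cfg (pX (κs n) X) u)) A →
      ∑ i ∈ A ∩ Lh (cfg (fun f => t * pX (κs n) X f) u) h, ∑ j ∈ Lh (cfg (fun f => t * pX (κs n) X f) u) h \ A,
        pX (κs n) X s(i, j) < b * n) := by
  intro θ hθ
  refine LT.ofU hθ.le ?_
  have hlim : Tendsto (fun n : ℕ => Real.exp (-(((1 - t) * b - 1 / ((h:ℝ)+1)) * n))) atTop (𝓝 0) :=
    Real.tendsto_exp_neg_atTop_nhds_zero.comp (tendsto_natCast_atTop_atTop.const_mul_atTop (sub_pos.2 hb))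
  filter_upwards [hlim.eventually (gt_mem_nhds hθ)] with n h1 X
  have h2 := spr_count ((hs.ks n).pX_PP X) t0 t1 h (b * n)
  rw [← Real.exp_add, Fintype.card_fin] at h2
  refine (measureReal_mono ?_ (measure_ne_top _ _)).trans (h2.trans (le_trans (le_of_eq ?_) h1.le))
  · intro u hu
    change ¬ ∀ A, _ at hu
    push Not at hu
    exact hu
  · congr 1; field_simp; ring

theorem Su.pXsum {n : ℕ} (hn : K ≤ n) (n0 : (0:ℝ) < n) (X : Fin n → ℝ) (A B : Finset (Fin n)) {a : ℝ}
    (h : a * (n:ℝ)^2 ≤ ∑ i ∈ A, ∑ j ∈ B, κs n (X i) (X j)) : a * n ≤ ∑ i ∈ A, ∑ j ∈ B, pX (κs n) X s(i, j) := by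
  simp only [(hs.ks n).pX_n hn X, ← Finset.sum_div]
  rw [le_div_iff₀ n0]
  linarith

theorem Su.hsmall {b t : ℝ} (hb : 0 < b) (t1 : t < 1) : ∃ h : ℕ, 1 / ((h:ℝ)+1) < (1 - t) * b :=
  exists_nat_one_div_lt (mul_pos (sub_pos.2 t1) hb)

theorem Su.LBb {t : ℝ} (t0 : 0 ≤ t) (t1 : t < 1) (hr : 0 < ∫ x, rho (fun x y => t * κ x y) x ∂lam) :
    ∃ δ > 0, Lk (fun n X u => δ * n ≤ (C1 (graphOf (cfg (pX (κs n) X) u)) : ℝ)) := by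
  have hk := hs.tk t0
  have K0 := hs.K0
  set r := rho (fun x y => t * κ x y) with hrr
  set a := ∫ x, r x ∂lam with ha
  have ir : Integrable r lam := bint hk.rmeas 1 hk.rabs
  have hw : a^2 ≤ ∫ x, r x * TT κ r x ∂lam := by
    have h1 : ∫ x, (2 * a * r x - a^2) ∂lam = a^2 := by
      rw [integral_sub (ir.const_mul _) (integrable_const _), integral_const_mul, integral_const, probReal_univ]
      simp only [one_smul, ← ha]; ring
    rw [← h1]
    refine integral_mono ((ir.const_mul _).sub (integrable_const _)) (bint (hk.rmeas.mul (hs.k.Tmeas hk.rmeas)) (1 * (K * a)) fun x => ?_) fun x => ?_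
    · have h0 := hs.k.Tnn hk.r0 x
      rw [abs_mul, abs_of_nonneg h0]
      exact mul_le_mul (hk.rabs x) (hs.k.Tle hk.rmeas 1 hk.rabs hk.r0 x) h0 zero_le_one
    · change 2 * a * r x - a^2 ≤ r x * TT κ r x
      have h0 := hs.k.Tnn hk.r0 x
      have h2 := hk.rT x
      rw [TT_smul] at h2
      have h3 : r x ≤ TT κ r x := h2.trans (mul_le_of_le_one_left h0 t1.le)
      have h4 := mul_le_mul_of_nonneg_left h3 (hk.r0 x)
      nlinarith [sq_nonneg (r x - a)]
  set w := a^2 / 2 with hwd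
  have w0 : 0 < w := by positivity
  set η := a^2 / (2 * (3 * K + 1)) with hη
  have η0 : 0 < η := by positivity
  have eη : (3 * K + 1) * η = a^2 / 2 := by rw [hη]; field_simp
  obtain ⟨h, hh⟩ := hs.hsmall (show 0 < w / 8 by positivity) t1
  refine ⟨w / (4 * K), by positivity, ((hs.tr t0 t1.le h η0).and (hs.spr t0 t1.le hh)).mono ?_⟩
  filter_upwards [hs.bigK] with n hK X u
  rintro ⟨⟨F, hT⟩, h2⟩
  have n0 := hK.2
  have h3 := hT.self hs.k hk.rmeas (fun x => ⟨hk.r0 x, hk.r1 x⟩) n0 η0.le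
  set L := Lh (cfg (fun f => t * pX (κs n) X f) u) h
  have h4 : w * n ≤ ∑ i ∈ L, ∑ j ∈ L, pX (κs n) X s(i, j) := by
    refine hs.pXsum hK.1 n0 X L L (le_trans ?_ h3)
    gcongr
    rw [eη]; linarith
  set G := graphOf (cfg (pX (κs n) X) u)
  by_contra hc
  have hc := not_le.1 hc
  have pp := (hs.ks n).pX_PP X
  have h5 := cut_avg (G := G) (L := L) (fun i j => pX (κs n) X s(i, j)) (fun i j => pp.nn _) (fun A hA => (h2 A hA).le)
  have h6 : ∀ i, ∑ j with rep G j = rep G i, pX (κs n) X s(i, j) ≤ w / 4 := by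
    intro i
    calc _ ≤ ∑ j with rep G j = rep G i, K / n := Finset.sum_le_sum fun j _ => pp.le _
      _ = compSize G i * (K / n) := by rw [Finset.sum_const, nsmul_eq_mul, compSize_eq]
      _ ≤ (w / (4 * K) * n) * (K / n) := by
          gcongr
          exact le_trans (by exact_mod_cast le_C1 G i) hc.le
      _ = _ := by field_simp
  have h7 : ∑ i, ∑ j with rep G j = rep G i, pX (κs n) X s(i, j) ≤ n * (w / 4) :=
    (Finset.sum_le_sum fun i _ => h6 i).trans (by simp)
  nlinarith

end

section
variable {κs : ℕ → ℝ → ℝ → ℝ} {W : ℝ → ℝ → ℝ} {c M K : ℝ} {φ : ℕ → ℝ → ℝ} (hW : Ker W M) (hi : Irreducible W) (hc : 0 < c)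
  (hs : Su κs (fun x y => c * W x y) K φ)
include hW hi hc hs

theorem Su.LBc {η : ℝ} (hη : 0 < η) :
    Lk (fun n X u => (∫ x, rho (fun x y => c * W x y) x ∂lam - η) * n ≤ (C1 (graphOf (cfg (pX (κs n) X) u)) : ℝ)) := by
  set κ := fun x y => c * W x y with hκ
  by_cases hR : ∫ x, rho κ x ∂lam - η ≤ 0
  · intro θ hθ
    refine (LT.ofU hθ.le (Q := fun _ _ _ => True) (Eventually.of_forall fun n X => by simpa using hθ.le)).mono
      (Eventually.of_forall fun n X u _ => ?_)
    exact (mul_nonpos_of_nonpos_of_nonneg hR (by positivity)).trans (by positivity)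
  push Not at hR
  have h1 : 1 < c * opNorm W := by
    by_contra h
    have := rho_zero hW hc (not_lt.1 h)
    simp only [hκ] at hR
    linarith
  obtain ⟨t, t0, t1, ht, hr⟩ := rho_cont hW hi hc h1 (half_pos hη)
  have e : (fun x y => t * c * W x y) = fun x y => t * κ x y := by funext x y; simp only [hκ]; ring
  rw [e] at hr
  change ∫ x, rho κ x ∂lam - η/2 ≤ _ at hr
  have hk := hs.tk t0.le
  have K0 := hs.K0
  set r := rho (fun x y => t * κ x y) with hrr
  have rp : ∀ᵐ x ∂lam, 0 < r x := by
    refine pos_ae hW hi (c := t * c) (by positivity) hk.rmeas hk.r0 hk.r1 (fun x => ?_) (by linarith)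
    have := hk.req x
    rwa [TT_smul, TT_smul, ← mul_assoc] at this
  obtain ⟨b0, hb0, hb⟩ := cut_lemma hW hi hk.rmeas hk.rabs rp (show 0 < η/16 by positivity) 3
  set b := c * b0 with hbd
  have bp : 0 < b := by positivity
  set ζ := min (η/4) (b / (2 * (2 * K + 1))) with hζ
  have ζ0 : 0 < ζ := lt_min (by positivity) (by positivity)
  have z1 : ζ ≤ η/4 := min_le_left _ _
  have z2 : (2 * K + 1) * ζ ≤ b/2 := by
    calc _ ≤ (2 * K + 1) * (b / (2 * (2 * K + 1))) := by gcongr; exact min_le_right _ _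
      _ = _ := by field_simp
  obtain ⟨h, hh⟩ := hs.hsmall (show 0 < b / 2 by positivity) t1
  refine ((hs.tr t0.le t1.le h ζ0).and (hs.spr t0.le t1.le hh)).mono ?_
  filter_upwards [hs.bigK] with n hK X u
  rintro ⟨⟨F, hT⟩, h2⟩
  have n0 := hK.2
  have hd := hT.dens hs.k hk.rmeas (fun x => ⟨hk.r0 x, hk.r1 x⟩) n0
  set L := Lh (cfg (fun f => t * pX (κs n) X f) u) h
  have hd2 : (∫ x, rho κ x ∂lam - 3 * η / 4) * n ≤ L.card := by
    refine le_trans (mul_le_mul_of_nonneg_right ?_ n0.le) hd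
    change _ ≤ ∫ x, r x ∂lam - ζ
    linarith
  have hd3 : (η / 4) * n ≤ (∫ x, rho κ x ∂lam - 3 * η / 4) * n := by
    gcongr
    linarith
  have pη : 0 < η * n := by positivity
  obtain ⟨v, hv⟩ := big_comp (G := graphOf (cfg (pX (κs n) X) u)) (L := L) (d := η / 16 * n) (by linarith) (by linarith) (by
    intro A hA
    by_contra hcon
    push Not at hcon
    have h3 := hT.cut hs.k hk.rmeas (fun x => ⟨hk.r0 x, hk.r1 x⟩) n0 (δ := η/16) (b := b) (by
      intro f g m1 m2 a1 a2 a3 a4 a5 a6 a7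
      have := hb f g m1 m2 a1 a2 a3 a4 a5 a6 a7
      simp only [hκ, TT_smul, mul_left_comm _ c, integral_const_mul, hbd]
      gcongr) A hcon.1 hcon.2
    have h4 := hs.pXsum hK.1 n0 X _ _ h3
    have h5 : b / 2 * n ≤ (b - (2 * K + 1) * ζ) * n := by gcongr; linarith
    exact absurd (h5.trans h4) (not_le.2 (h2 A hA)))
  have : (compSize (graphOf (cfg (pX (κs n) X) u)) v : ℝ) ≤ C1 (graphOf (cfg (pX (κs n) X) u)) := by exact_mod_cast le_C1 _ v
  linarith

end
end Percolation
end

open MeasureTheory Filter Topology ProbabilityTheory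
noncomputable section
namespace Percolation
set_option linter.unusedSectionVars false

section
variable {k : ℝ → ℝ → ℝ} {K : ℝ} (hk : Ker k K)
include hk

theorem Ker.gnw {n : ℕ} (ω : (Fin n → ℝ) × (Sym2 (Fin n) → ℝ)) : gnwGraph k ω = graphOf (cfg (pX k ω.1) ω.2) := by
  unfold gnwGraph graphOf cfg
  simp only [hk.pX_s, decide_eq_true_eq]

theorem Ker.gmeas {n : ℕ} (P : SimpleGraph (Fin n) → Prop) : MeasurableSet {ω | P (gnwGraph k ω)} := by
  have hp : ∀ f, Measurable (fun X : Fin n → ℝ => pX k X f) := by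
    intro f
    induction f using Sym2.ind with | _ i j => ?_
    simp only [hk.pX_s]
    have h2 : Measurable (fun X : Fin n → ℝ => (X i, X j)) := (measurable_pi_apply i).prodMk (measurable_pi_apply j)
    have h3 : Measurable (fun X : Fin n → ℝ => k (X i) (X j)) := hk.meas.comp h2
    exact (h3.div_const _).min measurable_const
  have hc : Measurable (fun ω : (Fin n → ℝ) × (Sym2 (Fin n) → ℝ) => cfg (pX k ω.1) ω.2) := by
    refine measurable_pi_iff.2 fun f => ?_
    refine measurable_to_bool ?_
    have : (fun ω : (Fin n → ℝ) × (Sym2 (Fin n) → ℝ) => cfg (pX k ω.1) ω.2 f) ⁻¹' {true} = {ω | ω.2 f < pX k ω.1 f} := by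
      ext ω; simp [cfg]
    rw [this]
    exact measurableSet_lt ((measurable_pi_apply f).comp measurable_snd) ((hp f).comp measurable_fst)
  have : {ω | P (gnwGraph k ω)} = (fun ω : (Fin n → ℝ) × (Sym2 (Fin n) → ℝ) => cfg (pX k ω.1) ω.2) ⁻¹' {g | P (graphOf g)} := by
    ext ω
    change P (gnwGraph k ω) ↔ P _
    rw [hk.gnw]
  rw [this]
  exact hc (Set.toFinite _).measurableSet

end

theorem gnw_eq (n : ℕ) : gnwMeasure n = (PX n).prod (PL (Fin n)) := rfl

instance gnw_prob (n : ℕ) : IsProbabilityMeasure (gnwMeasure n) := by rw [gnw_eq]; infer_instance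

section
variable {κs : ℕ → ℝ → ℝ → ℝ} {κ : ℝ → ℝ → ℝ} {K : ℝ} {φ : ℕ → ℝ → ℝ} (hs : Su κs κ K φ)
include hs

theorem Su.fin (E : ∀ n, SimpleGraph (Fin n) → Prop) (h : Lk (fun n X u => ¬ E n (graphOf (cfg (pX (κs n) X) u)))) :
    Tendsto (fun n : ℕ => gnwMeasure n {ω | E n (gnwGraph (κs n) ω)}) atTop (𝓝 0) := by
  rw [ENNReal.tendsto_nhds_zero]
  intro ε hε
  obtain ⟨θ, hθ, hθε⟩ : ∃ θ : ℝ, 0 < θ ∧ ENNReal.ofReal (θ + θ) ≤ ε := by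
    have h1 : min ε 1 ≠ ⊤ := (min_le_right _ _).trans_lt ENNReal.one_lt_top |>.ne
    have h2 : 0 < (min ε 1).toReal := ENNReal.toReal_pos (lt_min hε one_pos).ne' h1
    refine ⟨_, half_pos h2, ?_⟩
    rw [add_halves, ENNReal.ofReal_toReal h1]
    exact min_le_left _ _
  filter_upwards [h θ hθ] with n hn
  refine le_trans ?_ hθε
  rw [gnw_eq, Measure.prod_apply ((hs.ks n).gmeas (E n))]
  set B := {X | ¬ (PL (Fin n)).real {u | ¬ ¬ E n (graphOf (cfg (pX (κs n) X) u))} ≤ θ}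
  have hB : PX n (toMeasurable (PX n) B) ≤ ENNReal.ofReal θ := by
    rw [measure_toMeasurable, ← ofReal_measureReal]
    exact ENNReal.ofReal_le_ofReal hn
  calc _ ≤ ∫⁻ X, (ENNReal.ofReal θ + (toMeasurable (PX n) B).indicator 1 X) ∂(PX n) := by
        refine lintegral_mono fun X => ?_
        have e : Prod.mk X ⁻¹' {ω | E n (gnwGraph (κs n) ω)} = {u | ¬ ¬ E n (graphOf (cfg (pX (κs n) X) u))} := by
          ext u
          change E n (gnwGraph (κs n) (X, u)) ↔ ¬ ¬ _
          rw [(hs.ks n).gnw, not_not]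
        rw [e]
        by_cases hX : X ∈ B
        · have : X ∈ toMeasurable (PX n) B := subset_toMeasurable _ _ hX
          simp only [this, Set.indicator_of_mem, Pi.one_apply]
          exact prob_le_one.trans le_add_self
        · refine le_trans ?_ le_self_add
          rw [← ofReal_measureReal]
          exact ENNReal.ofReal_le_ofReal (not_not.1 hX)
    _ = ENNReal.ofReal θ + PX n (toMeasurable (PX n) B) := by
        rw [lintegral_add_left measurable_const, lintegral_const, measure_univ, mul_one,
          lintegral_indicator_one (measurableSet_toMeasurable _ _)]
    _ ≤ _ := by
        rw [ENNReal.ofReal_add hθ.le hθ.le]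
        gcongr

end

theorem mkSu {Wseq : ℕ → ℝ → ℝ → ℝ} {W : ℝ → ℝ → ℝ} {M c : ℝ} (hS : ∀ n, Ker (Wseq n) M) (hW : Ker W M) (hc : 0 < c) (M0 : 0 < M)
    (hconv : Tendsto (fun n => cutDist (Wseq n) W) atTop (𝓝 0)) :
    ∃ φ, Su (fun n x y => c * Wseq n x y) (fun x y => c * W x y) (c * M) φ := by
  obtain ⟨φ, ε, hφ, ht, hε⟩ := exists_phi hS hW hconv
  exact ⟨φ, fun n => (hS n).smul hc.le, hW.smul hc.le, by positivity, hφ,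
    fun m U hU e0 η h1 h2 h3 => samp1 hS hW hc hφ ht hε M0 hU h1 h2 h3⟩

theorem mainThm
    (Wseq : ℕ → ℝ → ℝ → ℝ) (hWseq : ∀ n, IsGraphon (Wseq n))
    (M : ℝ) (hM : ∀ n x y, Wseq n x y ≤ M)
    (W : ℝ → ℝ → ℝ) (hW : IsGraphon W)
    (hconv : Tendsto (fun n => cutDist (Wseq n) W) atTop (nhds 0))
    (c : ℝ) (hc : 0 < c) :
    (c * opNorm W ≤ 1 →
      ∀ ε > 0, Tendsto
        (fun n : ℕ => gnwMeasure n
          {ω | ε * n ≤ (C1 (gnwGraph (fun x y => c * Wseq n x y) ω) : ℝ)})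
        atTop (nhds 0)) ∧
    (1 < c * opNorm W →
      ∃ δ : ℝ, 0 < δ ∧ Tendsto
        (fun n : ℕ => gnwMeasure n
          {ω | δ * n ≤ (C1 (gnwGraph (fun x y => c * Wseq n x y) ω) : ℝ)})
        atTop (nhds 1)) ∧
    (Percolation.Irreducible W →
      (∀ ε > 0, Tendsto
        (fun n : ℕ => gnwMeasure n
          {ω | ε ≤ |(C1 (gnwGraph (fun x y => c * Wseq n x y) ω) : ℝ) / n -
            survival fun x y => c * W x y|})
        atTop (nhds 0)) ∧
      (∀ ε > 0, Tendsto
        (fun n : ℕ => gnwMeasure n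
          {ω | ε * n ≤ (C2 (gnwGraph (fun x y => c * Wseq n x y) ω) : ℝ)})
        atTop (nhds 0))) := by
  obtain ⟨wm, w0, ws, M1, w1⟩ := hW
  set M' := max (max M M1) 1
  have hkW : Ker W M' := ⟨wm, w0, ws, fun x y => (w1 x y).trans ((le_max_right _ _).trans (le_max_left _ _))⟩
  have hkS : ∀ n, Ker (Wseq n) M' := fun n => ⟨(hWseq n).1, (hWseq n).2.1, (hWseq n).2.2.1,
    fun x y => (hM n x y).trans ((le_max_left _ _).trans (le_max_left _ _))⟩
  obtain ⟨φ, hs⟩ := mkSu hkS hkW hc (lt_of_lt_of_le one_pos (le_max_right _ _)) hconv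
  have hR0 : 0 ≤ ∫ x, rho (fun x y => c * W x y) x ∂lam := integral_nonneg hs.k.r0
  refine ⟨fun h ε hε => ?_, fun h => ?_, fun hi => ⟨fun ε hε => ?_, fun ε hε => ?_⟩⟩
  · refine hs.fin (fun n G => ε * n ≤ (C1 G : ℝ)) ((hs.UB hε (half_pos hε)).mono ?_)
    filter_upwards [hs.bigK] with n hK X u h1 h2
    have n0 := hK.2
    have : Nonempty (Fin n) := ⟨⟨0, by exact_mod_cast n0⟩⟩
    have h3 := C1_Bg h2
    rw [rho_zero hkW hc h] at h1
    have : 0 < ε * n := by positivity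
    linarith
  · obtain ⟨t, ht1, ht2⟩ := exists_between (show 1 / (c * opNorm W) < 1 by rw [div_lt_one (by linarith)]; exact h)
    have t0 : 0 < t := lt_trans (by have : 0 < c * opNorm W := by linarith
                                    positivity) ht1
    rw [div_lt_iff₀ (by linarith), ← mul_assoc] at ht1
    have hp := rho_pos hkW (c := t * c) (by positivity) ht1
    simp only [mul_assoc] at hp
    obtain ⟨δ, hδ, hL⟩ := hs.LBb t0.le ht2 hp
    refine ⟨δ, hδ, ?_⟩
    have h0 := hs.fin (fun n G => ¬ δ * n ≤ (C1 G : ℝ)) (hL.mono (Eventually.of_forall fun n X u h1 h2 => h2 h1))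
    have h1 : Tendsto (fun n : ℕ => 1 - gnwMeasure n {ω | ¬ δ * n ≤ (C1 (gnwGraph (fun x y => c * Wseq n x y) ω) : ℝ)}) atTop (𝓝 (1 - 0)) :=
      ENNReal.Tendsto.sub tendsto_const_nhds h0 (Or.inl ENNReal.one_ne_top)
    rw [tsub_zero] at h1
    refine h1.congr fun n => ?_
    rw [← prob_compl_eq_one_sub ((hs.ks n).gmeas (fun G => ¬ δ * n ≤ (C1 G : ℝ)))]
    congr 1
    ext ω
    change ¬ ¬ _ ↔ _
    rw [not_not]
    rfl
  · rw [hs.k.surv]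
    set R := ∫ x, rho (fun x y => c * W x y) x ∂lam
    refine hs.fin (fun n G => ε ≤ |(C1 G : ℝ) / n - R|)
      (((hs.UB (show 0 < R + ε by linarith) (half_pos hε)).and (Su.LBc hkW hi hc hs (half_pos hε))).mono ?_)
    filter_upwards [hs.bigK] with n hK X u h1 h2
    obtain ⟨h1, h3⟩ := h1
    have n0 := hK.2
    have : Nonempty (Fin n) := ⟨⟨0, by exact_mod_cast n0⟩⟩
    have pε : 0 < ε * n := by positivity
    rcases le_abs.1 h2 with h4 | h4
    · have h5 : (R + ε) * n ≤ (C1 (graphOf (cfg (pX (fun x y => c * Wseq n x y) X) u)) : ℝ) := by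
        rw [← le_div_iff₀ n0]; linarith
      have h6 := C1_Bg h5
      linarith
    · have h5 : (C1 (graphOf (cfg (pX (fun x y => c * Wseq n x y) X) u)) : ℝ) ≤ (R - ε) * n := by
        rw [← div_le_iff₀ n0]; linarith
      linarith
  · set R := ∫ x, rho (fun x y => c * W x y) x ∂lam
    have h3 : 0 < ε / 3 := by positivity
    refine hs.fin (fun n G => ε * n ≤ (C2 G : ℝ)) (((hs.UB hε h3).and (Su.LBc hkW hi hc hs h3)).mono ?_)
    filter_upwards [hs.bigK] with n hK X u h1 h2
    obtain ⟨h1, h4⟩ := h1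
    have n0 := hK.2
    have : Nonempty (Fin n) := ⟨⟨0, by exact_mod_cast n0⟩⟩
    have pε : 0 < ε * n := by positivity
    have h5 := C2_Bg pε h2
    linarith

end Percolation
end

open Percolation MeasureTheory Filter Topology in
/-- Let `(W_n)` be uniformly bounded graphons with `δ_□(W_n, W) → 0`
and `c > 0`. Then for the random graphs `G(n, cW_n)`: (a) if `c‖T_W‖ ≤ 1` the largest
component is `o_p(n)`; (b) if `c‖T_W‖ > 1` it has `Θ(n)` vertices whp; (c) if `W` is
irreducible then `C₁/n → ρ(cW)` in probability and `C₂ = o_p(n)`. -/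
theorem gnw_phase_transition
    (Wseq : ℕ → ℝ → ℝ → ℝ) (hWseq : ∀ n, IsGraphon (Wseq n))
    (M : ℝ) (hM : ∀ n x y, Wseq n x y ≤ M)
    (W : ℝ → ℝ → ℝ) (hW : IsGraphon W)
    (hconv : Tendsto (fun n => cutDist (Wseq n) W) atTop (nhds 0))
    (c : ℝ) (hc : 0 < c) :
    (c * opNorm W ≤ 1 →
      ∀ ε > 0, Tendsto
        (fun n : ℕ => gnwMeasure n
          {ω | ε * n ≤ (C1 (gnwGraph (fun x y => c * Wseq n x y) ω) : ℝ)})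
        atTop (nhds 0)) ∧
    (1 < c * opNorm W →
      ∃ δ : ℝ, 0 < δ ∧ Tendsto
        (fun n : ℕ => gnwMeasure n
          {ω | δ * n ≤ (C1 (gnwGraph (fun x y => c * Wseq n x y) ω) : ℝ)})
        atTop (nhds 1)) ∧
    (Percolation.Irreducible W →
      (∀ ε > 0, Tendsto
        (fun n : ℕ => gnwMeasure n
          {ω | ε ≤ |(C1 (gnwGraph (fun x y => c * Wseq n x y) ω) : ℝ) / n -
            survival fun x y => c * W x y|})
        atTop (nhds 0)) ∧
      (∀ ε > 0, Tendsto
        (fun n : ℕ => gnwMeasure n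
          {ω | ε * n ≤ (C2 (gnwGraph (fun x y => c * Wseq n x y) ω) : ℝ)})
        atTop (nhds 0))) := by
  exact Percolation.mainThm Wseq hWseq M hM W hW hconv c hc
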